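/- arXiv:1807.06114 — 8 statements merged into one kernel-verified Lean document; each statement's English description precedes it below -/
import Mathlib

section
/- Let A > 0, p > 1, λ > 0 and let H : [0,A] → ℝ be a positive C¹ function with (H(0)+1)/2 < (p+1)/(p−1). Then for every ε with 0 < ε < A and every positive integer k there exists d_k > 0 such that: for every d ≥ d_k, every C² function w : [0,A] → ℝ satisfying w''(r) + (H(r)/r)·w'(r) + λ·(|w(r)|^{p−1}·w(r) − w(r)) = 0 for all r ∈ (0,A], with w(0) = d and w'(0) = 0, has at least k zeroes in the interval (0,ε). -/
lemma aux_pow (p : ℝ) (hp : 1 < p) (C η : ℝ) (hC : 0 < C) (hη : 0 < η) :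
    ∃ C0 : ℝ, 0 < C0 ∧ ∀ x : ℝ, C * x ^ 2 ≤ η * |x| ^ (p + 1) + C0 := by
  set X : ℝ := (C / η) ^ (1 / (p - 1)) with hX
  have hXpos : 0 < X := Real.rpow_pos_of_pos (by positivity) _
  have hXp : X ^ (p - 1) = C / η := by
    rw [hX, ← Real.rpow_mul (by positivity), one_div_mul_cancel (by linarith), Real.rpow_one]
  refine ⟨C * X ^ 2, by positivity, fun x => ?_⟩
  rcases le_total X |x| with h | h
  · have h1 : X ^ (p - 1) ≤ |x| ^ (p - 1) := Real.rpow_le_rpow hXpos.le h (by linarith)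
    have hx : 0 < |x| := lt_of_lt_of_le hXpos h
    have h2 : |x| ^ (p + 1) = |x| ^ (p - 1) * x ^ 2 := by
      rw [show p + 1 = (p - 1) + (2:ℕ) by push_cast; ring, Real.rpow_add_natCast hx.ne', sq_abs]
    rw [h2]
    have h3 : C ≤ η * |x| ^ (p - 1) := by
      rw [hXp, div_le_iff₀ hη] at h1; linarith
    have := mul_le_mul_of_nonneg_right h3 (sq_nonneg x)
    nlinarith [sq_nonneg X]
  · have h1 : x ^ 2 ≤ X ^ 2 := by
      rw [← sq_abs]; exact pow_le_pow_left₀ (abs_nonneg _) h 2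
    have h2 : 0 ≤ |x| ^ (p + 1) := Real.rpow_nonneg (abs_nonneg _) _
    nlinarith [mul_nonneg hη.le h2, mul_le_mul_of_nonneg_left h1 hC.le]

lemma aux_abs (p : ℝ) (hp : 1 < p) (x : ℝ) : |x| ^ (p + 1) = |x| ^ (p - 1) * x * x := by
  rcases eq_or_ne x 0 with rfl | hx
  · simp; rw [Real.zero_rpow]; linarith
  · have hx' : 0 < |x| := abs_pos.mpr hx
    rw [show p + 1 = (p - 1) + (2:ℕ) by push_cast; ring, Real.rpow_add_natCast hx'.ne', sq_abs]
    ring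

lemma osc (p lam C L : ℝ) (hp : 1 < p) (hlam : 0 < lam) (hL : 0 < L) :
    ∃ M : ℝ, 0 < M ∧ ∀ (a : ℝ) (w v g : ℝ → ℝ),
      (∀ r ∈ Set.Icc a (a + L), HasDerivAt w (v r) r) →
      (∀ r ∈ Set.Icc a (a + L),
        HasDerivAt v (-(g r * v r) - lam * (|w r| ^ (p - 1) * w r - w r)) r) →
      (∀ r ∈ Set.Icc a (a + L), |g r| ≤ C) →
      (∀ r ∈ Set.Icc a (a + L), M ≤ w r ^ 2 + v r ^ 2) →
      ∃ r ∈ Set.Icc a (a + L), w r = 0 := by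
  set s : ℝ := 3 * Real.pi / L with hs
  have hspos : 0 < s := by have := Real.pi_pos; positivity
  set D : ℝ := s ^ 2 / 2 + C ^ 2 + lam with hD
  have hDpos : 0 < D := by positivity
  set K : ℝ := (D / lam) ^ (1 / (p - 1)) with hK
  have hKpos : 0 < K := Real.rpow_pos_of_pos (by positivity) _
  have hKp : lam * K ^ (p - 1) = D := by
    rw [hK, ← Real.rpow_mul (by positivity), one_div_mul_cancel (by linarith), Real.rpow_one]
    field_simp
  refine ⟨K ^ 2 + 4 * K ^ 2 * D, by positivity, ?_⟩
  intro a w v g hw hv hg hM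
  by_contra hcon
  push Not at hcon
  have hder : ∀ r ∈ Set.Icc a (a + L), HasDerivAt (fun r => Real.arctan (v r / w r / s))
      (1 / (1 + (v r / w r / s) ^ 2) *
        ((((-(g r * v r) - lam * (|w r| ^ (p - 1) * w r - w r)) * w r - v r * v r) / w r ^ 2) / s)) r := by
    intro r hr
    exact (((hv r hr).div (hw r hr) (hcon r hr)).div_const s).arctan
  have hbd : ∀ r ∈ Set.Icc a (a + L), 1 / (1 + (v r / w r / s) ^ 2) *
        ((((-(g r * v r) - lam * (|w r| ^ (p - 1) * w r - w r)) * w r - v r * v r) / w r ^ 2) / s)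
        ≤ - (s / 2) := by
    intro r hr
    have hw0 := hcon r hr
    set u := v r / w r with hu
    have hvu : v r = u * w r := by rw [hu]; field_simp
    have e1 : ((-(g r * v r) - lam * (|w r| ^ (p - 1) * w r - w r)) * w r - v r * v r) / w r ^ 2
        = - g r * u - lam * |w r| ^ (p - 1) + lam - u ^ 2 := by
      rw [hvu]; field_simp; ring
    rw [e1]
    have hgr := abs_le.mp (hg r hr)
    have hgu : - g r * u ≤ u ^ 2 / 4 + C ^ 2 := by
      have : g r ^ 2 ≤ C ^ 2 := sq_le_sq' hgr.1 hgr.2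
      nlinarith [sq_nonneg (u / 2 + g r)]
    have hpw : 0 ≤ lam * |w r| ^ (p - 1) := by positivity
    have key : - g r * u - lam * |w r| ^ (p - 1) + lam - u ^ 2 ≤ - (u ^ 2 + s ^ 2) / 2 := by
      rcases le_total K |w r| with h | h
      · have h1 : K ^ (p - 1) ≤ |w r| ^ (p - 1) := Real.rpow_le_rpow hKpos.le h (by linarith)
        have h2 := mul_le_mul_of_nonneg_left h1 hlam.le
        nlinarith [sq_nonneg u]
      · have h1 : w r ^ 2 ≤ K ^ 2 := by
          rw [← sq_abs]; exact pow_le_pow_left₀ (abs_nonneg _) h 2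
        have h2 := hM r hr
        have h3 : 4 * D ≤ u ^ 2 := by
          rw [hvu] at h2
          have h4 : 4 * K ^ 2 * D ≤ u ^ 2 * K ^ 2 := by nlinarith [sq_nonneg u]
          have : 0 < K ^ 2 := by positivity
          by_contra hh
          push Not at hh
          nlinarith
        nlinarith
    have e2 : 1 / (1 + (u / s) ^ 2) = s ^ 2 / (u ^ 2 + s ^ 2) := by
      field_simp; ring
    rw [e2]
    have hpos : 0 < u ^ 2 + s ^ 2 := by positivity
    calc s ^ 2 / (u ^ 2 + s ^ 2) * ((- g r * u - lam * |w r| ^ (p - 1) + lam - u ^ 2) / s)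
        ≤ s ^ 2 / (u ^ 2 + s ^ 2) * ((- (u ^ 2 + s ^ 2) / 2) / s) := by gcongr
      _ = - (s / 2) := by field_simp
  obtain ⟨ξ, hξ, hξe⟩ := exists_hasDerivAt_eq_slope (fun r => Real.arctan (v r / w r / s)) _
    (show a < a + L by linarith) (fun r hr => (hder r hr).continuousAt.continuousWithinAt)
    (fun r hr => hder r (Set.Ioo_subset_Icc_self hr))
  have h1 := hbd ξ (Set.Ioo_subset_Icc_self hξ)
  rw [hξe] at h1
  have h2 := Real.arctan_lt_pi_div_two (v a / w a / s)
  have h3 := Real.neg_pi_div_two_lt_arctan (v (a + L) / w (a + L) / s)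
  rw [add_sub_cancel_left, div_le_iff₀ hL] at h1
  have h4 : s * L = 3 * Real.pi := by rw [hs]; field_simp
  have := Real.pi_pos
  nlinarith

lemma mono_aux (a b : ℝ) (hab : a ≤ b) (f f' : ℝ → ℝ) (hc : ContinuousOn f (Set.Icc a b))
    (hd : ∀ r ∈ Set.Ioo a b, HasDerivAt f (f' r) r) (hn : ∀ r ∈ Set.Ioo a b, 0 ≤ f' r) :
    f a ≤ f b := by
  refine monotoneOn_of_deriv_nonneg (convex_Icc a b) hc ?_ ?_ (Set.left_mem_Icc.2 hab)
    (Set.right_mem_Icc.2 hab) hab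
  · rw [interior_Icc]; exact fun r hr => (hd r hr).differentiableAt.differentiableWithinAt
  · rw [interior_Icc]; intro r hr; rw [(hd r hr).deriv]; exact hn r hr

lemma hasDeriv_F (p lam : ℝ) (hp : 1 < p) (w v : ℝ → ℝ) (r : ℝ) (hw : HasDerivAt w (v r) r) :
    HasDerivAt (fun r => lam * (|w r| ^ (p + 1) / (p + 1) - w r ^ 2 / 2))
      (lam * (|w r| ^ (p - 1) * w r - w r) * v r) r := by
  have h1 := (hasDerivAt_abs_rpow (w r) (show 1 < p + 1 by linarith)).comp r hw
  have h2 := ((h1.div_const (p + 1)).sub ((hw.pow 2).div_const 2)).const_mul lam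
  refine h2.congr_deriv ?_
  have : p + 1 ≠ 0 := by linarith
  rw [show p + 1 - 2 = p - 1 by ring]
  field_simp
  norm_num
  ring

lemma cont_F (p lam : ℝ) (hp : 1 < p) (w : ℝ → ℝ) (S : Set ℝ) (hw : ContinuousOn w S) :
    ContinuousOn (fun r => lam * (|w r| ^ (p + 1) / (p + 1) - w r ^ 2 / 2)) S := by
  have : ContinuousOn (fun r => |w r| ^ (p + 1)) S :=
    hw.abs.rpow_const (fun x hx => Or.inr (by linarith))
  fun_prop

lemma energy (A p lam : ℝ) (hp : 1 < p) (hlam : 0 < lam)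
    (H : ℝ → ℝ) (Hpos : ∀ r ∈ Set.Icc (0 : ℝ) A, 0 < H r) :
    ∃ C2 : ℝ, 0 < C2 ∧ ∀ (d : ℝ) (w v : ℝ → ℝ), 1 ≤ d → w 0 = d → v 0 = 0 →
      ContinuousOn w (Set.Icc 0 A) → ContinuousOn v (Set.Icc 0 A) →
      (∀ r ∈ Set.Ioo 0 A, HasDerivAt w (v r) r) →
      (∀ r ∈ Set.Ioo 0 A,
        HasDerivAt v (-(H r / r * v r) - lam * (|w r| ^ (p - 1) * w r - w r)) r) →
      ∀ r ∈ Set.Ico 0 A, d - C2 * d ^ ((p + 1) / 2) * r ≤ w r := by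
  obtain ⟨C0, hC0, hC⟩ := aux_pow p hp (1 / 2) (1 / (p + 1)) (by norm_num)
    (by apply one_div_pos.2; linarith)
  refine ⟨Real.sqrt (2 * lam * (1 + C0)), by positivity, ?_⟩
  intro d w v hd hw0 hv0 hwc hvc hw hv
  have hvb : ∀ r ∈ Set.Ico 0 A, - (Real.sqrt (2 * lam * (1 + C0)) * d ^ ((p + 1) / 2)) ≤ v r := by
    intro r hr
    have hsub : Set.Icc 0 r ⊆ Set.Icc 0 A := Set.Icc_subset_Icc_right hr.2.le
    have hE := mono_aux 0 r hr.1
      (fun r => -(v r ^ 2 / 2 + lam * (|w r| ^ (p + 1) / (p + 1) - w r ^ 2 / 2)))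
      (fun r => H r / r * v r ^ 2)
      (((((hvc.mono hsub).pow 2).div_const 2).add (cont_F p lam hp w _ (hwc.mono hsub))).neg)
      (fun x hx => by
        have hx' : x ∈ Set.Ioo 0 A := ⟨hx.1, hx.2.trans hr.2⟩
        refine (((((hv x hx').pow 2).div_const 2).add (hasDeriv_F p lam hp w v x (hw x hx'))).neg).congr_deriv ?_
        norm_num
        ring)
      (fun x hx => by
        have hx' : x ∈ Set.Icc 0 A := ⟨hx.1.le, (hx.2.trans hr.2).le⟩
        have := Hpos x hx'
        have := hx.1
        positivity)
    simp only [hw0, hv0] at hE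
    have h1 := hC (w r)
    have hdp : 1 ≤ d ^ (p + 1) := Real.one_le_rpow hd (by linarith)
    have habs : |d| = d := abs_of_pos (by linarith)
    rw [habs] at hE
    have h2 : d ^ (p + 1) / (p + 1) ≤ d ^ (p + 1) := div_le_self (by linarith) (by linarith)
    have h3 : v r ^ 2 / 2 ≤ lam * (d ^ (p + 1) + C0) := by
      have h4 : d ^ (p + 1) / (p + 1) - d ^ 2 / 2 - (|w r| ^ (p + 1) / (p + 1) - w r ^ 2 / 2)
          ≤ d ^ (p + 1) + C0 := by
        have : 1 / (p + 1) * |w r| ^ (p + 1) = |w r| ^ (p + 1) / (p + 1) := by ring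
        nlinarith [sq_nonneg d]
      nlinarith [mul_le_mul_of_nonneg_left h4 hlam.le]
    have h5 : v r ^ 2 ≤ (Real.sqrt (2 * lam * (1 + C0)) * d ^ ((p + 1) / 2)) ^ 2 := by
      rw [mul_pow, Real.sq_sqrt (by positivity), ← Real.rpow_mul_natCast (by linarith)]
      rw [show (p + 1) / 2 * (2:ℕ) = p + 1 by push_cast; ring]
      have : lam * C0 ≤ lam * C0 * d ^ (p + 1) := le_mul_of_one_le_right (by positivity) hdp
      nlinarith
    exact (abs_le_of_sq_le_sq' h5 (by positivity)).1
  intro r hr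
  have hsub : Set.Icc 0 r ⊆ Set.Icc 0 A := Set.Icc_subset_Icc_right hr.2.le
  have := mono_aux 0 r hr.1 (fun r => w r + Real.sqrt (2 * lam * (1 + C0)) * d ^ ((p + 1) / 2) * r)
    (fun r => v r + Real.sqrt (2 * lam * (1 + C0)) * d ^ ((p + 1) / 2) * 1)
    ((hwc.mono hsub).add (by fun_prop))
    (fun x hx => (hw x ⟨hx.1, hx.2.trans hr.2⟩).add ((hasDerivAt_id x).const_mul _))
    (fun x hx => by have := hvb x ⟨hx.1.le, hx.2.trans hr.2⟩; linarith)
  simp only [hw0] at this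
  linarith

lemma pohozaev (A p lam : ℝ) (hA : 0 < A) (hp : 1 < p) (hlam : 0 < lam)
    (H : ℝ → ℝ) (Hpos : ∀ r ∈ Set.Icc (0 : ℝ) A, 0 < H r)
    (hsub : (H 0 + 1) / 2 < (p + 1) / (p - 1)) (K : ℝ) (hK : 0 < K)
    (hHK : ∀ r ∈ Set.Icc (0 : ℝ) A, |H r - H 0| ≤ K * r) :
    ∃ b c0 C0 r0 : ℝ, 0 < b ∧ 0 < c0 ∧ 0 < C0 ∧ 0 < r0 ∧ r0 < A ∧ ∀ (w v : ℝ → ℝ),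
      (∀ r ∈ Set.Ioo 0 A, HasDerivAt w (v r) r) →
      (∀ r ∈ Set.Ioo 0 A,
        HasDerivAt v (-(H r / r * v r) - lam * (|w r| ^ (p - 1) * w r - w r)) r) →
      ∃ G' : ℝ → ℝ, ∀ r ∈ Set.Ioo 0 r0, HasDerivAt (fun r => r ^ (H 0 + 1) *
        (v r ^ 2 / 2 + lam * (|w r| ^ (p + 1) / (p + 1) - w r ^ 2 / 2)) + b * r ^ (H 0) * (w r * v r)
        + C0 / (H 0 + 1) * r ^ (H 0 + 1)) (G' r) r ∧ c0 * r ^ (H 0) * |w r| ^ (p + 1) ≤ G' r := by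
  have hh : 0 < H 0 := Hpos 0 ⟨le_rfl, hA.le⟩
  set h := H 0 with hhdef
  have hp1 : 0 < p - 1 := by linarith
  have hp2 : 0 < p + 1 := by linarith
  obtain ⟨b, hb1, hb2⟩ : ∃ b, max 0 ((h - 1) / 2) < b ∧ b < (h + 1) / (p + 1) := by
    apply exists_between
    apply max_lt (by positivity)
    rw [lt_div_iff₀ hp1] at hsub
    rw [lt_div_iff₀ hp2]
    nlinarith
  have hb0 : 0 < b := lt_of_le_of_lt (le_max_left _ _) hb1
  have hb3 : (h - 1) / 2 < b := lt_of_le_of_lt (le_max_right _ _) hb1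
  obtain ⟨δ, hδ⟩ : ∃ δ, δ = (b - (h - 1) / 2) / 2 := ⟨_, rfl⟩
  have hδ0 : 0 < δ := by rw [hδ]; linarith
  obtain ⟨c0, hc0⟩ : ∃ c0, c0 = lam * ((h + 1) / (p + 1) - b) / 2 := ⟨_, rfl⟩
  have hc00 : 0 < c0 := by
    rw [hc0]; have : 0 < (h + 1) / (p + 1) - b := by linarith
    positivity
  obtain ⟨C0, hC0, hC⟩ := aux_pow p hp (lam * (h + 1) + (b * K) ^ 2 / (4 * δ)) c0 (by positivity) hc00
  refine ⟨b, c0, C0, min (A / 2) (δ / K), hb0, hc00, hC0, by positivity,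
    lt_of_le_of_lt (min_le_left _ _) (by linarith), ?_⟩
  intro w v hw hv
  refine ⟨fun r => r ^ h * ((h + 1) * (v r ^ 2 / 2 + lam * (|w r| ^ (p + 1) / (p + 1) - w r ^ 2 / 2))
    - H r * v r ^ 2 + b * (v r ^ 2 - w r * (lam * (|w r| ^ (p - 1) * w r - w r)))
    + b * ((h - H r) / r) * (w r * v r) + C0), ?_⟩
  intro r hr
  have hr0 : 0 < r := hr.1
  have hrA : r ∈ Set.Ioo 0 A := ⟨hr0, by have := hr.2.trans_le (min_le_left _ _); linarith⟩
  have hrd : K * r ≤ δ := by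
    have := hr.2.trans_le (min_le_right _ _)
    rw [lt_div_iff₀ hK] at this; linarith
  constructor
  · have d1 := Real.hasDerivAt_rpow_const (x := r) (p := h + 1) (Or.inl hr0.ne')
    have d2 := Real.hasDerivAt_rpow_const (x := r) (p := h) (Or.inl hr0.ne')
    have dE := (((hv r hrA).pow 2).div_const 2).add (hasDeriv_F p lam hp w v r (hw r hrA))
    have := ((d1.mul dE).add ((d2.const_mul b).mul ((hw r hrA).mul (hv r hrA)))).add
      (d1.const_mul (C0 / (h + 1)))
    refine this.congr_deriv ?_
    have e1 : r ^ (h + 1) = r ^ h * r := Real.rpow_add_one hr0.ne' h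
    have e2 : r ^ (h - 1) = r ^ h / r := Real.rpow_sub_one hr0.ne' h
    have e3 : h + 1 - 1 = h := by ring
    simp only [e3, e1, e2, Pi.add_apply, Pi.mul_apply, Pi.pow_apply]
    have : h + 1 ≠ 0 := by linarith
    generalize |w r| ^ (p - 1) = X
    generalize |w r| ^ (p + 1) = Y
    field_simp
    norm_num
    ring
  · have hrh : 0 < r ^ h := Real.rpow_pos_of_pos hr0 h
    have hHr := hHK r ⟨hr0.le, hrA.2.le⟩
    set q := (h - H r) / r with hq
    have hqK : |q| ≤ K := by
      rw [hq, abs_div, abs_of_pos hr0, div_le_iff₀ hr0, abs_sub_comm]; exact hHr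
    have hHr2 : H r ≤ h + δ := by have := (abs_le.mp hHr).2; linarith
    have hX : w r * (lam * (|w r| ^ (p - 1) * w r - w r)) = lam * (|w r| ^ (p + 1) - w r ^ 2) := by
      rw [aux_abs p hp]; ring
    have hq2 : q ^ 2 ≤ K ^ 2 := sq_le_sq' (abs_le.mp hqK).1 (abs_le.mp hqK).2
    have hcross : 0 ≤ δ * v r ^ 2 + b * q * (w r * v r) + (b * K) ^ 2 / (4 * δ) * w r ^ 2 := by
      have e : δ * v r ^ 2 + b * q * (w r * v r) + (b * K) ^ 2 / (4 * δ) * w r ^ 2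
        = δ * (v r + b * q * w r / (2 * δ)) ^ 2 + b ^ 2 * (K ^ 2 - q ^ 2) / (4 * δ) * w r ^ 2 := by
        field_simp; ring
      rw [e]
      have : 0 ≤ K ^ 2 - q ^ 2 := by linarith
      positivity
    have hCw := hC (w r)
    rw [mul_comm c0, mul_assoc]
    apply mul_le_mul_of_nonneg_left _ hrh.le
    rw [hX]
    have hY : 2 * c0 * |w r| ^ (p + 1) = lam * (h + 1) * (|w r| ^ (p + 1) / (p + 1)) - b * lam * |w r| ^ (p + 1) := by
      rw [hc0]; ring
    have hH : H r * v r ^ 2 ≤ (h + δ) * v r ^ 2 := mul_le_mul_of_nonneg_right hHr2 (sq_nonneg _)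
    have hbd : b = 2 * δ + (h - 1) / 2 := by rw [hδ]; ring
    have hbv : b * v r ^ 2 = (2 * δ + (h - 1) / 2) * v r ^ 2 := by rw [← hbd]
    have hlw : 0 ≤ lam * (h + 1) * w r ^ 2 := by positivity
    have hblw : 0 ≤ b * lam * w r ^ 2 := by positivity
    linarith

set_option maxHeartbeats 1000000 in
lemma growth (A p lam : ℝ) (hA : 0 < A) (hp : 1 < p) (hlam : 0 < lam)
    (H : ℝ → ℝ) (Hpos : ∀ r ∈ Set.Icc (0 : ℝ) A, 0 < H r)
    (hsub : (H 0 + 1) / 2 < (p + 1) / (p - 1)) (K : ℝ) (hK : 0 < K)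
    (hHK : ∀ r ∈ Set.Icc (0 : ℝ) A, |H r - H 0| ≤ K * r) (ε : ℝ) (hε : 0 < ε) :
    ∃ R : ℝ, 0 < R ∧ R ≤ ε ∧ R < A ∧ ∀ M : ℝ, 0 < M → ∃ dk : ℝ, 0 < dk ∧
      ∀ (d : ℝ) (w v : ℝ → ℝ), dk ≤ d → w 0 = d → v 0 = 0 →
      ContinuousOn w (Set.Icc 0 A) → ContinuousOn v (Set.Icc 0 A) →
      (∀ r ∈ Set.Ioo 0 A, HasDerivAt w (v r) r) →
      (∀ r ∈ Set.Ioo 0 A,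
        HasDerivAt v (-(H r / r * v r) - lam * (|w r| ^ (p - 1) * w r - w r)) r) →
      ∀ r ∈ Set.Icc (R / 2) R, M ≤ w r ^ 2 + v r ^ 2 := by
  have hh : 0 < H 0 := Hpos 0 ⟨le_rfl, hA.le⟩
  obtain ⟨b, c0, C0, r0, hb, hc0, hC0, hr0, hr0A, hpo⟩ :=
    pohozaev A p lam hA hp hlam H Hpos hsub K hK hHK
  obtain ⟨C2, hC2, hen⟩ := energy A p lam hp hlam H Hpos
  set h := H 0 with hhdef
  have hp1 : 0 < p - 1 := by linarith
  have hp2 : 0 < p + 1 := by linarith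
  obtain ⟨R, hR⟩ : ∃ R, R = min (min r0 ε) 1 := ⟨_, rfl⟩
  have hR0 : 0 < R := by rw [hR]; positivity
  have hRr0 : R ≤ r0 := by rw [hR]; exact (min_le_left _ _).trans (min_le_left _ _)
  have hRε : R ≤ ε := by rw [hR]; exact (min_le_left _ _).trans (min_le_right _ _)
  have hR1 : R ≤ 1 := by rw [hR]; exact min_le_right _ _
  refine ⟨R, hR0, hRε, by linarith, ?_⟩
  intro M hM
  obtain ⟨T, hT⟩ : ∃ T, T = M / 2 + lam * (Real.sqrt M ^ (p + 1) / (p + 1)) + b * M + C0 / (h + 1) :=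
    ⟨_, rfl⟩
  obtain ⟨c3, hc3⟩ : ∃ c3, c3 = c0 * (1 / 2) ^ (p + 1) / (h + 1) * (1 / (2 * C2)) ^ (h + 1) := ⟨_, rfl⟩
  have hc30 : 0 < c3 := by rw [hc3]; positivity
  obtain ⟨β, hβ⟩ : ∃ β, β = (p + 1) + (1 - p) / 2 * (h + 1) := ⟨_, rfl⟩
  have hβ0 : 0 < β := by
    rw [hβ]; rw [lt_div_iff₀ hp1] at hsub; nlinarith
  have ev1 : ∀ᶠ d : ℝ in Filter.atTop, T / c3 < d ^ β :=
    (tendsto_rpow_atTop hβ0).eventually_gt_atTop _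
  have ev2 : ∀ᶠ d : ℝ in Filter.atTop, d ^ ((1 - p) / 2) < 2 * C2 * (R / 2) := by
    have := tendsto_rpow_neg_atTop (y := (p - 1) / 2) (by positivity)
    have h2 := this.eventually_lt_const (show 0 < 2 * C2 * (R / 2) by positivity)
    rwa [show -((p - 1) / 2) = (1 - p) / 2 by ring] at h2
  obtain ⟨d0, hd0⟩ := Filter.eventually_atTop.1 (ev1.and ev2)
  refine ⟨max d0 1, by positivity, ?_⟩
  intro d w v hd hw0 hv0 hwc hvc hw hv r hr
  have hd1 : 1 ≤ d := (le_max_right _ _).trans hd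
  have hdpos : 0 < d := by linarith
  obtain ⟨hdT, hdR⟩ := hd0 d ((le_max_left _ _).trans hd)
  obtain ⟨G', hG⟩ := hpo w v hw hv
  have hen := hen d w v hd1 hw0 hv0 hwc hvc hw hv
  obtain ⟨G, hGdef⟩ : ∃ G : ℝ → ℝ, G = (fun r => r ^ (h + 1) *
        (v r ^ 2 / 2 + lam * (|w r| ^ (p + 1) / (p + 1) - w r ^ 2 / 2)) + b * r ^ h * (w r * v r)
        + C0 / (h + 1) * r ^ (h + 1)) := ⟨_, rfl⟩
  rw [← hGdef] at hG
  have hpc : ∀ q : ℝ, 0 < q → ContinuousOn (fun x : ℝ => x ^ q) (Set.Icc 0 A) := fun q hq =>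
    (Real.continuous_rpow_const hq.le).continuousOn
  have hGc : ContinuousOn G (Set.Icc 0 A) := by
    rw [hGdef]
    have c1 := hpc (h + 1) (by linarith)
    have c2 := hpc h hh
    exact ((c1.mul (((hvc.pow 2).div_const 2).add (cont_F p lam hp w _ hwc))).add
      ((continuousOn_const.mul c2).mul (hwc.mul hvc))).add (continuousOn_const.mul c1)
  obtain ⟨r1, hr1⟩ : ∃ r1, r1 = d ^ ((1 - p) / 2) * (1 / (2 * C2)) := ⟨_, rfl⟩
  have hr10 : 0 < r1 := by rw [hr1]; positivity
  have hr1R : r1 < R / 2 := by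
    rw [hr1, mul_one_div, div_lt_iff₀ (by positivity)]; linarith
  have hrr1 : r1 ≤ r := by linarith [hr.1]
  have hrR := hr.2
  have hrpos : 0 < r := by linarith
  have hG0 : G 0 = 0 := by
    rw [hGdef]; simp [Real.zero_rpow hh.ne', Real.zero_rpow (show h + 1 ≠ 0 by linarith)]
  -- lower bound for w on [0, r1]
  have hwl : ∀ x ∈ Set.Ioo 0 r1, d / 2 ≤ w x := by
    intro x hx
    have h1 := hen x ⟨hx.1.le, by linarith [hx.2]⟩
    have h2 : C2 * d ^ ((p + 1) / 2) * x ≤ C2 * d ^ ((p + 1) / 2) * r1 :=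
      mul_le_mul_of_nonneg_left hx.2.le (by positivity)
    have h3 : d ^ ((p + 1) / 2) * d ^ ((1 - p) / 2) = d := by
      rw [← Real.rpow_add hdpos]
      rw [show (p + 1) / 2 + (1 - p) / 2 = 1 by ring, Real.rpow_one]
    have h4 : C2 * d ^ ((p + 1) / 2) * r1 = d / 2 := by
      rw [hr1]
      calc C2 * d ^ ((p + 1) / 2) * (d ^ ((1 - p) / 2) * (1 / (2 * C2)))
          = (d ^ ((p + 1) / 2) * d ^ ((1 - p) / 2)) / 2 := by field_simp
        _ = d / 2 := by rw [h3]
    linarith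
  obtain ⟨κ, hκ⟩ : ∃ κ, κ = c0 * (d / 2) ^ (p + 1) / (h + 1) := ⟨_, rfl⟩
  have step1 := mono_aux 0 r1 hr10.le (fun x => G x - κ * x ^ (h + 1))
    (fun x => G' x - κ * ((h + 1) * x ^ (h + 1 - 1)))
    ((hGc.sub (continuousOn_const.mul (hpc (h + 1) (by linarith)))).mono
      (Set.Icc_subset_Icc_right (by linarith)))
    (fun x hx => (hG x ⟨hx.1, by linarith [hx.2]⟩).1.sub
      ((Real.hasDerivAt_rpow_const (Or.inl hx.1.ne')).const_mul κ))
    (fun x hx => by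
      have h1 := (hG x ⟨hx.1, by linarith [hx.2]⟩).2
      have h2 : (d / 2) ^ (p + 1) ≤ |w x| ^ (p + 1) :=
        Real.rpow_le_rpow (by positivity) ((hwl x hx).trans (le_abs_self _)) hp2.le
      have hxh : 0 < x ^ h := Real.rpow_pos_of_pos hx.1 h
      have h3 : κ * ((h + 1) * x ^ (h + 1 - 1)) = c0 * x ^ h * (d / 2) ^ (p + 1) := by
        rw [hκ, show h + 1 - 1 = h by ring]; field_simp
      have h4 : c0 * x ^ h * (d / 2) ^ (p + 1) ≤ c0 * x ^ h * |w x| ^ (p + 1) :=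
        mul_le_mul_of_nonneg_left h2 (by positivity)
      simp only [h3]; linarith)
  have step2 := mono_aux r1 r hrr1 G G'
    (hGc.mono (Set.Icc_subset_Icc hr10.le (by linarith)))
    (fun x hx => (hG x ⟨by linarith [hx.1], by linarith [hx.2]⟩).1)
    (fun x hx => by
      have hx0 : 0 < x := by linarith [hx.1]
      refine le_trans ?_ (hG x ⟨by linarith [hx.1], by linarith [hx.2]⟩).2
      positivity)
  have hval : κ * r1 ^ (h + 1) = c3 * d ^ β := by
    rw [hκ, hr1, hc3, hβ, Real.mul_rpow (by positivity) (by positivity), ← Real.rpow_mul hdpos.le,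
      Real.rpow_add hdpos, div_eq_mul_one_div d 2, Real.mul_rpow (by positivity) (by positivity)]
    ring
  simp only [hG0, Real.zero_rpow (show h + 1 ≠ 0 by linarith), hval] at step1
  have hGT : T < G r := by
    rw [div_lt_iff₀ hc30] at hdT
    linarith
  by_contra hcon
  push Not at hcon
  have hwM : |w r| ≤ Real.sqrt M := Real.abs_le_sqrt (by nlinarith [sq_nonneg (v r)])
  have hrh : r ^ h ≤ 1 := Real.rpow_le_one hrpos.le (by linarith) hh.le
  have hrh1 : r ^ (h + 1) ≤ 1 := Real.rpow_le_one hrpos.le (by linarith) (by linarith)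
  have hrh0 : 0 < r ^ h := by positivity
  have hrh10 : 0 < r ^ (h + 1) := by positivity
  have hwp : |w r| ^ (p + 1) / (p + 1) ≤ Real.sqrt M ^ (p + 1) / (p + 1) := by gcongr
  have t1 : r ^ (h + 1) * (v r ^ 2 / 2 + lam * (|w r| ^ (p + 1) / (p + 1) - w r ^ 2 / 2))
      ≤ M / 2 + lam * (Real.sqrt M ^ (p + 1) / (p + 1)) := by
    have s1 : v r ^ 2 / 2 + lam * (|w r| ^ (p + 1) / (p + 1) - w r ^ 2 / 2)
      ≤ M / 2 + lam * (Real.sqrt M ^ (p + 1) / (p + 1)) := by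
      have := mul_le_mul_of_nonneg_left hwp hlam.le
      nlinarith [mul_nonneg hlam.le (sq_nonneg (w r)), sq_nonneg (w r)]
    have s2 : 0 ≤ M / 2 + lam * (Real.sqrt M ^ (p + 1) / (p + 1)) := by positivity
    nlinarith
  have t2 : b * r ^ h * (w r * v r) ≤ b * M := by
    have s1 : w r * v r ≤ M := by nlinarith [sq_nonneg (w r - v r), sq_nonneg (w r + v r)]
    calc b * r ^ h * (w r * v r) ≤ b * r ^ h * M := mul_le_mul_of_nonneg_left s1 (by positivity)
      _ ≤ b * 1 * M := by gcongr
      _ = b * M := by ring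
  have t3 : C0 / (h + 1) * r ^ (h + 1) ≤ C0 / (h + 1) := mul_le_of_le_one_right (by positivity) hrh1
  have : G r ≤ T := by rw [hGdef, hT]; simp only; linarith
  linarith

lemma main_aux
    (A p lam : ℝ) (hA : 0 < A) (hp : 1 < p) 
    (H : ℝ → ℝ) (Hpos : ∀ r ∈ Set.Icc (0 : ℝ) A, 0 < H r)
    (HC1 : ContDiffOn ℝ 1 H (Set.Icc 0 A)) (w : ℝ → ℝ) (hw : ContDiffOn ℝ 2 w (Set.Icc 0 A))
    (hode : ∀ r ∈ Set.Ioc (0 : ℝ) A,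
              deriv (deriv w) r + (H r / r) * deriv w r
                + lam * (|w r| ^ (p - 1) * w r - w r) = 0) :
    ∃ v : ℝ → ℝ, v 0 = 0 ∧ ContinuousOn w (Set.Icc 0 A) ∧ ContinuousOn v (Set.Icc 0 A) ∧
      (∀ r ∈ Set.Ioo 0 A, HasDerivAt w (v r) r) ∧
      (∀ r ∈ Set.Ioo 0 A,
        HasDerivAt v (-(H r / r * v r) - lam * (|w r| ^ (p - 1) * w r - w r)) r) := by
  have hu : UniqueDiffOn ℝ (Set.Icc 0 A) := uniqueDiffOn_Icc hA
  have hnhds : ∀ r ∈ Set.Ioo 0 A, Set.Icc 0 A ∈ nhds r := fun r hr => Icc_mem_nhds hr.1 hr.2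
  obtain ⟨v, hvdef⟩ : ∃ v, v = derivWithin w (Set.Icc 0 A) := ⟨_, rfl⟩
  have hv1 : ContDiffOn ℝ 1 v (Set.Icc 0 A) := by
    rw [hvdef]; exact hw.derivWithin hu (by norm_num)
  have hwd : ∀ r ∈ Set.Ioo 0 A, HasDerivAt w (v r) r := by
    intro r hr
    have := (hw.differentiableOn (by norm_num) r (Set.Ioo_subset_Icc_self hr)).hasDerivWithinAt
    rw [hvdef]; exact this.hasDerivAt (hnhds r hr)
  have hvd : ∀ r ∈ Set.Ioo 0 A, HasDerivAt v (derivWithin v (Set.Icc 0 A) r) r := by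
    intro r hr
    have := (hv1.differentiableOn (by norm_num) r (Set.Ioo_subset_Icc_self hr)).hasDerivWithinAt
    exact this.hasDerivAt (hnhds r hr)
  have hode2 : ∀ r ∈ Set.Ioo 0 A, derivWithin v (Set.Icc 0 A) r
      = -(H r / r * v r) - lam * (|w r| ^ (p - 1) * w r - w r) := by
    intro r hr
    have h1 := hode r ⟨hr.1, hr.2.le⟩
    have h2 : deriv w =ᶠ[nhds r] v := by
      filter_upwards [Ioo_mem_nhds hr.1 hr.2] with x hx using (hwd x hx).deriv
    rw [h2.deriv_eq, (hvd r hr).deriv, (hwd r hr).deriv] at h1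
    linarith
  have hvc := hv1.continuousOn
  have hwc := hw.continuousOn
  have hv'c : ContinuousOn (derivWithin v (Set.Icc 0 A)) (Set.Icc 0 A) :=
    hv1.continuousOn_derivWithin hu (by norm_num)
  have hpc : ContinuousOn (fun r => |w r| ^ (p - 1)) (Set.Icc 0 A) :=
    hwc.abs.rpow_const (fun x hx => Or.inr (by linarith))
  have hHc := HC1.continuousOn
  have heq : Set.EqOn (fun r => H r * v r)
      (fun r => -(r * (derivWithin v (Set.Icc 0 A) r + lam * (|w r| ^ (p - 1) * w r - w r))))
      (Set.Icc 0 A) := by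
    refine Set.EqOn.of_subset_closure (s := Set.Ioo 0 A) ?_ (by fun_prop) (by fun_prop)
      Set.Ioo_subset_Icc_self (by rw [closure_Ioo hA.ne])
    intro r hr
    have := hr.1.ne'
    simp only [hode2 r hr]
    field_simp
    ring
  have h0 := heq (Set.left_mem_Icc.2 hA.le)
  simp only [zero_mul, neg_zero] at h0
  refine ⟨v, ?_, hwc, hvc, hwd, fun r hr => hode2 r hr ▸ hvd r hr⟩
  exact (mul_eq_zero.1 h0).resolve_left (Hpos 0 (Set.left_mem_Icc.2 hA.le)).ne'

/-- Theorem 3.1: solutions of the general singular ODE with large initial value `d`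
have at least `k` zeroes in `(0, ε)`. -/
theorem zeroes_near_singularity_general_singular_ODE
    (A p lam : ℝ) (hA : 0 < A) (hp : 1 < p) (hlam : 0 < lam)
    (H : ℝ → ℝ) (Hpos : ∀ r ∈ Set.Icc (0 : ℝ) A, 0 < H r)
    (HC1 : ContDiffOn ℝ 1 H (Set.Icc 0 A))
    (hsub : (H 0 + 1) / 2 < (p + 1) / (p - 1)) :
    ∀ ε : ℝ, 0 < ε → ε < A → ∀ k : ℕ, 0 < k →
      ∃ dk : ℝ, 0 < dk ∧
        ∀ d : ℝ, dk ≤ d →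
          ∀ w : ℝ → ℝ, ContDiffOn ℝ 2 w (Set.Icc 0 A) →
            (∀ r ∈ Set.Ioc (0 : ℝ) A,
              deriv (deriv w) r + (H r / r) * deriv w r
                + lam * (|w r| ^ (p - 1) * w r - w r) = 0) →
            w 0 = d → deriv w 0 = 0 →
            ∃ Z : Finset ℝ, (Z : Set ℝ) ⊆ {r ∈ Set.Ioo (0 : ℝ) ε | w r = 0} ∧ k ≤ Z.card := by
  intro ε hε hεA k hk
  have h0mem : (0:ℝ) ∈ Set.Icc 0 A := Set.left_mem_Icc.2 hA.le
  obtain ⟨K, hK, hHK⟩ : ∃ K : ℝ, 0 < K ∧ ∀ r ∈ Set.Icc (0 : ℝ) A, |H r - H 0| ≤ K * r := by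
    have hc := HC1.continuousOn_derivWithin (uniqueDiffOn_Icc hA) (by norm_num)
    obtain ⟨K, hK⟩ := isCompact_Icc.exists_bound_of_continuousOn hc
    refine ⟨max K 1, by positivity, fun r hr => ?_⟩
    have := (convex_Icc (0:ℝ) A).norm_image_sub_le_of_norm_derivWithin_le
      (HC1.differentiableOn (by norm_num)) (fun x hx => (hK x hx).trans (le_max_left K 1)) h0mem hr
    simpa [abs_of_nonneg hr.1] using this
  obtain ⟨R, hR0, hRε, hRA, hgr⟩ := growth A p lam hA hp hlam H Hpos hsub K hK hHK ε hε
  have hkp : (0:ℝ) < k := by exact_mod_cast hk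
  obtain ⟨L, hL⟩ : ∃ L, L = R / (4 * k) := ⟨_, rfl⟩
  have hL0 : 0 < L := by rw [hL]; positivity
  have hkL : k * L = R / 4 := by rw [hL]; field_simp
  obtain ⟨M, hM0, hM⟩ := osc p lam ((H 0 + K * A) / (R / 2)) L hp hlam hL0
  obtain ⟨dk, hdk0, hdk⟩ := hgr M hM0
  refine ⟨dk, hdk0, ?_⟩
  intro d hd w hw hode hw0 _
  obtain ⟨v, hv0, hwc, hvc, hwd, hvd⟩ := main_aux A p lam hA hp H Hpos HC1 w hw hode
  have hbig := hdk d w v hd hw0 hv0 hwc hvc hwd hvd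
  have hz : ∀ i : Fin k, ∃ r ∈ Set.Icc (R / 2 + 2 * i * L) (R / 2 + 2 * i * L + L), w r = 0 := by
    intro i
    have hi : ((i:ℕ):ℝ) + 1 ≤ k := by exact_mod_cast i.2
    have hi0 : (0:ℝ) ≤ (i:ℕ) := Nat.cast_nonneg _
    have hiL : ((i:ℕ) + 1) * L ≤ R / 4 := by
      rw [← hkL]; exact mul_le_mul_of_nonneg_right hi hL0.le
    have hiL0 : 0 ≤ (i:ℕ) * L := by positivity
    have hs : ∀ r ∈ Set.Icc (R / 2 + 2 * i * L) (R / 2 + 2 * i * L + L), r ∈ Set.Icc (R / 2) R := by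
      intro r hr
      exact ⟨by linarith [hr.1], by linarith [hr.2]⟩
    have hs2 : ∀ r ∈ Set.Icc (R / 2 + 2 * i * L) (R / 2 + 2 * i * L + L), r ∈ Set.Ioo 0 A := by
      intro r hr
      exact ⟨by linarith [(hs r hr).1], by linarith [(hs r hr).2]⟩
    refine hM _ w v (fun r => H r / r) (fun r hr => hwd r (hs2 r hr)) (fun r hr => hvd r (hs2 r hr))
      (fun r hr => ?_) (fun r hr => hbig r (hs r hr))
    have hr' := hs2 r hr
    have hr'' := Set.Ioo_subset_Icc_self hr'
    have hHr := Hpos r hr''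
    rw [abs_of_pos (div_pos hHr hr'.1)]
    have h1 := (abs_le.mp (hHK r hr'')).2
    have h2 : K * r ≤ K * A := mul_le_mul_of_nonneg_left hr'.2.le hK.le
    exact div_le_div₀ (by linarith) (by linarith) (by positivity) (hs r hr).1
  choose z hz1 hz2 using hz
  have hmono : StrictMono z := by
    intro i j hij
    have hij' : ((i:ℕ):ℝ) + 1 ≤ (j:ℕ) := by exact_mod_cast hij
    have h1 := (hz1 i).2
    have h2 := (hz1 j).1
    have := mul_le_mul_of_nonneg_right hij' hL0.le
    linarith
  refine ⟨Finset.univ.image z, ?_, ?_⟩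
  · intro x hx
    simp only [Finset.coe_image, Finset.coe_univ, Set.image_univ, Set.mem_range] at hx
    obtain ⟨i, rfl⟩ := hx
    have hi : ((i:ℕ):ℝ) + 1 ≤ k := by exact_mod_cast i.2
    have hi0 : (0:ℝ) ≤ (i:ℕ) := Nat.cast_nonneg _
    have hiL : ((i:ℕ) + 1) * L ≤ R / 4 := by
      rw [← hkL]; exact mul_le_mul_of_nonneg_right hi hL0.le
    have hiL0 : 0 ≤ (i:ℕ) * L := by positivity
    have h1 := (hz1 i).1
    have h2 := (hz1 i).2
    exact ⟨⟨by linarith, by linarith⟩, hz2 i⟩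
  · rw [Finset.card_image_of_injective _ hmono.injective]; simp
end

section
/- Let H₀ ≥ 0 and p > 1 satisfy (H₀+1)/2 < (p+1)/(p−1). Then every C² function v : [0,∞) → ℝ satisfying v''(r) + (H₀/r)·v'(r) + |v(r)|^{p−1}·v(r) = 0 for all r ∈ (0,∞), with v(0) = 1 and v'(0) = 0, has infinitely many zeroes in (0,∞); that is, the set {r ∈ (0,∞) : v(r) = 0} is infinite. -/
lemma aux_W (H0 p : ℝ) (v w : ℝ → ℝ) (r : ℝ) (hr : 0 < r)
    (hw : HasDerivAt w (-(H0 / r) * w r - |v r| ^ (p - 1) * v r) r) :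
    HasDerivAt (fun s => s ^ H0 * w s) (-(r ^ H0 * (|v r| ^ (p - 1) * v r))) r := by
  have h1 := (Real.hasDerivAt_rpow_const (x := r) (p := H0) (Or.inl hr.ne')).mul hw
  refine h1.congr_deriv ?_
  rw [Real.rpow_sub_one hr.ne']
  field_simp
  ring

noncomputable def auxP (H0 p a : ℝ) (v w : ℝ → ℝ) (s : ℝ) : ℝ :=
  s ^ (H0 + 1) * ((w s) ^ 2 / 2 + |v s| ^ (p + 1) / (p + 1)) + a * (s ^ H0 * w s * v s)

lemma abs_rpow_mul (p x : ℝ) (hp : 1 < p) : |x| ^ (p - 1) * x * x = |x| ^ (p + 1) := by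
  have : x * x = |x| ^ (2:ℝ) := by
    rw [Real.rpow_two, sq_abs, sq]
  rw [mul_assoc, this]
  by_cases hx : x = 0
  · subst hx
    simp only [abs_zero]
    rw [Real.zero_rpow (x := p + 1) (by linarith), Real.zero_rpow (x := 2) (by norm_num), mul_zero]
  · rw [← Real.rpow_add (abs_pos.2 hx)]; congr 1; ring

lemma aux_P (H0 p a : ℝ) (hp : 1 < p) (v w : ℝ → ℝ) (r : ℝ) (hr : 0 < r)
    (hv : HasDerivAt v (w r) r)
    (hw : HasDerivAt w (-(H0 / r) * w r - |v r| ^ (p - 1) * v r) r) :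
    HasDerivAt (auxP H0 p a v w) (r ^ H0 * ((a - (H0 - 1) / 2) * (w r) ^ 2
      + ((H0 + 1) / (p + 1) - a) * |v r| ^ (p + 1))) r := by
  have h1 := (Real.hasDerivAt_rpow_const (x := r) (p := H0 + 1) (Or.inl hr.ne'))
  have h2 := (hasDerivAt_abs_rpow (v r) (p := p + 1) (by linarith)).comp r hv
  have h3 := (aux_W H0 p v w r hr hw)
  have h4 := (h1.mul (((hw.pow 2).div_const 2).add (h2.div_const (p + 1)))).add
    ((h3.mul hv).const_mul a)
  refine h4.congr_deriv ?_
  have e1 : p + 1 - 2 = p - 1 := by ring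
  have e2 : H0 + 1 - 1 = H0 := by ring
  simp only [Function.comp, Pi.add_apply, Pi.pow_apply, Pi.mul_apply]
  rw [e1, e2, Real.rpow_add_one hr.ne', ← abs_rpow_mul p _ hp]
  have : p + 1 ≠ 0 := by linarith
  field_simp
  norm_num
  ring

/-- eventually positive solutions: the Pohozaev functional gets small -/
lemma aux_pos (H0 p a : ℝ) (hH0 : 0 ≤ H0) (hp : 1 < p) (ha : 0 ≤ a)
    (hsub : (H0 + 1) / 2 < (p + 1) / (p - 1)) (v w : ℝ → ℝ)
    (hv : ∀ r, 0 < r → HasDerivAt v (w r) r)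
    (hw : ∀ r, 0 < r → HasDerivAt w (-(H0 / r) * w r - |v r| ^ (p - 1) * v r) r)
    (R : ℝ) (hR : 0 < R) (hpos : ∀ r, R ≤ r → 0 < v r) (δ : ℝ) (hδ : 0 < δ) (T : ℝ) :
    ∃ s, T ≤ s ∧ 0 < s ∧ auxP H0 p a v w s < δ := by
  have hvp : ∀ r, R ≤ r → |v r| ^ (p - 1) * v r = v r ^ p := by
    intro r hr
    have := hpos r hr
    rw [abs_of_pos this, ← Real.rpow_add_one this.ne']; congr 1; ring
  have hW : ∀ r, R ≤ r → HasDerivAt (fun s => s ^ H0 * w s) (-(r ^ H0 * v r ^ p)) r := by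
    intro r hr
    rw [← hvp r hr]
    exact aux_W H0 p v w r (by linarith) (hw r (by linarith))
  -- w is negative somewhere
  have hneg1 : ∃ R1, R ≤ R1 ∧ w R1 < 0 := by
    by_contra! hcon
    have hmono : MonotoneOn v (Set.Ici R) := by
      apply monotoneOn_of_hasDerivWithinAt_nonneg (f' := w) (convex_Ici R)
      · intro x hx
        exact (hv x (lt_of_lt_of_le hR hx)).continuousAt.continuousWithinAt
      · intro x hx
        rw [interior_Ici] at hx
        exact (hv x (hR.trans hx)).hasDerivWithinAt
      · intro x hx
        rw [interior_Ici] at hx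
        exact hcon x (le_of_lt hx)
    set c := R ^ H0 * v R ^ p with hc
    have hcpos : 0 < c := mul_pos (Real.rpow_pos_of_pos hR _) (Real.rpow_pos_of_pos (hpos R le_rfl) _)
    have hanti : AntitoneOn (fun s => s ^ H0 * w s + c * s) (Set.Ici R) := by
      have hd : ∀ x, R ≤ x → HasDerivAt (fun s => s ^ H0 * w s + c * s)
          (-(x ^ H0 * v x ^ p) + c * 1) x := fun x hx =>
        (hW x hx).add ((hasDerivAt_id x).const_mul c)
      apply antitoneOn_of_hasDerivWithinAt_nonpos
        (f' := fun x => (-(x ^ H0 * v x ^ p) + c * 1)) (convex_Ici R)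
      · intro x hx
        exact (hd x hx).continuousAt.continuousWithinAt
      · intro x hx
        rw [interior_Ici] at hx
        exact (hd x (le_of_lt hx)).hasDerivWithinAt
      · intro x hx
        rw [interior_Ici] at hx
        have hx' : R ≤ x := le_of_lt hx
        have h1 : R ^ H0 ≤ x ^ H0 := Real.rpow_le_rpow hR.le hx' hH0
        have h2 : v R ^ p ≤ v x ^ p := Real.rpow_le_rpow (hpos R le_rfl).le
          (hmono (Set.mem_Ici.2 le_rfl) hx' hx') (by linarith)
        have h3 : c ≤ x ^ H0 * v x ^ p := mul_le_mul h1 h2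
          (Real.rpow_nonneg (hpos R le_rfl).le _) (Real.rpow_nonneg (hR.le.trans hx') _)
        linarith
    set M := R ^ H0 * w R
    have hM : 0 ≤ M := mul_nonneg (Real.rpow_nonneg hR.le _) (hcon R le_rfl)
    have hx : R ≤ R + M / c + 1 := by
      have : 0 ≤ M / c := by positivity
      linarith
    have h := hanti (Set.mem_Ici.2 le_rfl) (Set.mem_Ici.2 hx) hx
    have h5 : 0 ≤ (R + M / c + 1) ^ H0 * w (R + M / c + 1) :=
      mul_nonneg (Real.rpow_nonneg (hR.le.trans hx) _) (hcon _ hx)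
    have h6 : c * (R + M / c + 1) = c * R + M + c := by field_simp
    simp only at h
    rw [h6] at h
    linarith
  obtain ⟨R1, hRR1, hwR1⟩ := hneg1
  have hR1 : 0 < R1 := lt_of_lt_of_le hR hRR1
  have hWanti : AntitoneOn (fun s => s ^ H0 * w s) (Set.Ici R1) := by
    apply antitoneOn_of_hasDerivWithinAt_nonpos
      (f' := fun x => (-(x ^ H0 * v x ^ p))) (convex_Ici R1)
    · intro x hx
      exact (hW x (hRR1.trans hx)).continuousAt.continuousWithinAt
    · intro x hx
      rw [interior_Ici] at hx
      exact (hW x (hRR1.trans (le_of_lt hx))).hasDerivWithinAt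
    · intro x hx
      rw [interior_Ici] at hx
      have hx' : R1 ≤ x := le_of_lt hx
      have := Real.rpow_nonneg (hpos x (hRR1.trans hx')).le p
      have h2 := Real.rpow_nonneg (hR1.le.trans hx') H0
      have := mul_nonneg h2 this
      linarith
  have hwneg : ∀ r, R1 ≤ r → w r < 0 := by
    intro r hr
    have h1 := hWanti (Set.mem_Ici.2 le_rfl) (Set.mem_Ici.2 hr) hr
    simp only at h1
    have h2 : R1 ^ H0 * w R1 < 0 := mul_neg_of_pos_of_neg (Real.rpow_pos_of_pos hR1 _) hwR1
    have h3 := Real.rpow_pos_of_pos (hR1.trans_le hr) H0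
    by_contra! h4
    have := mul_nonneg h3.le h4
    linarith
  have hvanti : AntitoneOn v (Set.Ici R1) := by
    apply antitoneOn_of_hasDerivWithinAt_nonpos (f' := w) (convex_Ici R1)
    · intro x hx
      exact (hv x (lt_of_lt_of_le hR1 hx)).continuousAt.continuousWithinAt
    · intro x hx
      rw [interior_Ici] at hx
      exact (hv x (hR1.trans hx)).hasDerivWithinAt
    · intro x hx
      rw [interior_Ici] at hx
      exact (hwneg x (le_of_lt hx)).le
  have hn : 0 < H0 + 1 := by linarith
  -- bound on w
  have hwb : ∀ r, 2 * R1 ≤ r → w r ≤ -(v r ^ p * r / (2 * (H0 + 1))) := by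
    intro r hr
    have hr1 : R1 ≤ r := by linarith
    have hr0 : 0 < r := by linarith
    set k := v r ^ p / (H0 + 1) with hk
    have hvr := hpos r (hRR1.trans hr1)
    have hkpos : 0 < k := div_pos (Real.rpow_pos_of_pos hvr _) hn
    have hd : ∀ x, R1 ≤ x → HasDerivAt (fun s => s ^ H0 * w s + k * s ^ (H0 + 1))
        (-(x ^ H0 * v x ^ p) + k * ((H0 + 1) * x ^ (H0 + 1 - 1))) x := fun x hx =>
      (hW x (hRR1.trans hx)).add ((Real.hasDerivAt_rpow_const
        (Or.inl (hR1.trans_le hx).ne')).const_mul k)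
    have hanti : AntitoneOn (fun s => s ^ H0 * w s + k * s ^ (H0 + 1)) (Set.Icc R1 r) := by
      apply antitoneOn_of_hasDerivWithinAt_nonpos
        (f' := fun x => (-(x ^ H0 * v x ^ p) + k * ((H0 + 1) * x ^ (H0 + 1 - 1)))) (convex_Icc R1 r)
      · intro x hx
        exact (hd x hx.1).continuousAt.continuousWithinAt
      · intro x hx
        rw [interior_Icc] at hx
        exact (hd x hx.1.le).hasDerivWithinAt
      · intro x hx
        rw [interior_Icc] at hx
        have h1 : v r ^ p ≤ v x ^ p := Real.rpow_le_rpow hvr.le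
          (hvanti (Set.mem_Ici.2 hx.1.le) (Set.mem_Ici.2 hr1) hx.2.le) (by linarith)
        have h2 := Real.rpow_nonneg (hR1.trans hx.1).le H0
        have e : k * ((H0 + 1) * x ^ (H0 + 1 - 1)) = x ^ H0 * v r ^ p := by
          rw [hk, add_sub_cancel_right]; field_simp
        simp only [e]
        have := mul_le_mul_of_nonneg_left h1 h2
        linarith
    have h := hanti (Set.left_mem_Icc.2 hr1) (Set.right_mem_Icc.2 hr1) hr1
    simp only at h
    have h2 : R1 ^ H0 * w R1 < 0 := mul_neg_of_pos_of_neg (Real.rpow_pos_of_pos hR1 _) hwR1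
    have h3 : R1 ^ (H0 + 1) ≤ r ^ (H0 + 1) / 2 := by
      have h4 : R1 ^ H0 ≤ r ^ H0 := Real.rpow_le_rpow hR1.le hr1 hH0
      rw [Real.rpow_add_one hR1.ne', Real.rpow_add_one hr0.ne']
      have := Real.rpow_nonneg hr0.le H0
      nlinarith
    have h4 := mul_le_mul_of_nonneg_left h3 hkpos.le
    have hrp := Real.rpow_pos_of_pos hr0 H0
    rw [Real.rpow_add_one hr0.ne'] at h h4
    have h5 : r ^ H0 * w r ≤ r ^ H0 * (-(k * r / 2)) := by nlinarith
    have h6 := le_of_mul_le_mul_left h5 hrp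
    have e : v r ^ p * r / (2 * (H0 + 1)) = k * r / 2 := by rw [hk]; field_simp
    rw [e]; exact h6
  -- decay of v
  have hp1 : 0 < p - 1 := by linarith
  set L := (p - 1) / (4 * (H0 + 1)) with hL
  have hLpos : 0 < L := by positivity
  have hmono2 : MonotoneOn (fun s => v s ^ (1 - p) - L * s ^ 2) (Set.Ici (2 * R1)) := by
    have hd : ∀ x, 2 * R1 ≤ x → HasDerivAt (fun s => v s ^ (1 - p) - L * s ^ 2)
        (w x * (1 - p) * v x ^ (1 - p - 1) - L * (2 * x)) x := by
      intro x hx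
      have hvx := hpos x (by linarith)
      have h1 := (hv x (by linarith)).rpow_const (p := 1 - p) (Or.inl hvx.ne')
      have h2 := (hasDerivAt_pow 2 x).const_mul L
      refine (h1.sub h2).congr_deriv ?_
      norm_num
    apply monotoneOn_of_hasDerivWithinAt_nonneg
      (f' := fun x => (w x * (1 - p) * v x ^ (1 - p - 1) - L * (2 * x))) (convex_Ici _)
    · intro x hx
      exact (hd x hx).continuousAt.continuousWithinAt
    · intro x hx
      rw [interior_Ici] at hx
      exact (hd x (le_of_lt hx)).hasDerivWithinAt
    · intro x hx
      rw [interior_Ici] at hx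
      have hx' : 2 * R1 ≤ x := le_of_lt hx
      have hvx := hpos x (by linarith)
      have h1 := hwb x hx'
      have h2 : v x ^ (1 - p - 1) * v x ^ p = 1 := by
        rw [← Real.rpow_add hvx]; ring_nf; simp
      have h3 := Real.rpow_pos_of_pos hvx (1 - p - 1)
      have h4 := mul_le_mul_of_nonneg_left h1 (mul_pos hp1 h3).le
      have h5 : (p - 1) * v x ^ (1 - p - 1) * -(v x ^ p * x / (2 * (H0 + 1))) = - (L * (2 * x)) := by
        have : (p - 1) * v x ^ (1 - p - 1) * -(v x ^ p * x / (2 * (H0 + 1)))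
          = - ((v x ^ (1 - p - 1) * v x ^ p) * (p - 1) * x / (2 * (H0 + 1))) := by ring
        rw [this, h2, hL]; field_simp; ring
      rw [h5] at h4
      linarith
  set K := 3 / 4 * L with hK
  have hKpos : 0 < K := by positivity
  set q := 2 / (p - 1) with hq
  set A := K ^ (-(1 / (p - 1))) with hA
  have hApos : 0 < A := Real.rpow_pos_of_pos hKpos _
  have hdecay : ∀ r, 4 * R1 ≤ r → v r ≤ A * r ^ (-q) := by
    intro r hr
    have hr0 : 0 < r := by linarith
    have hvr := hpos r (by linarith)
    have h := hmono2 (Set.mem_Ici.2 le_rfl) (Set.mem_Ici.2 (by linarith : 2 * R1 ≤ r)) (by linarith)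
    simp only at h
    have h1 := Real.rpow_pos_of_pos (hpos (2 * R1) (by linarith)) (1 - p)
    have h2 : K * r ^ 2 ≤ v r ^ (1 - p) := by
      have : (2 * R1) ^ 2 ≤ r ^ 2 / 4 := by nlinarith
      have := mul_le_mul_of_nonneg_left this hLpos.le
      rw [hK]; linarith
    have h3 : (v r ^ (1 - p)) ^ (-(1 / (p - 1))) ≤ (K * r ^ 2) ^ (-(1 / (p - 1))) :=
      Real.rpow_le_rpow_of_nonpos (by positivity) h2 (by
        have : 0 < 1 / (p - 1) := by positivity
        linarith)
    rw [← Real.rpow_mul hvr.le, Real.mul_rpow hKpos.le (by positivity), ← Real.rpow_natCast r 2,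
      ← Real.rpow_mul hr0.le] at h3
    have e1 : (1 - p) * (-(1 / (p - 1))) = 1 := by field_simp; ring
    have e2 : ((2:ℕ):ℝ) * (-(1 / (p - 1))) = -q := by rw [hq]; push_cast; ring
    rw [e1, e2, Real.rpow_one] at h3
    exact h3
  -- conclusion
  set m := q * (p + 1) with hm
  have hm2 : 2 * q + 2 = m := by rw [hm, hq]; field_simp; ring
  have hmn : H0 + 1 < m := by
    have : m = 2 * ((p + 1) / (p - 1)) := by rw [hm, hq]; ring
    linarith
  set C := 2 ^ (H0 + 1) * (A ^ 2 / 2 + A ^ (p + 1) / (p + 1)) with hC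
  have hlim : Filter.Tendsto (fun r : ℝ => C * r ^ (-(m - (H0 + 1)))) Filter.atTop (nhds (C * 0)) :=
    (tendsto_rpow_neg_atTop (by linarith)).const_mul C
  rw [mul_zero] at hlim
  obtain ⟨r, hrs, hrT⟩ := ((hlim.eventually (gt_mem_nhds hδ)).and
    (Filter.eventually_ge_atTop (max T (4 * R1)))).exists
  have hrT' : T ≤ r := (le_max_left _ _).trans hrT
  have hr4 : 4 * R1 ≤ r := (le_max_right _ _).trans hrT
  have hr0 : 0 < r := by linarith
  obtain ⟨s, hs, hws⟩ := exists_hasDerivAt_eq_slope v w (by linarith : r < 2 * r)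
    (fun x hx => (hv x (by linarith [hx.1])).continuousAt.continuousWithinAt)
    (fun x hx => hv x (by linarith [hx.1]))
  have hs0 : 0 < s := hr0.trans hs.1
  refine ⟨s, hrT'.trans hs.1.le, hs0, lt_of_le_of_lt ?_ hrs⟩
  have hvs := hpos s (by linarith [hs.1])
  have hvr := hpos r (by linarith)
  have hv2r := hpos (2 * r) (by linarith)
  have hwsn := hwneg s (by linarith [hs.1])
  have hvsr : v s ≤ v r := hvanti (Set.mem_Ici.2 (by linarith)) (Set.mem_Ici.2 (by linarith [hs.1])) hs.1.le
  have hd := hdecay r hr4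
  have hws2 : -(w s) ≤ A * r ^ (-q - 1) := by
    rw [hws, Real.rpow_sub_one hr0.ne', ← neg_div, neg_sub, ← mul_div_assoc]
    have : 2 * r - r = r := by ring
    rw [this]
    gcongr
    linarith
  have hsq : w s ^ 2 ≤ A ^ 2 * r ^ (-m) := by
    have h1 : (-(w s)) ^ 2 ≤ (A * r ^ (-q - 1)) ^ 2 := by
      apply pow_le_pow_left₀ (by linarith) hws2
    rw [neg_sq, mul_pow, ← Real.rpow_natCast (r ^ (-q - 1)) 2, ← Real.rpow_mul hr0.le] at h1
    have : (-q - 1) * ((2:ℕ):ℝ) = -m := by rw [← hm2]; push_cast; ring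
    rwa [this] at h1
  have hvp1 : |v s| ^ (p + 1) ≤ A ^ (p + 1) * r ^ (-m) := by
    rw [abs_of_pos hvs]
    have h1 : v s ^ (p + 1) ≤ (A * r ^ (-q)) ^ (p + 1) :=
      Real.rpow_le_rpow hvs.le (hvsr.trans hd) (by linarith)
    rw [Real.mul_rpow hApos.le (Real.rpow_nonneg hr0.le _), ← Real.rpow_mul hr0.le] at h1
    have : -q * (p + 1) = -m := by rw [hm]; ring
    rwa [this] at h1
  have hsn : s ^ (H0 + 1) ≤ 2 ^ (H0 + 1) * r ^ (H0 + 1) := by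
    rw [← Real.mul_rpow (by norm_num) hr0.le]
    exact Real.rpow_le_rpow hs0.le hs.2.le hn.le
  have hlast : a * (s ^ H0 * w s * v s) ≤ 0 := by
    apply mul_nonpos_of_nonneg_of_nonpos ha
    apply mul_nonpos_of_nonpos_of_nonneg _ hvs.le
    exact mul_nonpos_of_nonneg_of_nonpos (Real.rpow_nonneg hs0.le _) hwsn.le
  have hp2 : 0 < p + 1 := by linarith
  have hmain : s ^ (H0 + 1) * ((w s) ^ 2 / 2 + |v s| ^ (p + 1) / (p + 1)) ≤
      (2 ^ (H0 + 1) * r ^ (H0 + 1)) * (A ^ 2 * r ^ (-m) / 2 + A ^ (p + 1) * r ^ (-m) / (p + 1)) := by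
    gcongr
  have hfin : (2 ^ (H0 + 1) * r ^ (H0 + 1)) * (A ^ 2 * r ^ (-m) / 2 + A ^ (p + 1) * r ^ (-m) / (p + 1))
      = C * r ^ (-(m - (H0 + 1))) := by
    have : -(m - (H0 + 1)) = (H0 + 1) + -m := by ring
    rw [this, Real.rpow_add hr0 (H0 + 1) (-m), hC]
    ring
  unfold auxP
  linarith

lemma auxP_neg (H0 p a : ℝ) (v w : ℝ → ℝ) (s : ℝ) :
    auxP H0 p a (fun x => - v x) (fun x => - w x) s = auxP H0 p a v w s := by
  simp [auxP]


/-- Theorem 3.3 (after Haraux): under the subcriticality condition, the solution of the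
limit Cauchy problem has infinitely many zeroes in `(0,∞)`. -/
theorem limit_Cauchy_problem_infinitely_many_zeroes
    (H0 p : ℝ) (hH0 : 0 ≤ H0) (hp : 1 < p)
    (hsub : (H0 + 1) / 2 < (p + 1) / (p - 1))
    (v : ℝ → ℝ) (hv : ContDiffOn ℝ 2 v (Set.Ici 0))
    (hode : ∀ r ∈ Set.Ioi (0 : ℝ),
      deriv (deriv v) r + (H0 / r) * deriv v r + |v r| ^ (p - 1) * v r = 0)
    (hv0 : v 0 = 1) (hv'0 : deriv v 0 = 0) :
    {r ∈ Set.Ioi (0 : ℝ) | v r = 0}.Infinite := by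
  have hp1 : 0 < p - 1 := by linarith
  have hp2 : 0 < p + 1 := by linarith
  -- regularity
  have hvd : ∀ r, 0 < r → HasDerivAt v (deriv v r) r := by
    intro r hr
    have h1 : ContDiffAt ℝ 2 v r := hv.contDiffAt (Ici_mem_nhds hr)
    exact (h1.differentiableAt (by norm_num)).hasDerivAt
  have hwd : ∀ r, 0 < r → HasDerivAt (deriv v)
      (-(H0 / r) * deriv v r - |v r| ^ (p - 1) * v r) r := by
    intro r hr
    have h1 : ContDiffOn ℝ 1 (deriv v) (Set.Ioi 0) :=
      (hv.mono Set.Ioi_subset_Ici_self).deriv_of_isOpen isOpen_Ioi (by norm_num)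
    have h2 : ContDiffAt ℝ 1 (deriv v) r := h1.contDiffAt (Ioi_mem_nhds hr)
    have h3 := (h2.differentiableAt (by norm_num)).hasDerivAt
    refine h3.congr_deriv ?_
    have := hode r hr
    linarith
  -- choice of a
  obtain ⟨a, ha0, ha1, ha2, ha3⟩ : ∃ a : ℝ, 0 ≤ a ∧ (H0 - 1) / 2 ≤ a ∧ a < (H0 + 1) / (p + 1) ∧
      (a = 0 ∨ 0 < H0) := by
    refine ⟨max 0 ((H0 - 1) / 2), le_max_left _ _, le_max_right _ _, ?_, ?_⟩
    · apply max_lt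
      · positivity
      · rw [lt_div_iff₀ hp1] at hsub
        rw [lt_div_iff₀ hp2]
        linarith
    · by_cases h : H0 ≤ 1
      · left; exact max_eq_left (by linarith)
      · right; linarith
  set P := auxP H0 p a v (deriv v) with hP
  have hPd := fun r hr => aux_P H0 p a hp v (deriv v) r hr (hvd r hr) (hwd r hr)
  have hPmono : MonotoneOn P (Set.Ioi 0) := by
    apply monotoneOn_of_hasDerivWithinAt_nonneg (f' := fun r => r ^ H0 * ((a - (H0 - 1) / 2) *
      (deriv v r) ^ 2 + ((H0 + 1) / (p + 1) - a) * |v r| ^ (p + 1))) (convex_Ioi 0)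
    · intro x hx
      exact (hPd x hx).continuousAt.continuousWithinAt
    · intro x hx
      rw [interior_Ioi] at hx
      exact (hPd x hx).hasDerivWithinAt
    · intro x hx
      rw [interior_Ioi] at hx
      have hx0 : 0 < x := hx
      have h1 : 0 ≤ a - (H0 - 1) / 2 := by linarith
      have h2 : 0 ≤ (H0 + 1) / (p + 1) - a := by linarith
      positivity
  -- limit at 0
  have hvlim : Filter.Tendsto v (nhdsWithin 0 (Set.Ioi 0)) (nhds 1) := by
    rw [← hv0]
    exact (hv.continuousOn 0 (Set.mem_Ici.2 le_rfl)).mono_left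
      (nhdsWithin_mono _ Set.Ioi_subset_Ici_self)
  obtain ⟨l, hwlim⟩ : ∃ l, Filter.Tendsto (deriv v) (nhdsWithin 0 (Set.Ioi 0)) (nhds l) := by
    have h1 := hv.continuousOn_derivWithin (uniqueDiffOn_Ici 0) (by norm_num)
    have h2 := (h1 0 (Set.mem_Ici.2 le_rfl)).mono_left
      (nhdsWithin_mono _ Set.Ioi_subset_Ici_self)
    refine ⟨_, h2.congr' ?_⟩
    filter_upwards [self_mem_nhdsWithin] with x hx
    exact derivWithin_of_mem_nhds (Ici_mem_nhds hx)
  have hid : Filter.Tendsto (fun x : ℝ => x) (nhdsWithin 0 (Set.Ioi 0)) (nhds 0) :=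
    Filter.tendsto_id.mono_left nhdsWithin_le_nhds
  have hrp : ∀ b : ℝ, 0 < b → Filter.Tendsto (fun x : ℝ => x ^ b) (nhdsWithin 0 (Set.Ioi 0)) (nhds 0) := by
    intro b hb
    have := hid.rpow_const (p := b) (Or.inr hb.le)
    rwa [Real.zero_rpow hb.ne'] at this
  have hPlim : Filter.Tendsto P (nhdsWithin 0 (Set.Ioi 0)) (nhds 0) := by
    have h1 := (hrp (H0 + 1) (by linarith)).mul (((hwlim.pow 2).div_const 2).add
      ((hvlim.abs.rpow_const (p := p + 1) (Or.inr hp2.le)).div_const (p + 1)))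
    rw [zero_mul] at h1
    have h2 : Filter.Tendsto (fun s => a * (s ^ H0 * deriv v s * v s))
        (nhdsWithin 0 (Set.Ioi 0)) (nhds 0) := by
      rcases ha3 with h | h
      · simp [h]
      · have := (((hrp H0 h).mul hwlim).mul hvlim).const_mul a
        simpa using this
    have := h1.add h2
    rw [zero_add] at this
    exact this
  have hPnn : ∀ r, 0 < r → 0 ≤ P r := by
    intro r hr
    refine le_of_tendsto hPlim ?_
    filter_upwards [Ioo_mem_nhdsGT hr] with x hx
    exact hPmono hx.1 hr hx.2.le
  obtain ⟨e, he, hve⟩ : ∃ e : ℝ, 0 < e ∧ ∀ x, 0 < x → x < e → 0 < v x := by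
    have := hvlim.eventually (lt_mem_nhds (show (0:ℝ) < 1 by norm_num))
    obtain ⟨e, he, h⟩ := (mem_nhdsGT_iff_exists_Ioo_subset).1 this
    exact ⟨e, he, fun x hx hxe => h ⟨hx, hxe⟩⟩
  have hPpos : 0 < P (e / 2) := by
    have hst : StrictMonoOn P (Set.Ioo 0 e) := by
      apply strictMonoOn_of_hasDerivWithinAt_pos (f' := fun r => r ^ H0 * ((a - (H0 - 1) / 2) *
        (deriv v r) ^ 2 + ((H0 + 1) / (p + 1) - a) * |v r| ^ (p + 1))) (convex_Ioo 0 e)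
      · intro x hx
        exact (hPd x hx.1).continuousAt.continuousWithinAt
      · intro x hx
        rw [interior_Ioo] at hx
        exact (hPd x hx.1).hasDerivWithinAt
      · intro x hx
        rw [interior_Ioo] at hx
        have hx0 : 0 < x := hx.1
        have hvx : 0 < v x := hve x hx.1 hx.2
        have h1 : 0 ≤ a - (H0 - 1) / 2 := by linarith
        have h2 : 0 < (H0 + 1) / (p + 1) - a := by linarith
        have h3 : 0 < |v x| := abs_pos.2 hvx.ne'
        positivity
    have h := hst (a := e / 4) (b := e / 2) ⟨by linarith, by linarith⟩ ⟨by linarith, by linarith⟩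
      (by linarith)
    exact lt_of_le_of_lt (hPnn _ (by linarith)) h
  -- contradiction
  intro hfin
  obtain ⟨B, hB⟩ := hfin.bddAbove
  set R := max B 0 + 1 with hR
  have hRpos : 0 < R := by have := le_max_right B 0; linarith
  have hnz : ∀ r, R ≤ r → v r ≠ 0 := by
    intro r hr h0
    have := hB (show r ∈ {r ∈ Set.Ioi (0 : ℝ) | v r = 0} from ⟨hRpos.trans_le hr, h0⟩)
    have := le_max_left B 0
    linarith
  have hcont : ContinuousOn v (Set.Ici R) := fun x hx =>
    (hvd x (hRpos.trans_le hx)).continuousAt.continuousWithinAt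
  have hsign : (∀ r, R ≤ r → 0 < v r) ∨ (∀ r, R ≤ r → 0 < - v r) := by
    by_contra! hcon
    obtain ⟨⟨x, hx, hvx⟩, ⟨y, hy, hvy⟩⟩ := hcon
    obtain ⟨z, hz, hvz⟩ := isPreconnected_Ici.intermediate_value (a := x) (b := y)
      (Set.mem_Ici.2 hx) (Set.mem_Ici.2 hy) hcont (show (0:ℝ) ∈ Set.Icc (v x) (v y) from
        ⟨hvx, by linarith⟩)
    exact hnz z hz hvz
  have hex : ∃ s, e / 2 ≤ s ∧ 0 < s ∧ P s < P (e / 2) := by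
    rcases hsign with h | h
    · exact aux_pos H0 p a hH0 hp ha0 hsub v (deriv v) hvd hwd R hRpos h _ hPpos _
    · obtain ⟨s, h1, h2, h3⟩ := aux_pos H0 p a hH0 hp ha0 hsub (fun x => - v x)
        (fun x => - deriv v x) (fun r hr => (hvd r hr).neg)
        (fun r hr => (hwd r hr).neg.congr_deriv (by simp only [abs_neg]; ring)) R hRpos h
        (P (e / 2)) hPpos (e / 2)
      rw [auxP_neg] at h3
      exact ⟨s, h1, h2, h3⟩
  obtain ⟨s, h1, h2, h3⟩ := hex
  have := hPmono (Set.mem_Ioi.2 (by linarith : 0 < e / 2)) (Set.mem_Ioi.2 h2) h1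
  linarith
end

section
/- Let A > 0, p > 1, λ > 0, let H : [0,A] → ℝ be a positive C¹ function, and let K > 0. Choose D₀ > 2 with A·√λ·D₀ > K. Assume that for each d ≥ D₀ a C² function z_d : [0, d·A·√λ] → ℝ satisfies z_d''(r) + (H(r/(√λ·d))/r)·z_d'(r) + |z_d(r)|^{p−1}·z_d(r) − d^{−2}·z_d(r) = 0 on (0, d·A·√λ], with z_d(0) = 1 and z_d'(0) = 0. Then there exists a constant C > 0 such that |z_d(r)| ≤ C and |z_d'(r)| ≤ C for all d ≥ D₀ and all r ∈ [0,K]. -/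
theorem energy_aux (p d R : ℝ) (hp : 1 < p) (hR : 0 < R) (h z : ℝ → ℝ)
    (hpos : ∀ r ∈ Set.Icc (0 : ℝ) R, 0 < h r) (hc : ContinuousOn h (Set.Icc 0 R))
    (hz : ContDiffOn ℝ 2 z (Set.Icc 0 R))
    (ode : ∀ r ∈ Set.Ioo (0 : ℝ) R, deriv (deriv z) r + (h r / r) * deriv z r
        + |z r| ^ (p - 1) * z r - (1 / d ^ 2) * z r = 0)
    (hz0 : z 0 = 1) (r : ℝ) (hr : r ∈ Set.Ioo 0 R) :
    (deriv z r) ^ 2 / 2 + |z r| ^ (p + 1) / (p + 1) - (1 / d ^ 2) * (z r) ^ 2 / 2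
      ≤ 1 / (p + 1) - (1 / d ^ 2) / 2 := by
  have hu : UniqueDiffOn ℝ (Set.Icc 0 R) := uniqueDiffOn_Icc hR
  set w := derivWithin z (Set.Icc 0 R) with hw
  have hw1 : ContDiffOn ℝ 1 w (Set.Icc 0 R) := hz.derivWithin hu (by norm_num)
  set g := derivWithin w (Set.Icc 0 R) with hg
  have hg0 : ContinuousOn g (Set.Icc 0 R) := hw1.continuousOn_derivWithin hu (by norm_num)
  have hzc := hz.continuousOn
  have hwc := hw1.continuousOn
  have nhd : ∀ x ∈ Set.Ioo (0 : ℝ) R, Set.Icc 0 R ∈ nhds x := fun x hx => Icc_mem_nhds hx.1 hx.2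
  have dz : ∀ x ∈ Set.Ioo (0 : ℝ) R, w x = deriv z x := fun x hx =>
    derivWithin_of_mem_nhds (nhd x hx)
  have dz2 : ∀ x ∈ Set.Ioo (0 : ℝ) R, deriv w x = deriv (deriv z) x := fun x hx => by
    apply Filter.EventuallyEq.deriv_eq
    filter_upwards [Ioo_mem_nhds hx.1 hx.2] with y hy using dz y hy
  have dw : ∀ x ∈ Set.Ioo (0 : ℝ) R, g x = deriv w x := fun x hx =>
    derivWithin_of_mem_nhds (nhd x hx)
  have Hz : ∀ x ∈ Set.Ioo (0 : ℝ) R, HasDerivAt z (w x) x := fun x hx => by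
    rw [dz x hx]
    exact ((hz.differentiableOn (by norm_num)).differentiableAt (nhd x hx)).hasDerivAt
  have Hw : ∀ x ∈ Set.Ioo (0 : ℝ) R, HasDerivAt w (deriv (deriv z) x) x := fun x hx => by
    rw [← dz2 x hx]
    exact ((hw1.differentiableOn (by norm_num)).differentiableAt (nhd x hx)).hasDerivAt
  have w0 : w 0 = 0 := by
    have hF : ContinuousOn (fun x => x * g x + h x * w x
        + x * (|z x| ^ (p - 1) * z x - (1 / d ^ 2) * z x)) (Set.Icc 0 R) := by
      have : ContinuousOn (fun x => |z x| ^ (p - 1)) (Set.Icc 0 R) :=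
        hzc.abs.rpow_const (fun x _ => Or.inr (by linarith))
      fun_prop
    have he : Set.EqOn (fun x => x * g x + h x * w x
        + x * (|z x| ^ (p - 1) * z x - (1 / d ^ 2) * z x)) (fun _ => 0) (Set.Ioo 0 R) := by
      intro x hx
      have h1 := ode x hx
      have hx0 : x ≠ 0 := hx.1.ne'
      simp only [dw x hx, dz2 x hx, dz x hx]
      have h2 : x * (h x / x * deriv z x) = h x * deriv z x := by field_simp
      linear_combination x * h1 - h2
    have h3 := he.of_subset_closure hF continuousOn_const Set.Ioo_subset_Icc_self
      (by rw [closure_Ioo hR.ne]) (Set.left_mem_Icc.2 hR.le)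
    have h4 := hpos 0 (Set.left_mem_Icc.2 hR.le)
    simp only [zero_mul, zero_add, add_zero, mul_eq_zero] at h3
    rcases h3 with h3 | h3
    · exact absurd h3 h4.ne'
    · exact h3
  have hE : AntitoneOn (fun x => (w x) ^ 2 / 2 + |z x| ^ (p + 1) / (p + 1)
      - (1 / d ^ 2) * (z x) ^ 2 / 2) (Set.Icc 0 R) := by
    have HE : ∀ x ∈ Set.Ioo (0 : ℝ) R, HasDerivAt (fun x => (w x) ^ 2 / 2
      + |z x| ^ (p + 1) / (p + 1) - (1 / d ^ 2) * (z x) ^ 2 / 2) (-(h x / x) * (w x) ^ 2) x := by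
      intro x hx
      have a1 := ((Hw x hx).pow 2).div_const 2
      have a2 := ((hasDerivAt_abs_rpow (z x) (p := p + 1) (by linarith)).comp x
        (Hz x hx)).div_const (p + 1)
      have a3 := (((Hz x hx).pow 2).const_mul (1 / d ^ 2)).div_const 2
      refine ((a1.add a2).sub a3).congr_deriv ?_
      have h1 := ode x hx
      rw [← dz x hx] at h1
      have hp1 : p + 1 ≠ 0 := by linarith
      have e : p + 1 - 2 = p - 1 := by ring
      have e2 : (p + 1) * |z x| ^ (p - 1) * z x * w x / (p + 1)
        = |z x| ^ (p - 1) * z x * w x := by field_simp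
      rw [e, e2]
      push_cast
      linear_combination w x * h1
    refine antitoneOn_of_deriv_nonpos (convex_Icc 0 R) ?_ ?_ ?_
    · have : ContinuousOn (fun x => |z x| ^ (p + 1)) (Set.Icc 0 R) :=
        hzc.abs.rpow_const (fun x _ => Or.inr (by linarith))
      fun_prop
    · rw [interior_Icc]
      exact fun x hx => (HE x hx).differentiableAt.differentiableWithinAt
    · rw [interior_Icc]
      intro x hx
      rw [(HE x hx).deriv]
      have := div_pos (hpos x (Set.Ioo_subset_Icc_self hx)) hx.1
      nlinarith [mul_nonneg this.le (sq_nonneg (w x))]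
  have := hE (Set.left_mem_Icc.2 hR.le) (Set.Ioo_subset_Icc_self hr) hr.1.le
  simp only [w0, hz0, dz r hr, abs_one, Real.one_rpow] at this
  linarith

/-- Steps 1 of Lemma 3.2: the rescaled solutions `z_d` and their derivatives are
uniformly bounded on `[0,K]` for all `d ≥ D₀`. -/
theorem rescaled_solutions_uniformly_bounded
    (A p lam K : ℝ) (hA : 0 < A) (hp : 1 < p) (hlam : 0 < lam) (hK : 0 < K)
    (H : ℝ → ℝ) (Hpos : ∀ r ∈ Set.Icc (0 : ℝ) A, 0 < H r)
    (HC1 : ContDiffOn ℝ 1 H (Set.Icc 0 A))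
    (D₀ : ℝ) (hD₀ : 2 < D₀) (hD₀K : K < A * Real.sqrt lam * D₀)
    (z : ℝ → ℝ → ℝ)
    (hzC2 : ∀ d : ℝ, D₀ ≤ d → ContDiffOn ℝ 2 (z d) (Set.Icc 0 (d * A * Real.sqrt lam)))
    (hzode : ∀ d : ℝ, D₀ ≤ d → ∀ r ∈ Set.Ioc (0 : ℝ) (d * A * Real.sqrt lam),
      deriv (deriv (z d)) r + (H (r / (Real.sqrt lam * d)) / r) * deriv (z d) r
        + |z d r| ^ (p - 1) * z d r - (1 / d ^ 2) * z d r = 0)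
    (hz0 : ∀ d : ℝ, D₀ ≤ d → z d 0 = 1)
    (hz'0 : ∀ d : ℝ, D₀ ≤ d → deriv (z d) 0 = 0) :
    ∃ C : ℝ, 0 < C ∧ ∀ d : ℝ, D₀ ≤ d → ∀ r ∈ Set.Icc (0 : ℝ) K,
      |z d r| ≤ C ∧ |deriv (z d) r| ≤ C := by
  have hs : 0 < Real.sqrt lam := Real.sqrt_pos.2 hlam
  set M : ℝ := (p + 1) ^ (1 / (p - 1)) with hM
  have hM1 : 1 ≤ M := Real.one_le_rpow (by linarith) (by apply div_nonneg <;> linarith)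
  have hMp : M ^ (p - 1) = p + 1 := by
    rw [hM, ← Real.rpow_mul (by linarith), one_div_mul_cancel (by linarith), Real.rpow_one]
  refine ⟨1 + M, by linarith, fun d hd r hr => ?_⟩
  have hd0 : 0 < d := by linarith
  rcases hr.1.eq_or_lt with h0 | h0
  · rw [← h0, hz0 d hd, hz'0 d hd]
    simp only [abs_one, abs_zero]
    constructor <;> linarith
  have hRK : K < d * A * Real.sqrt lam := by
    have : A * Real.sqrt lam * D₀ ≤ A * Real.sqrt lam * d :=
      mul_le_mul_of_nonneg_left hd (by positivity)
    linarith
  have hmaps : Set.MapsTo (fun r => r / (Real.sqrt lam * d)) (Set.Icc 0 (d * A * Real.sqrt lam))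
      (Set.Icc 0 A) := by
    intro x hx
    have : 0 < Real.sqrt lam * d := by positivity
    refine ⟨div_nonneg hx.1 this.le, ?_⟩
    rw [div_le_iff₀ this]
    linarith [hx.2]
  have key := energy_aux p d (d * A * Real.sqrt lam) hp (by positivity)
    (fun r => H (r / (Real.sqrt lam * d))) (z d) (fun x hx => Hpos _ (hmaps hx))
    (HC1.continuousOn.comp (by fun_prop) hmaps) (hzC2 d hd)
    (fun x hx => hzode d hd x ⟨hx.1, hx.2.le⟩) (hz0 d hd) r ⟨h0, by linarith [hr.2]⟩
  have hd1 : 0 < 1 / d ^ 2 := by positivity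
  have hd2 : 1 / d ^ 2 ≤ 1 / 4 := by
    apply one_div_le_one_div_of_le <;> nlinarith
  have hp2 : 1 / (p + 1) ≤ 1 / 2 := by
    apply one_div_le_one_div_of_le <;> linarith
  have hzz : 1 / d ^ 2 * (z d r) ^ 2 ≤ 1 / 4 * (z d r) ^ 2 :=
    mul_le_mul_of_nonneg_right hd2 (sq_nonneg _)
  have hnn : 0 ≤ |z d r| ^ (p + 1) / (p + 1) := by
    have := Real.rpow_nonneg (abs_nonneg (z d r)) (p + 1)
    apply div_nonneg this; linarith
  have hzM : |z d r| ≤ M := by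
    by_contra! hlt
    have hpos : 0 < |z d r| := by linarith
    have h1 : p + 1 ≤ |z d r| ^ (p - 1) := by
      rw [← hMp]; exact Real.rpow_le_rpow (by linarith) hlt.le (by linarith)
    have h2 : |z d r| ^ (p + 1) = |z d r| ^ (p - 1) * |z d r| ^ 2 := by
      rw [← Real.rpow_natCast, ← Real.rpow_add hpos]; congr 1; push_cast; ring
    have h3 : |z d r| ^ 2 ≤ |z d r| ^ (p + 1) / (p + 1) := by
      rw [le_div_iff₀ (by linarith), h2, mul_comm]
      exact mul_le_mul_of_nonneg_right h1 (sq_nonneg _)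
    have h4 : 1 ≤ |z d r| ^ 2 := by nlinarith
    rw [sq_abs] at h3 h4
    nlinarith [sq_nonneg (deriv (z d) r)]
  refine ⟨by linarith, ?_⟩
  have h5 : (z d r) ^ 2 ≤ M ^ 2 := by
    rw [← sq_abs]; exact pow_le_pow_left₀ (abs_nonneg _) hzM 2
  refine abs_le_of_sq_le_sq ?_ (by linarith : (0:ℝ) ≤ 1 + M)
  nlinarith
end

section
/- Let H₀ > 0, p > 1 and K > 0. Let φ : [0,K] → ℝ be a C¹ function on [0,K] that is C² on (0,K] and satisfies φ''(r) + (H₀/r)·φ'(r) + |φ(r)|^{p−1}·φ(r) = 0 for all r ∈ (0,K], with φ(0) = 1 and φ'(0) = 0. Then lim_{r → 0⁺} φ'(r)/r = −1/(1+H₀); consequently φ is C² on [0,K] with φ''(0) = −1/(1+H₀). -/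
/-- Step 4 of Lemma 3.2: a `C¹` solution of the limit equation on `(0,K]` with
`φ(0) = 1`, `φ'(0) = 0` satisfies `φ'(r)/r → -1/(1+H₀)` as `r → 0⁺`; consequently it is
`C²` up to `0` with `φ''(0) = -1/(1+H₀)`. -/
theorem limit_equation_solution_C2_at_origin
    (H0 p K : ℝ) (hH0 : 0 < H0) (hp : 1 < p) (hK : 0 < K)
    (φ : ℝ → ℝ)
    (hC1 : ContDiffOn ℝ 1 φ (Set.Icc 0 K))
    (hC2 : ContDiffOn ℝ 2 φ (Set.Ioc 0 K))
    (hode : ∀ r ∈ Set.Ioc (0 : ℝ) K,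
      deriv (deriv φ) r + (H0 / r) * deriv φ r + |φ r| ^ (p - 1) * φ r = 0)
    (h0 : φ 0 = 1) (h'0 : deriv φ 0 = 0) :
    Filter.Tendsto (fun r : ℝ => deriv φ r / r) (nhdsWithin 0 (Set.Ioi 0))
        (nhds (-1 / (1 + H0))) ∧
      ContDiffOn ℝ 2 φ (Set.Icc 0 K) ∧
      derivWithin (deriv φ) (Set.Ici 0) 0 = -1 / (1 + H0) := by
  have hI : UniqueDiffOn ℝ (Set.Icc 0 K) := uniqueDiffOn_Icc hK
  set D := derivWithin φ (Set.Icc 0 K) with hD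
  have hDcont : ContinuousOn D (Set.Icc 0 K) := hC1.continuousOn_derivWithin hI le_rfl
  have hK0 : (0:ℝ) ∈ Set.Icc 0 K := ⟨le_rfl, hK.le⟩
  have hnhds : ∀ r ∈ Set.Ioo (0:ℝ) K, Set.Icc 0 K ∈ nhds r := fun r hr => Icc_mem_nhds hr.1 hr.2
  have hnhds' : ∀ r ∈ Set.Ioo (0:ℝ) K, Set.Ioc 0 K ∈ nhds r := fun r hr => Ioc_mem_nhds hr.1 hr.2
  have hDeq : ∀ r ∈ Set.Ioo (0:ℝ) K, D r = deriv φ r := fun r hr =>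
    derivWithin_of_mem_nhds (hnhds r hr)
  have hIoo : Set.Ioo (0:ℝ) K ∈ nhdsWithin 0 (Set.Ioi 0) := Ioo_mem_nhdsGT hK
  have hle : nhdsWithin (0:ℝ) (Set.Ioi 0) ≤ nhdsWithin 0 (Set.Icc 0 K) := by
    rw [← nhdsWithin_Ioo_eq_nhdsGT hK]
    exact nhdsWithin_mono _ Set.Ioo_subset_Icc_self
  have hDlim : Filter.Tendsto D (nhdsWithin 0 (Set.Ioi 0)) (nhds (D 0)) :=
    (hDcont 0 hK0).tendsto.mono_left hle
  have hev : D =ᶠ[nhdsWithin 0 (Set.Ioi 0)] deriv φ := by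
    filter_upwards [hIoo] with r hr using hDeq r hr
  have hφlim : Filter.Tendsto φ (nhdsWithin 0 (Set.Ioi 0)) (nhds 1) := by
    have := (hC1.continuousOn 0 hK0).tendsto.mono_left hle
    rwa [h0] at this
  have hflim : Filter.Tendsto (fun r => |φ r| ^ (p - 1) * φ r) (nhdsWithin 0 (Set.Ioi 0)) (nhds 1) := by
    have := (hφlim.abs.rpow_const (p := p - 1) (Or.inr (by linarith))).mul hφlim
    simpa using this
  have hid : Filter.Tendsto (fun r : ℝ => r) (nhdsWithin 0 (Set.Ioi 0)) (nhds 0) :=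
    Filter.tendsto_id.mono_left nhdsWithin_le_nhds
  have hpow : ∀ a : ℝ, 0 < a →
      Filter.Tendsto (fun r : ℝ => r ^ a) (nhdsWithin 0 (Set.Ioi 0)) (nhds 0) := by
    intro a ha
    have := hid.rpow_const (p := a) (Or.inr ha.le)
    rwa [Real.zero_rpow ha.ne'] at this
  have hdd : ∀ r ∈ Set.Ioo (0:ℝ) K, HasDerivAt (deriv φ) (deriv (deriv φ) r) r := by
    intro r hr
    have h2 : ContDiffAt ℝ 2 φ r := hC2.contDiffAt (hnhds' r hr)
    have h3 : ContDiffAt ℝ 1 (deriv φ) r := h2.derivWithin (by norm_num)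
    exact (h3.differentiableAt one_ne_zero).hasDerivAt
  have hlim : Filter.Tendsto (fun r : ℝ => deriv φ r / r) (nhdsWithin 0 (Set.Ioi 0))
        (nhds (-1 / (1 + H0))) := by
    have hl := HasDerivAt.lhopital_zero_nhdsGT (a := 0) (l := nhds (-1 / (1 + H0)))
      (f := fun r => r ^ H0 * deriv φ r) (g := fun r : ℝ => r ^ (1 + H0))
      (f' := fun r => - (r ^ H0 * (|φ r| ^ (p - 1) * φ r))) (g' := fun r : ℝ => (1 + H0) * r ^ H0)
      ?_ ?_ ?_ ?_ ?_ ?_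
    · refine hl.congr' ?_
      filter_upwards [hIoo] with r hr
      have : 0 < r ^ H0 := Real.rpow_pos_of_pos hr.1 _
      have h1 := hr.1.ne'
      rw [Real.rpow_add hr.1, Real.rpow_one]
      field_simp
    · filter_upwards [hIoo] with r hr
      have h1 := (Real.hasDerivAt_rpow_const (x := r) (p := H0) (Or.inl hr.1.ne')).mul (hdd r hr)
      refine h1.congr_deriv ?_
      have h2 := hode r ⟨hr.1, hr.2.le⟩
      have h3 : deriv (deriv φ) r = - ((H0 / r) * deriv φ r) - |φ r| ^ (p - 1) * φ r := by linarith
      rw [h3, Real.rpow_sub hr.1, Real.rpow_one]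
      ring
    · filter_upwards [hIoo] with r hr
      have h1 := (Real.hasDerivAt_rpow_const (x := r) (p := 1 + H0) (Or.inl hr.1.ne'))
      refine h1.congr_deriv ?_
      congr 2
      ring
    · filter_upwards [hIoo] with r hr
      have : 0 < r ^ H0 := Real.rpow_pos_of_pos hr.1 _
      positivity
    · have := (hpow H0 hH0).mul (hDlim.congr' hev)
      simpa using this
    · exact hpow _ (by linarith)
    · have := hflim.neg.div_const (1 + H0)
      refine this.congr' ?_
      filter_upwards [hIoo] with r hr
      have : 0 < r ^ H0 := Real.rpow_pos_of_pos hr.1 _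
      field_simp
  have hD0 : D 0 = 0 := by
    have h1 : Filter.Tendsto (deriv φ) (nhdsWithin 0 (Set.Ioi 0)) (nhds 0) := by
      have := hlim.mul hid
      rw [mul_zero] at this
      refine this.congr' ?_
      filter_upwards [hIoo] with r hr
      have := hr.1.ne'
      field_simp
    exact tendsto_nhds_unique (hDlim.congr' hev) h1
  have hderD : HasDerivWithinAt D (-1 / (1 + H0)) (Set.Icc 0 K) 0 := by
    have : HasDerivWithinAt D (-1 / (1 + H0)) (Set.Ioi 0) 0 := by
      rw [hasDerivWithinAt_iff_tendsto_slope' (by simp)]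
      refine hlim.congr' ?_
      filter_upwards [hIoo] with r hr
      rw [slope_def_field, hD0, hDeq r hr, sub_zero, sub_zero]
    exact this.Ici_of_Ioi.mono Set.Icc_subset_Ici_self
  refine ⟨hlim, ?_, ?_⟩
  · have hDloc : ∀ r ∈ Set.Ioc (0:ℝ) K, ContDiffWithinAt ℝ 1 D (Set.Icc 0 K) r := by
      intro r hr
      have hmem : Set.Ioc (0:ℝ) K ∈ nhdsWithin r (Set.Icc 0 K) := by
        have : Set.Ioi (0:ℝ) ∈ nhds r := Ioi_mem_nhds hr.1
        filter_upwards [mem_nhdsWithin_of_mem_nhds this, self_mem_nhdsWithin] with x h1 h2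
        exact ⟨h1, h2.2⟩
      have h2 : ContDiffWithinAt ℝ 2 φ (Set.Icc 0 K) r :=
        (hC2 r hr).mono_of_mem_nhdsWithin hmem
      exact h2.derivWithin hI (by norm_num) ⟨hr.1.le, hr.2⟩
    rw [show (2 : WithTop ℕ∞) = 1 + 1 by norm_num, contDiffOn_succ_iff_derivWithin hI]
    refine ⟨hC1.differentiableOn one_ne_zero, by simp, ?_⟩
    rw [show (1 : WithTop ℕ∞) = 0 + 1 by norm_num, contDiffOn_succ_iff_derivWithin hI, contDiffOn_zero]
    refine ⟨?_, by simp, ?_⟩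
    · intro r hr
      rcases hr.1.eq_or_lt with h | h
      · rw [← h]; exact hderD.differentiableWithinAt
      · exact (hDloc r ⟨h, hr.2⟩).differentiableWithinAt one_ne_zero
    · intro r hr
      rcases hr.1.eq_or_lt with h | h
      · rw [← h]
        have hval : derivWithin D (Set.Icc 0 K) 0 = -1 / (1 + H0) := hderD.derivWithin (hI 0 hK0)
        have h1 : ContinuousWithinAt (derivWithin D (Set.Icc 0 K)) (Set.Ioi 0) 0 := by
          unfold ContinuousWithinAt
          rw [hval]
          have h2 := ((hlim.const_mul H0).neg).sub hflim
          have h3 : -(H0 * (-1 / (1 + H0))) - 1 = -1 / (1 + H0) := by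
            field_simp
            ring
          rw [h3] at h2
          refine h2.congr' ?_
          filter_upwards [hIoo] with r hr
          have h4 : derivWithin D (Set.Icc 0 K) r = deriv (deriv φ) r := by
            rw [derivWithin_of_mem_nhds (hnhds r hr)]
            apply Filter.EventuallyEq.deriv_eq
            filter_upwards [Ioo_mem_nhds hr.1 hr.2] with x hx using hDeq x hx
          have h5 := hode r ⟨hr.1, hr.2.le⟩
          rw [h4]
          have h6 : H0 / r * deriv φ r = H0 * (deriv φ r / r) := by ring
          linarith
        exact (continuousWithinAt_Ioi_iff_Ici.1 h1).mono Set.Icc_subset_Ici_self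
      · exact ((hDloc r ⟨h, hr.2⟩).derivWithin (m := 0) hI (by norm_num) hr).continuousWithinAt
  · have : HasDerivWithinAt (deriv φ) (-1 / (1 + H0)) (Set.Ioi 0) 0 := by
      rw [hasDerivWithinAt_iff_tendsto_slope' (by simp)]
      refine hlim.congr' ?_
      filter_upwards [hIoo] with r hr
      rw [slope_def_field, h'0, sub_zero, sub_zero]
    exact this.Ici_of_Ioi.derivWithin (uniqueDiffOn_Ici 0 0 (by simp))
end

section
/- Let n ≥ 3, ℓ ≥ 1 and m₁, m₂ ≥ 1 be integers; set p = (n+2)/(n−2), λ = n(n−2)/(4ℓ²), h(r) = ((m₁+m₂)/2)·cos r − (m₂−m₁)/2, and let a₀ ∈ (0,π) be the unique zero of h. Let 0 < d ≤ 1 and let w : [0,a₀] → ℝ be a C² function satisfying w''(r) + (h(r)/sin r)·w'(r) + λ·(|w(r)|^{p−1}·w(r) − w(r)) = 0 on (0,a₀], with w(0) = d and w'(0) = 0. Then w(r) > 0 for all r ∈ [0,a₀]. -/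
/-- Lemma 4.1: if `0 < d ≤ 1` then the solution of the sphere ODE with `w(0) = d`,
`w'(0) = 0` is positive on `[0,a₀]`. -/
theorem small_initial_data_no_zeroes
    (n ℓ m₁ m₂ : ℕ) (hn : 3 ≤ n) (hℓ : 1 ≤ ℓ) (hm₁ : 1 ≤ m₁) (hm₂ : 1 ≤ m₂)
    (p lam : ℝ) (hp : p = ((n : ℝ) + 2) / ((n : ℝ) - 2))
    (hlam : lam = (n : ℝ) * ((n : ℝ) - 2) / (4 * (ℓ : ℝ) ^ 2))
    (h : ℝ → ℝ)
    (hh : ∀ r : ℝ, h r = (((m₁ : ℝ) + (m₂ : ℝ)) / 2) * Real.cos r - ((m₂ : ℝ) - (m₁ : ℝ)) / 2)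
    (a₀ : ℝ) (ha₀ : a₀ ∈ Set.Ioo (0 : ℝ) Real.pi) (ha₀z : h a₀ = 0)
    (d : ℝ) (hd0 : 0 < d) (hd1 : d ≤ 1)
    (w : ℝ → ℝ) (hw : ContDiffOn ℝ 2 w (Set.Icc 0 a₀))
    (hode : ∀ r ∈ Set.Ioc (0 : ℝ) a₀,
      deriv (deriv w) r + (h r / Real.sin r) * deriv w r
        + lam * (|w r| ^ (p - 1) * w r - w r) = 0)
    (hw0 : w 0 = d) (hw'0 : deriv w 0 = 0) :
    ∀ r ∈ Set.Icc (0 : ℝ) a₀, 0 < w r := by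
  obtain ⟨ha0, hapi⟩ := ha₀
  have hn3 : (3:ℝ) ≤ n := by exact_mod_cast hn
  have hℓ1 : (1:ℝ) ≤ ℓ := by exact_mod_cast hℓ
  have hm1 : (1:ℝ) ≤ m₁ := by exact_mod_cast hm₁
  have hm2 : (1:ℝ) ≤ m₂ := by exact_mod_cast hm₂
  have hp1 : 1 < p := by
    rw [hp, lt_div_iff₀ (by linarith)]; linarith
  have hlam0 : 0 < lam := by
    rw [hlam]
    apply div_pos (mul_pos (by linarith) (by linarith)); positivity
  have hU : UniqueDiffOn ℝ (Set.Icc 0 a₀) := uniqueDiffOn_Icc ha0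
  set v := derivWithin w (Set.Icc 0 a₀) with hv
  have hv1 : ContDiffOn ℝ 1 v (Set.Icc 0 a₀) := hw.derivWithin hU (by norm_num)
  have hvc : ContinuousOn v (Set.Icc 0 a₀) := hv1.continuousOn
  have hwc : ContinuousOn w (Set.Icc 0 a₀) := hw.continuousOn
  set u := derivWithin v (Set.Icc 0 a₀) with hu
  have huc : ContinuousOn u (Set.Icc 0 a₀) := hv1.continuousOn_derivWithin hU (by norm_num)
  have hnh : ∀ r ∈ Set.Ioo 0 a₀, Set.Icc 0 a₀ ∈ nhds r := fun r hr => Icc_mem_nhds hr.1 hr.2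
  have hwd : ∀ r ∈ Set.Ioo 0 a₀, HasDerivAt w (v r) r := fun r hr =>
    ((hw.differentiableOn (by norm_num)) r ⟨hr.1.le, hr.2.le⟩).hasDerivWithinAt.hasDerivAt (hnh r hr)
  have hvd : ∀ r ∈ Set.Ioo 0 a₀, HasDerivAt v (u r) r := fun r hr =>
    ((hv1.differentiableOn (by norm_num)) r ⟨hr.1.le, hr.2.le⟩).hasDerivWithinAt.hasDerivAt (hnh r hr)
  have hode' : ∀ r ∈ Set.Ioo 0 a₀,
      u r + (h r / Real.sin r) * v r + lam * (|w r| ^ (p - 1) * w r - w r) = 0 := by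
    intro r hr
    have h1 := hode r ⟨hr.1, hr.2.le⟩
    have h2 : deriv w =ᶠ[nhds r] v := by
      filter_upwards [Ioo_mem_nhds hr.1 hr.2] with x hx using (hwd x hx).deriv
    rwa [h2.deriv_eq, (hvd r hr).deriv, h2.eq_of_nhds] at h1
  have hsin : ∀ r ∈ Set.Ioo 0 a₀, 0 < Real.sin r := fun r hr =>
    Real.sin_pos_of_pos_of_lt_pi hr.1 (hr.2.trans hapi)
  have hhc : Continuous h := by
    have : h = fun r => (((m₁ : ℝ) + (m₂ : ℝ)) / 2) * Real.cos r - ((m₂ : ℝ) - (m₁ : ℝ)) / 2 :=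
      funext hh
    rw [this]; fun_prop
  have hpc : ContinuousOn (fun r => |w r| ^ (p - 1)) (Set.Icc 0 a₀) :=
    hwc.abs.rpow_const (fun x _ => Or.inr (by linarith))
  have hv0 : v 0 = 0 := by
    have hE : Set.EqOn (fun r => h r * v r)
        (fun r => - (Real.sin r * (u r + lam * (|w r| ^ (p - 1) * w r - w r)))) (Set.Icc 0 a₀) := by
      apply Set.EqOn.of_subset_closure (s := Set.Ioo 0 a₀) (t := Set.Icc 0 a₀)
      · intro r hr
        have h1 := hode' r hr
        have h2 := (hsin r hr).ne'
        have h3 : h r / Real.sin r * v r * Real.sin r = h r * v r := by field_simp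
        simp only
        linear_combination Real.sin r * h1 - h3
      · exact hhc.continuousOn.mul hvc
      · exact (Real.continuous_sin.continuousOn.mul
          (huc.add (continuousOn_const.mul ((hpc.mul hwc).sub hwc)))).neg
      · exact Set.Ioo_subset_Icc_self
      · rw [closure_Ioo ha0.ne]
    have h0 := hE (Set.left_mem_Icc.2 ha0.le)
    simp only [Real.sin_zero, zero_mul, neg_zero, hh, Real.cos_zero] at h0
    rcases mul_eq_zero.1 h0 with h0 | h0
    · linarith
    · exact h0
  have hhn : ∀ r ∈ Set.Ioo 0 a₀, 0 ≤ h r := by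
    intro r hr
    have hc := Real.cos_le_cos_of_nonneg_of_le_pi hr.1.le hapi.le hr.2.le
    rw [← ha₀z, hh, hh]
    have := mul_le_mul_of_nonneg_left hc (show 0 ≤ ((m₁ : ℝ) + (m₂ : ℝ)) / 2 by linarith)
    linarith
  let E : ℝ → ℝ := fun r => v r ^ 2 / 2 + lam * (|w r| ^ (p + 1) / (p + 1) - w r ^ 2 / 2)
  have hEc : ContinuousOn E (Set.Icc 0 a₀) :=
    ((hvc.pow 2).div_const 2).add (continuousOn_const.mul
      (((hwc.abs.rpow_const (fun x _ => Or.inr (by linarith))).div_const _).sub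
        ((hwc.pow 2).div_const 2)))
  have hEd : ∀ r ∈ Set.Ioo 0 a₀, HasDerivAt E (-(h r / Real.sin r) * v r ^ 2) r := by
    intro r hr
    have h1 := ((hasDerivAt_abs_rpow (w r) (show 1 < p + 1 by linarith)).comp r (hwd r hr))
    have h2 := (((hvd r hr).pow 2).div_const 2).add
      (((h1.div_const (p + 1)).sub (((hwd r hr).pow 2).div_const 2)).const_mul lam)
    refine h2.congr_deriv ?_
    have h3 := hode' r hr
    have h4 : p + 1 - 2 = p - 1 := by ring
    have h5 : (p + 1) ≠ 0 := by linarith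
    rw [h4]
    have h6 : (p + 1) * |w r| ^ (p - 1) * w r * v r / (p + 1) = |w r| ^ (p - 1) * w r * v r := by
      field_simp
    rw [h6]
    push_cast
    linear_combination v r * h3
  have hEa : AntitoneOn E (Set.Icc 0 a₀) := by
    apply antitoneOn_of_deriv_nonpos (convex_Icc _ _) hEc
    · rw [interior_Icc]
      exact fun r hr => (hEd r hr).differentiableAt.differentiableWithinAt
    · rw [interior_Icc]
      intro r hr
      rw [(hEd r hr).deriv]
      have := mul_nonneg (div_nonneg (hhn r hr) (hsin r hr).le) (sq_nonneg (v r))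
      linarith
  have hE0 : E 0 < 0 := by
    have h1 : d ^ (p + 1) ≤ d ^ 2 := by
      rw [← Real.rpow_natCast]
      exact Real.rpow_le_rpow_of_exponent_ge hd0 hd1 (by push_cast; linarith)
    have h2 : d ^ (p + 1) / (p + 1) < d ^ 2 / 2 := by
      have h3 : 0 < d ^ 2 := by positivity
      rw [div_lt_div_iff₀ (by linarith) (by norm_num)]
      nlinarith
    have h4 : E 0 = lam * (d ^ (p + 1) / (p + 1) - d ^ 2 / 2) := by
      simp only [E, hv0, hw0, abs_of_pos hd0]; ring
    rw [h4]
    exact mul_neg_of_pos_of_neg hlam0 (by linarith)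
  have hne : ∀ r ∈ Set.Icc 0 a₀, w r ≠ 0 := by
    intro r hr h0
    have h1 := hEa (Set.left_mem_Icc.2 ha0.le) hr hr.1
    have h2 : E r = v r ^ 2 / 2 := by
      simp only [E, h0, abs_zero]
      rw [Real.zero_rpow (by linarith)]; ring
    have := sq_nonneg (v r)
    linarith
  intro r hr
  by_contra hcon
  have hsub : Set.Icc 0 r ⊆ Set.Icc 0 a₀ := Set.Icc_subset_Icc_right hr.2
  obtain ⟨x, hx, hx0⟩ := intermediate_value_Icc' hr.1 (hwc.mono hsub)
    (show (0:ℝ) ∈ Set.Icc (w r) (w 0) from ⟨not_lt.1 hcon, hw0 ▸ hd0.le⟩)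
  exact hne x (hsub hx) hx0
end

section
/- Assume the family (w_d), the map I, the argument function θ, and the zero-count n(d) as in the context. Suppose θ(d*) = −π/2 − kπ for some d* > 0 and some integer k ≥ 0, and suppose w_{d*} has exactly m zeroes in [0,a₀) (i.e. n(d*) = m ≥ 0). Then for every ε with 0 < ε < π there exists δ > 0 such that for all d > 0 with |d − d*| < δ: θ(d) ∈ (−π/2 − kπ − ε, −π/2 − kπ + ε), and moreover n(d) = m + 1 if and only if θ(d) < −π/2 − kπ, and n(d) = m if and only if θ(d) ≥ −π/2 − kπ. -/
lemma aux_nbhd (P : ℝ × ℝ → Prop) (d0 z : ℝ) (h : ∀ᶠ q in nhds (d0, z), P q) :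
    ∀ᶠ η in nhdsWithin (0:ℝ) (Set.Ioi 0), ∀ᶠ d in nhds d0, ∀ x, |x - z| ≤ η → P (d, x) := by
  rw [nhds_prod_eq] at h
  obtain ⟨pa, ha, pb, hb, hab⟩ := Filter.eventually_prod_iff.1 h
  obtain ⟨e, he, hball⟩ := Metric.eventually_nhds_iff.1 hb
  filter_upwards [Ioo_mem_nhdsGT he] with η hη
  filter_upwards [ha] with d hd x hx
  exact hab hd (hball (by rw [Real.dist_eq]; exact lt_of_le_of_lt hx hη.2))

lemma aux_sign (f : ℝ → ℝ) (z : ℝ) (hz : f z = 0) (hd : deriv f z ≠ 0) :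
    ∀ᶠ η in nhdsWithin (0:ℝ) (Set.Ioi 0),
      f (z - η) * deriv f z < 0 ∧ 0 < f (z + η) * deriv f z := by
  have key : ∀ᶠ x in nhds z, x ≠ z → 0 < f x * deriv f z * (x - z) := by
    have hD : HasDerivAt f (deriv f z) z := (differentiableAt_of_deriv_ne_zero hd).hasDerivAt
    have h1 := hasDerivAt_iff_tendsto_slope.1 hD
    have h2 : Filter.Tendsto (fun x => slope f z x * deriv f z) (nhdsWithin z {z}ᶜ)
        (nhds (deriv f z * deriv f z)) := h1.mul_const _
    have h3 := h2.eventually_const_lt (mul_self_pos.2 hd)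
    have h4 := eventually_nhdsWithin_iff.1 h3
    filter_upwards [h4] with x hx hne
    have h5 := hx hne
    have hne' : x - z ≠ 0 := sub_ne_zero.2 hne
    rw [slope_def_field, hz, sub_zero] at h5
    have h6 : f x * deriv f z * (x - z) = (f x / (x - z) * deriv f z) * ((x - z) * (x - z)) := by
      field_simp
    rw [h6]
    exact mul_pos h5 (mul_self_pos.2 hne')
  obtain ⟨e, he, hball⟩ := Metric.eventually_nhds_iff.1 key
  filter_upwards [Ioo_mem_nhdsGT he] with η hη
  have hη0 : 0 < η := hη.1
  constructor
  · have := hball (y := z - η) (by rw [Real.dist_eq]; simp [abs_of_pos hη0, hη.2]) (by linarith)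
    have e1 : z - η - z = -η := by ring
    rw [e1] at this
    by_contra hc
    nlinarith [mul_nonneg (not_lt.1 hc) hη0.le]
  · have := hball (y := z + η) (by rw [Real.dist_eq]; simp [abs_of_pos hη0, hη.2]) (by linarith)
    have e1 : z + η - z = η := by ring
    rw [e1] at this
    exact pos_of_mul_pos_left this hη0.le

lemma aux_ivt (f : ℝ → ℝ) (hf : Continuous f) (x y c : ℝ) (hxy : x < y)
    (h1 : f x * c < 0) (h2 : 0 < f y * c) : ∃ z ∈ Set.Ioo x y, f z = 0 := by
  have hc : c ≠ 0 := by rintro rfl; simp at h1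
  obtain ⟨z, hz, hz0⟩ := intermediate_value_Ioo hxy.le (f := fun t => f t * c)
    (by fun_prop) (show (0:ℝ) ∈ Set.Ioo _ _ from ⟨h1, h2⟩)
  exact ⟨z, hz, by simpa [hc] using hz0⟩

lemma aux_rolle (f : ℝ → ℝ) (hf : Continuous f) (s : Set ℝ) (hs : s.OrdConnected)
    (hd : ∀ x ∈ s, deriv f x ≠ 0) (x y : ℝ) (hx : x ∈ s) (hy : y ∈ s)
    (hfx : f x = 0) (hfy : f y = 0) : x = y := by
  by_contra hne
  rcases lt_or_gt_of_ne hne with h | h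
  · obtain ⟨c, hc, hc0⟩ := exists_deriv_eq_zero h hf.continuousOn (hfx.trans hfy.symm)
    exact hd c (hs.out hx hy ⟨hc.1.le, hc.2.le⟩) hc0
  · obtain ⟨c, hc, hc0⟩ := exists_deriv_eq_zero h hf.continuousOn (hfy.trans hfx.symm)
    exact hd c (hs.out hy hx ⟨hc.1.le, hc.2.le⟩) hc0

lemma aux_count (W : ℝ → ℝ → ℝ)
    (hW : Continuous fun q : ℝ × ℝ => W q.1 q.2)
    (hW' : Continuous fun q : ℝ × ℝ => deriv (W q.1) q.2)
    (d0 a : ℝ) (h00 : W d0 0 ≠ 0) (h0a : W d0 a = 0)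
    (hfin : {r ∈ Set.Ico (0 : ℝ) a | W d0 r = 0}.Finite)
    (hsimple : ∀ z ∈ Set.Icc 0 a, W d0 z = 0 → deriv (W d0) z ≠ 0) (ha : 0 < a) :
    ∀ᶠ d in nhds d0,
      (0 < W d a * deriv (W d0) a → {r ∈ Set.Ico (0 : ℝ) a | W d r = 0}.ncard =
        {r ∈ Set.Ico (0 : ℝ) a | W d0 r = 0}.ncard + 1) ∧
      (W d a * deriv (W d0) a ≤ 0 → {r ∈ Set.Ico (0 : ℝ) a | W d r = 0}.ncard =
        {r ∈ Set.Ico (0 : ℝ) a | W d0 r = 0}.ncard) := by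
  set S := {r ∈ Set.Ico (0 : ℝ) a | W d0 r = 0} with hS
  set c := deriv (W d0) a with hc
  have hWd : ∀ d, Continuous (W d) := fun d =>
    hW.comp (Continuous.prodMk continuous_const continuous_id)
  have hWx : ∀ x, Continuous (fun d => W d x) := fun x =>
    hW.comp (Continuous.prodMk continuous_id continuous_const)
  have hc0 : c ≠ 0 := hsimple a ⟨ha.le, le_rfl⟩ h0a
  have hSpos : ∀ z ∈ S, 0 < z := by
    intro z hz
    rcases hz.1.1.lt_or_eq with h | h
    · exact h
    · exact absurd (h ▸ hz.2) h00
  have hSs : ∀ z ∈ S, deriv (W d0) z ≠ 0 := fun z hz => hsimple z ⟨hz.1.1, hz.1.2.le⟩ hz.2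
  have small : ∀ e : ℝ, 0 < e → ∀ᶠ η in nhdsWithin (0:ℝ) (Set.Ioi 0), η < e := fun e he => by
    filter_upwards [Ioo_mem_nhdsGT he] with η hη using hη.2
  -- conditions on the radius
  have E1 : ∀ᶠ η in nhdsWithin (0:ℝ) (Set.Ioi 0), ∀ z ∈ S,
      W d0 (z - η) * deriv (W d0) z < 0 ∧ 0 < W d0 (z + η) * deriv (W d0) z := by
    rw [Filter.eventually_all_finite hfin]
    exact fun z hz => aux_sign _ z hz.2 (hSs z hz)
  have E2 : ∀ᶠ η in nhdsWithin (0:ℝ) (Set.Ioi 0), ∀ z ∈ S, η < z ∧ η < (a - z) / 2 := by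
    rw [Filter.eventually_all_finite hfin]
    intro z hz
    exact (small z (hSpos z hz)).and (small _ (by have := hz.1.2; linarith))
  have E3 : ∀ᶠ η in nhdsWithin (0:ℝ) (Set.Ioi 0), ∀ z ∈ S, ∀ z' ∈ S, z ≠ z' →
      η < |z - z'| / 2 := by
    rw [Filter.eventually_all_finite hfin]
    intro z hz
    rw [Filter.eventually_all_finite hfin]
    intro z' hz'
    by_cases h : z = z'
    · exact Filter.Eventually.of_forall fun _ h' => absurd h h'
    · filter_upwards [small (|z - z'| / 2) (half_pos (abs_pos.2 (sub_ne_zero.2 h)))] with η hη _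
        using hη
  have E4 : ∀ᶠ η in nhdsWithin (0:ℝ) (Set.Ioi 0), ∀ z ∈ S, ∀ᶠ d in nhds d0,
      ∀ x, |x - z| ≤ η → deriv (W d) x ≠ 0 := by
    rw [Filter.eventually_all_finite hfin]
    intro z hz
    exact aux_nbhd (fun q => deriv (W q.1) q.2 ≠ 0) d0 z
      (hW'.continuousAt.eventually_ne (hSs z hz))
  have E5 : ∀ᶠ η in nhdsWithin (0:ℝ) (Set.Ioi 0), ∀ᶠ d in nhds d0,
      ∀ x, |x - a| ≤ η → 0 < deriv (W d) x * c := by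
    refine aux_nbhd (fun q => 0 < deriv (W q.1) q.2 * c) d0 a ?_
    have : ContinuousAt (fun q : ℝ × ℝ => deriv (W q.1) q.2 * c) (d0, a) :=
      (hW'.mul continuous_const).continuousAt
    exact this.eventually_const_lt (mul_self_pos.2 hc0)
  have E6 := aux_sign (W d0) a h0a hc0
  have E0 : ∀ᶠ η in nhdsWithin (0:ℝ) (Set.Ioi 0), η ∈ Set.Ioi (0:ℝ) := self_mem_nhdsWithin
  obtain ⟨η, ⟨hη0, F1, F2, F3, F4, F5, F6⟩, hηa⟩ :=
    ((E0.and (E1.and (E2.and (E3.and (E4.and (E5.and E6)))))).and (small a ha)).exists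
  replace hη0 : 0 < η := hη0
  -- compact complement
  set K : Set ℝ := {x ∈ Set.Icc 0 a | (∀ z ∈ S, η ≤ |x - z|) ∧ η ≤ |x - a|} with hK
  have hKc : IsCompact K := by
    have : IsClosed {x : ℝ | (∀ z ∈ S, η ≤ |x - z|) ∧ η ≤ |x - a|} := by
      have h1 : IsClosed {x : ℝ | ∀ z ∈ S, η ≤ |x - z|} := by
        simp only [Set.setOf_forall]
        exact isClosed_iInter fun z => isClosed_iInter fun _ =>
          isClosed_le continuous_const (by fun_prop)
      have h2 : IsClosed {x : ℝ | η ≤ |x - a|} := isClosed_le continuous_const (by fun_prop)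
      exact h1.inter h2
    exact isCompact_Icc.inter_right this
  have G1 : ∀ᶠ d in nhds d0, ∀ x ∈ K, W d x ≠ 0 := by
    apply hKc.eventually_forall_of_forall_eventually
    intro x hx
    refine hW.continuousAt.eventually_ne ?_
    show W d0 x ≠ 0
    intro h0
    rcases hx.1.2.lt_or_eq with h | h
    · have := hx.2.1 x ⟨⟨hx.1.1, h⟩, h0⟩
      simp at this; linarith
    · have := hx.2.2
      simp [h] at this; linarith
  have G2 : ∀ᶠ d in nhds d0, ∀ z ∈ S,
      W d (z - η) * deriv (W d0) z < 0 ∧ 0 < W d (z + η) * deriv (W d0) z := by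
    rw [Filter.eventually_all_finite hfin]
    intro z hz
    have c1 : ContinuousAt (fun d => W d (z - η) * deriv (W d0) z) d0 :=
      ((hWx _).mul continuous_const).continuousAt
    have c2 : ContinuousAt (fun d => W d (z + η) * deriv (W d0) z) d0 :=
      ((hWx _).mul continuous_const).continuousAt
    exact (c1.eventually_lt_const (F1 z hz).1).and (c2.eventually_const_lt (F1 z hz).2)
  have G3 : ∀ᶠ d in nhds d0, W d (a - η) * c < 0 := by
    have c1 : ContinuousAt (fun d => W d (a - η) * c) d0 :=
      ((hWx _).mul continuous_const).continuousAt
    exact c1.eventually_lt_const F6.1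
  have G4 := (Filter.eventually_all_finite hfin).2 F4
  filter_upwards [G1, G2, G3, G4, F5] with d g1 g2 g3 g4 g5
  have hex : ∀ z, ∃ y, z ∈ S → |y - z| < η ∧ W d y = 0 := by
    intro z
    by_cases hz : z ∈ S
    · obtain ⟨y, hy, hy0⟩ := aux_ivt (W d) (hWd d) (z - η) (z + η) _ (by linarith)
        (g2 z hz).1 (g2 z hz).2
      exact ⟨y, fun _ => ⟨abs_lt.2 ⟨by linarith [hy.1], by linarith [hy.2]⟩, hy0⟩⟩
    · exact ⟨0, fun h => absurd h hz⟩
  choose f hf using hex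
  have hinj : Set.InjOn f S := by
    intro z hz z' hz' hzz
    by_contra hne
    have h1 := F3 z hz z' hz' hne
    have h2 := (hf z hz).1
    have h3 := (hf z' hz').1
    rw [← hzz] at h3
    have h4 : |z - z'| ≤ |f z - z| + |f z - z'| := by
      have := abs_sub_le z (f z) z'
      rwa [abs_sub_comm z (f z)] at this
    linarith
  have hfa : ∀ z ∈ S, f z < a - η ∧ 0 < f z := by
    intro z hz
    have h1 := abs_lt.1 (hf z hz).1
    have h2 := F2 z hz
    constructor <;> linarith
  have hsub : f '' S ⊆ {r ∈ Set.Ico (0 : ℝ) a | W d r = 0} := by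
    rintro _ ⟨z, hz, rfl⟩
    exact ⟨⟨(hfa z hz).2.le, by linarith [(hfa z hz).1]⟩, (hf z hz).2⟩
  have hcard : (f '' S).ncard = S.ncard := Set.ncard_image_of_injOn hinj
  have hcov : ∀ x ∈ Set.Ico (0:ℝ) a, W d x = 0 → x ∈ f '' S ∨ |x - a| < η := by
    intro x hx hx0
    by_contra! hcon
    refine g1 x ⟨⟨hx.1, hx.2.le⟩, ?_, hcon.2⟩ hx0
    intro z hz
    by_contra! hlt
    apply hcon.1
    refine ⟨z, hz, ?_⟩
    refine aux_rolle (W d) (hWd d) (Set.Icc (z - η) (z + η)) Set.ordConnected_Icc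
      (fun y hy => g4 z hz y (abs_le.2 ⟨by linarith [hy.1], by linarith [hy.2]⟩)) _ _ ?_ ?_
      (hf z hz).2 hx0
    · have := abs_lt.1 (hf z hz).1
      exact ⟨by linarith, by linarith⟩
    · have := abs_lt.1 hlt
      exact ⟨by linarith, by linarith⟩
  constructor
  · intro hpos
    obtain ⟨y, hy, hy0⟩ := aux_ivt (W d) (hWd d) (a - η) a c (by linarith) g3 hpos
    have hyn : y ∉ f '' S := by
      rintro ⟨z, hz, rfl⟩
      linarith [(hfa z hz).1, hy.1]
    have : {r ∈ Set.Ico (0 : ℝ) a | W d r = 0} = insert y (f '' S) := by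
      apply Set.Subset.antisymm
      · rintro x ⟨hx, hx0⟩
        rcases hcov x hx hx0 with h | h
        · exact Or.inr h
        · left
          refine aux_rolle (W d) (hWd d) (Set.Icc (a - η) a) Set.ordConnected_Icc
            (fun t ht h0 => ?_) _ _ ?_ ⟨hy.1.le, hy.2.le⟩ hx0 hy0
          · have := g5 t (abs_le.2 ⟨by linarith [ht.1], by linarith [ht.2]⟩)
            simp [h0] at this
          · exact ⟨by linarith [(abs_lt.1 h).1], hx.2.le⟩
      · apply Set.insert_subset _ hsub
        exact ⟨⟨by linarith [hy.1], hy.2⟩, hy0⟩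
    rw [this, Set.ncard_insert_of_notMem hyn (hfin.image f), hcard]
  · intro hneg
    have : {r ∈ Set.Ico (0 : ℝ) a | W d r = 0} = f '' S := by
      apply Set.Subset.antisymm _ hsub
      rintro x ⟨hx, hx0⟩
      rcases hcov x hx hx0 with h | h
      · exact h
      · exfalso
        have h' := (abs_lt.1 h).1
        have hpos : ∀ t, x ≤ t → t ≤ a → 0 < deriv (W d) t * c := fun t h1 h2 =>
          g5 t (abs_le.2 ⟨by linarith, by linarith⟩)
        obtain ⟨t, ht, hte⟩ := exists_deriv_eq_slope (W d) hx.2 (hWd d).continuousOn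
          (fun t ht => (differentiableAt_of_deriv_ne_zero (fun h0 => by
            have := hpos t ht.1.le ht.2.le
            simp [h0] at this)).differentiableWithinAt)
        have h3 := hpos t ht.1.le ht.2.le
        have hxa : 0 < a - x := sub_pos.2 hx.2
        rw [hte, hx0, sub_zero, div_mul_eq_mul_div] at h3
        have := (div_pos_iff_of_pos_right hxa).1 h3
        linarith
    rw [this, hcard]

lemma aux_ode (w A B : ℝ → ℝ) (r a : ℝ) (hra : r < a)
    (hw : Continuous w) (hw' : Continuous (deriv w))
    (hdiff : ∀ x ∈ Set.Ioo r a, DifferentiableAt ℝ (deriv w) x)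
    (hdiff0 : ∀ x ∈ Set.Ioo r a, DifferentiableAt ℝ w x)
    (hdr : DifferentiableAt ℝ w r) (hdr' : DifferentiableAt ℝ (deriv w) r)
    (hA : ContinuousOn A (Set.Icc r a)) (hB : ContinuousOn B (Set.Icc r a))
    (hode : ∀ x ∈ Set.Ico r a, deriv (deriv w) x = A x * deriv w x + B x * w x)
    (h0 : w r = 0) (h0' : deriv w r = 0) : w a = 0 ∧ deriv w a = 0 := by
  obtain ⟨KA, hKA⟩ := isCompact_Icc.exists_bound_of_continuousOn hA
  obtain ⟨KB, hKB⟩ := isCompact_Icc.exists_bound_of_continuousOn hB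
  have hdw : ∀ x ∈ Set.Ico r a, DifferentiableAt ℝ w x := by
    intro x hx
    rcases hx.1.lt_or_eq with h | h
    · exact hdiff0 x ⟨h, hx.2⟩
    · exact h ▸ hdr
  have hdw' : ∀ x ∈ Set.Ico r a, DifferentiableAt ℝ (deriv w) x := by
    intro x hx
    rcases hx.1.lt_or_eq with h | h
    · exact hdiff x ⟨h, hx.2⟩
    · exact h ▸ hdr'
  have key := eq_zero_of_abs_deriv_le_mul_abs_self_of_eq_zero_right
    (f := fun x => (w x, deriv w x)) (f' := fun x => (deriv w x, deriv (deriv w) x))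
    (K := 1 + KA + KB) (a := r) (b := a) (by fun_prop)
    (fun x hx => ((hdw x hx).hasDerivAt.prodMk (hdw' x hx).hasDerivAt).hasDerivWithinAt)
    (by simp [h0, h0'])
    (by
      intro x hx
      have hx' : x ∈ Set.Icc r a := ⟨hx.1, hx.2.le⟩
      have b1 := hKA x hx'
      have b2 := hKB x hx'
      have b3 : 0 ≤ KA := (norm_nonneg _).trans b1
      have b4 : 0 ≤ KB := (norm_nonneg _).trans b2
      have n1 : ‖w x‖ ≤ ‖(w x, deriv w x)‖ := norm_fst_le (w x, deriv w x)
      have n2 : ‖deriv w x‖ ≤ ‖(w x, deriv w x)‖ := norm_snd_le (w x, deriv w x)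
      set N := ‖(w x, deriv w x)‖
      have hN : 0 ≤ N := norm_nonneg _
      refine norm_prod_le_iff.2 ⟨?_, ?_⟩
      · show ‖deriv w x‖ ≤ _
        nlinarith [mul_nonneg b3 hN, mul_nonneg b4 hN]
      · show ‖deriv (deriv w) x‖ ≤ _
        rw [hode x hx]
        refine (norm_add_le _ _).trans ?_
        rw [norm_mul, norm_mul]
        have m1 := mul_le_mul b1 n2 (norm_nonneg _) b3
        have m2 := mul_le_mul b2 n1 (norm_nonneg _) b4
        nlinarith)
    a ⟨hra.le, le_rfl⟩
  exact ⟨congrArg Prod.fst key, congrArg Prod.snd key⟩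

/-- Lemma 4.2: behaviour of the zero count `n(d)` of `w_d` on `[0,a₀)` near a parameter
`d*` where the argument `θ(d*) = -π/2 - kπ` (i.e. `w_{d*}(a₀) = 0`). -/
theorem zero_count_near_crossing
    (n ℓ m₁ m₂ : ℕ) (hn : 3 ≤ n) (hℓ : 1 ≤ ℓ) (hm₁ : 1 ≤ m₁) (hm₂ : 1 ≤ m₂)
    (p lam : ℝ) (hp : p = ((n : ℝ) + 2) / ((n : ℝ) - 2))
    (hlam : lam = (n : ℝ) * ((n : ℝ) - 2) / (4 * (ℓ : ℝ) ^ 2))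
    (h : ℝ → ℝ)
    (hh : ∀ r : ℝ, h r = (((m₁ : ℝ) + (m₂ : ℝ)) / 2) * Real.cos r - ((m₂ : ℝ) - (m₁ : ℝ)) / 2)
    (a₀ : ℝ) (ha₀ : a₀ ∈ Set.Ioo (0 : ℝ) Real.pi) (ha₀z : h a₀ = 0)
    (W : ℝ → ℝ → ℝ)
    (hWC2 : ∀ d : ℝ, ContDiffOn ℝ 2 (W d) (Set.Icc 0 a₀))
    (hWode : ∀ d : ℝ, ∀ r ∈ Set.Ioc (0 : ℝ) a₀,
      deriv (deriv (W d)) r + (h r / Real.sin r) * deriv (W d) r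
        + lam * (|W d r| ^ (p - 1) * W d r - W d r) = 0)
    (hW0 : ∀ d : ℝ, W d 0 = d) (hW'0 : ∀ d : ℝ, deriv (W d) 0 = 0)
    (hWcont : Continuous fun q : ℝ × ℝ => (W q.1 q.2, deriv (W q.1) q.2))
    (huniq : ∀ d d' : ℝ, W d a₀ = W d' a₀ → deriv (W d) a₀ = deriv (W d') a₀ → d = d')
    (I : ℝ → ℝ × ℝ) (hI : ∀ d : ℝ, I d = (W d a₀, deriv (W d) a₀))
    (hInz : ∀ d : ℝ, d ≠ 0 → I d ≠ (0, 0))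
    (θ : ℝ → ℝ) (hθc : ContinuousOn θ (Set.Ioi 0)) (hθ1 : θ 1 = 0)
    (hθ : ∀ d : ℝ, 0 < d →
      I d = (Real.sqrt ((I d).1 ^ 2 + (I d).2 ^ 2) * Real.cos (θ d),
             Real.sqrt ((I d).1 ^ 2 + (I d).2 ^ 2) * Real.sin (θ d)))
    (hfin : ∀ d : ℝ, d ≠ 0 → {r ∈ Set.Ico (0 : ℝ) a₀ | W d r = 0}.Finite)
    (dstar : ℝ) (hdstar : 0 < dstar) (k : ℕ)
    (hθd : θ dstar = -Real.pi / 2 - (k : ℝ) * Real.pi)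
    (m : ℕ) (hm : {r ∈ Set.Ico (0 : ℝ) a₀ | W dstar r = 0}.ncard = m)
    (ε : ℝ) (hε : 0 < ε) (hεπ : ε < Real.pi) :
    ∃ δ : ℝ, 0 < δ ∧ ∀ d : ℝ, 0 < d → |d - dstar| < δ →
      θ d ∈ Set.Ioo (-Real.pi / 2 - (k : ℝ) * Real.pi - ε) (-Real.pi / 2 - (k : ℝ) * Real.pi + ε) ∧
      ({r ∈ Set.Ico (0 : ℝ) a₀ | W d r = 0}.ncard = m + 1 ↔
        θ d < -Real.pi / 2 - (k : ℝ) * Real.pi) ∧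
      ({r ∈ Set.Ico (0 : ℝ) a₀ | W d r = 0}.ncard = m ↔
        -Real.pi / 2 - (k : ℝ) * Real.pi ≤ θ d) := by
  have hWc : Continuous fun q : ℝ × ℝ => W q.1 q.2 := continuous_fst.comp hWcont
  have hWc' : Continuous fun q : ℝ × ℝ => deriv (W q.1) q.2 := continuous_snd.comp hWcont
  have ha0 : 0 < a₀ := ha₀.1
  have hn3 : (3:ℝ) ≤ n := by exact_mod_cast hn
  have hp1 : 0 < p - 1 := by
    have h2 : (0:ℝ) < (n:ℝ) - 2 := by linarith
    have : p - 1 = 4 / ((n:ℝ) - 2) := by rw [hp]; field_simp; ring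
    rw [this]; positivity
  have hRpos : ∀ d, 0 < d → 0 < Real.sqrt ((I d).1 ^ 2 + (I d).2 ^ 2) := by
    intro d hd
    refine (Real.sqrt_nonneg _).lt_of_ne' fun h0 => hInz d hd.ne' ?_
    have := hθ d hd
    rw [h0] at this
    simpa using this
  have hWθ : ∀ d, 0 < d → W d a₀ = Real.sqrt ((I d).1 ^ 2 + (I d).2 ^ 2) * Real.cos (θ d) := by
    intro d hd
    have := congrArg Prod.fst (hθ d hd)
    rwa [show (I d).1 = W d a₀ by rw [hI]] at this ⊢
  have hWθ' : ∀ d, 0 < d →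
      deriv (W d) a₀ = Real.sqrt ((I d).1 ^ 2 + (I d).2 ^ 2) * Real.sin (θ d) := by
    intro d hd
    have := congrArg Prod.snd (hθ d hd)
    rwa [show (I d).2 = deriv (W d) a₀ by rw [hI]] at this ⊢
  have hcos : Real.cos (θ dstar) = 0 := by
    rw [Real.cos_eq_zero_iff]
    refine ⟨-(k:ℤ) - 1, ?_⟩
    rw [hθd]; push_cast; ring
  have hsimple : ∀ z ∈ Set.Icc 0 a₀, W dstar z = 0 → deriv (W dstar) z ≠ 0 := by
    intro z hz hz0 hz1
    have hzpos : 0 < z := by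
      rcases hz.1.lt_or_eq with h | h
      · exact h
      · rw [← h, hW0] at hz0; exact absurd hz0 hdstar.ne'
    rcases hz.2.lt_or_eq with hza | hza
    swap
    · subst hza
      exact hInz dstar hdstar.ne' (by rw [hI, hz0, hz1])
    have hcd : ∀ x ∈ Set.Ioo 0 a₀, ContDiffAt ℝ 2 (W dstar) x := fun x hx =>
      (hWC2 dstar).contDiffAt (Icc_mem_nhds hx.1 hx.2)
    have hd1 : ∀ x ∈ Set.Ioo 0 a₀, DifferentiableAt ℝ (W dstar) x := fun x hx =>
      (hcd x hx).differentiableAt (by norm_num)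
    have hd2 : ∀ x ∈ Set.Ioo 0 a₀, DifferentiableAt ℝ (deriv (W dstar)) x := fun x hx =>
      ((hcd x hx).derivWithin (m := 1) (by norm_num)).differentiableAt (by norm_num)
    have hwc : Continuous (W dstar) := hWc.comp (Continuous.prodMk continuous_const continuous_id)
    have hwc' : Continuous (deriv (W dstar)) :=
      hWc'.comp (Continuous.prodMk continuous_const continuous_id)
    have hhc : Continuous h := by
      rw [show h = _ from funext hh]; fun_prop
    have hres := aux_ode (W dstar) (fun r => -(h r / Real.sin r))
      (fun r => -(lam * (|W dstar r| ^ (p - 1) - 1))) z a₀ hza hwc hwc'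
      (fun x hx => hd2 x ⟨hzpos.trans hx.1, hx.2⟩) (fun x hx => hd1 x ⟨hzpos.trans hx.1, hx.2⟩)
      (hd1 z ⟨hzpos, hza⟩) (hd2 z ⟨hzpos, hza⟩)
      ((hhc.continuousOn.div Real.continuous_sin.continuousOn (fun x hx =>
        (Real.sin_pos_of_pos_of_lt_pi (hzpos.trans_le hx.1) (hx.2.trans_lt ha₀.2)).ne')).neg)
      (((continuous_const.mul ((hwc.abs.rpow_const
        (fun _ => Or.inr hp1.le)).sub continuous_const)).neg).continuousOn)
      (fun x hx => by
        have := hWode dstar x ⟨hzpos.trans_le hx.1, hx.2.le⟩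
        linear_combination this) hz0 hz1
    exact hInz dstar hdstar.ne' (by rw [hI, hres.1, hres.2])
  have hcount := aux_count W hWc hWc' dstar a₀ (by rw [hW0]; exact hdstar.ne')
    (by rw [hWθ _ hdstar, hcos, mul_zero]) (hfin dstar hdstar.ne') hsimple ha0
  have hθat : ContinuousAt θ dstar := hθc.continuousAt (Ioi_mem_nhds hdstar)
  have hθev : ∀ᶠ d in nhds dstar, θ d ∈ Set.Ioo (θ dstar - ε) (θ dstar + ε) :=
    hθat (Ioo_mem_nhds (by linarith) (by linarith))
  obtain ⟨δ, hδ, hball⟩ := Metric.eventually_nhds_iff.1 (hcount.and hθev)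
  refine ⟨δ, hδ, fun d hd hdd => ?_⟩
  obtain ⟨⟨c1, c2⟩, c3⟩ := hball (y := d) (by rwa [Real.dist_eq])
  rw [hm] at c1 c2
  rw [← hθd]
  refine ⟨c3, ?_⟩
  have hsin2 : Real.sin (θ dstar) ^ 2 = 1 := by
    have := Real.sin_sq_add_cos_sq (θ dstar)
    rw [hcos] at this; linarith
  set t := θ d - θ dstar with ht
  have hprod : W d a₀ * deriv (W dstar) a₀ =
      (Real.sqrt ((I d).1 ^ 2 + (I d).2 ^ 2) *
        Real.sqrt ((I dstar).1 ^ 2 + (I dstar).2 ^ 2)) * (-Real.sin t) := by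
    have e : Real.cos (θ d) = - (Real.sin (θ dstar) * Real.sin t) := by
      rw [show θ d = θ dstar + t by rw [ht]; ring, Real.cos_add, hcos]; ring
    rw [hWθ d hd, hWθ' dstar hdstar, e]
    linear_combination (-(Real.sqrt ((I d).1 ^ 2 + (I d).2 ^ 2)) *
        Real.sqrt ((I dstar).1 ^ 2 + (I dstar).2 ^ 2) * Real.sin t) * hsin2
  have hRR := mul_pos (hRpos d hd) (hRpos dstar hdstar)
  rcases lt_or_ge (θ d) (θ dstar) with hlt | hge
  · have hs : Real.sin t < 0 := Real.sin_neg_of_neg_of_neg_pi_lt (by linarith) (by linarith [c3.1])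
    have := c1 (by rw [hprod]; exact mul_pos hRR (by linarith))
    rw [this]
    exact ⟨by simp [hlt], by simp [hlt]⟩
  · have hs : 0 ≤ Real.sin t :=
      Real.sin_nonneg_of_nonneg_of_le_pi (by linarith) (by linarith [c3.2])
    have := c2 (by rw [hprod]; exact mul_nonpos_of_nonneg_of_nonpos hRR.le (by linarith))
    rw [this]
    exact ⟨by simp [hge], by simp [hge]⟩
end

section
/- Assume the family (w_d), the map I, the argument function θ, and the zero-count n(d) as in the context. Then for every d > 0 one has θ(d) < π/2 and n(d) = −⌊(θ(d) − π/2)/π⌋ − 1, where ⌊x⌋ denotes the greatest integer less than or equal to x. -/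
section ZC
open Set Filter Topology

lemma zc_fwd {φ : ℝ → ℝ} {a c : ℝ} (hφ : ContinuousOn φ (Icc 0 a))
    (hl : ∀ s ∈ Ioc 0 a, φ s = c → ∃ q < s, ∀ r ∈ Ioo q s, 0 ≤ r → c < φ r)
    {x y : ℝ} (hx : 0 ≤ x) (hxy : x ≤ y) (hy : y ≤ a) (h : φ x < c) : φ y < c := by
  by_contra hc
  push Not at hc
  have hc1 : ContinuousOn φ (Icc x y) := hφ.mono (Icc_subset_Icc hx hy)
  have hS : IsCompact (Icc x y ∩ φ ⁻¹' Ici c) :=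
    isCompact_Icc.of_isClosed_subset (hc1.preimage_isClosed_of_isClosed isClosed_Icc isClosed_Ici)
      inter_subset_left
  obtain ⟨s, ⟨⟨hs1, hs2⟩, hs3⟩, hs4⟩ := hS.exists_isLeast ⟨y, ⟨hxy, le_rfl⟩, hc⟩
  have hs3' : c ≤ φ s := hs3
  obtain ⟨t, ht, htc⟩ := intermediate_value_Icc hs1 (hc1.mono (Icc_subset_Icc le_rfl hs2))
    ⟨h.le, hs3'⟩
  have hst : s ≤ t := hs4 ⟨⟨ht.1, ht.2.trans hs2⟩, htc.ge⟩
  have hts : t = s := le_antisymm ht.2 hst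
  subst hts
  have hxs : x < t := lt_of_le_of_ne hs1 (by rintro rfl; exact h.not_ge hs3')
  obtain ⟨q, hq, hq2⟩ := hl t ⟨hx.trans_lt hxs, hs2.trans hy⟩ htc
  obtain ⟨r, hr1, hr2⟩ := exists_between (max_lt hq hxs)
  have hr3 := max_lt_iff.1 hr1
  have := hq2 r ⟨hr3.1, hr2⟩ (hx.trans hr3.2.le)
  have := hs4 ⟨⟨hr3.2.le, hr2.le.trans hs2⟩, this.le⟩
  linarith

lemma zc_count {φ w : ℝ → ℝ} {a : ℝ} (ha : 0 < a) (hφ : ContinuousOn φ (Icc 0 a))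
    (h0 : φ 0 = 0) (hw : ∀ r ∈ Icc 0 a, w r = 0 ↔ Real.cos (φ r) = 0)
    (hcr : ∀ s ∈ Icc 0 a, Real.cos (φ s) = 0 →
      ∀ᶠ r in 𝓝[Icc 0 a \ {s}] s, (φ r - φ s) * (r - s) < 0) :
    φ a < Real.pi / 2 ∧ ({r ∈ Ico (0 : ℝ) a | w r = 0}.ncard : ℤ)
        = -⌊(φ a - Real.pi / 2) / Real.pi⌋ - 1 := by
  have hpi := Real.pi_pos
  have hcr' : ∀ s ∈ Icc 0 a, Real.cos (φ s) = 0 → ∃ ε > 0, ∀ r ∈ Icc 0 a, r ≠ s → |r - s| < ε →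
      (φ r - φ s) * (r - s) < 0 := by
    intro s hs hc
    have := hcr s hs hc
    rw [eventually_nhdsWithin_iff, Metric.eventually_nhds_iff] at this
    obtain ⟨ε, he, H⟩ := this
    exact ⟨ε, he, fun r hr hrs hd => H (by rwa [Real.dist_eq]) ⟨hr, hrs⟩⟩
  have hlev : ∀ m : ℤ, Real.cos (Real.pi / 2 + m * Real.pi) = 0 := by
    intro m
    rw [Real.cos_eq_zero_iff]; exact ⟨m, by ring⟩
  have hfw : ∀ m : ℤ, ∀ x y : ℝ, 0 ≤ x → x ≤ y → y ≤ a → φ x < Real.pi / 2 + m * Real.pi →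
      φ y < Real.pi / 2 + m * Real.pi := by
    intro m x y hx hxy hy h
    refine zc_fwd hφ ?_ hx hxy hy h
    intro s hs hsc
    obtain ⟨ε, he, H⟩ := hcr' s ⟨hs.1.le, hs.2⟩ (hsc ▸ hlev m)
    refine ⟨s - ε, by linarith, fun r hr hr0 => ?_⟩
    have := H r ⟨hr0, hr.2.le.trans hs.2⟩ hr.2.ne (by rw [abs_lt]; constructor <;> linarith [hr.1, hr.2])
    rw [← hsc]
    nlinarith [hr.2]
  -- after hitting a level
  have haft : ∀ m : ℤ, ∀ x y : ℝ, 0 ≤ x → x < y → y ≤ a → φ x = Real.pi / 2 + m * Real.pi →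
      φ y < Real.pi / 2 + m * Real.pi := by
    intro m x y hx hxy hy h
    obtain ⟨ε, he, H⟩ := hcr' x ⟨hx, hxy.le.trans hy⟩ (h ▸ hlev m)
    obtain ⟨r, hr1, hr2⟩ := exists_between (lt_min hxy (by linarith : x < x + ε))
    have hr3 := lt_min_iff.1 hr2
    have := H r ⟨by linarith, by linarith⟩ hr1.ne' (by rw [abs_lt]; constructor <;> linarith)
    refine hfw m r y (by linarith) hr3.1.le hy ?_
    rw [← h]; nlinarith
  have hlt : φ a < Real.pi / 2 := by
    have := hfw 0 0 a le_rfl ha.le le_rfl (by rw [h0]; push_cast; linarith)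
    simpa using this
  refine ⟨hlt, ?_⟩
  set F : ℤ := ⌊(φ a - Real.pi / 2) / Real.pi⌋ with hF
  have hmF : ∀ m : ℤ, φ a < Real.pi / 2 + m * Real.pi ↔ F < m := by
    intro m
    rw [hF, Int.floor_lt, div_lt_iff₀ hpi]
    constructor <;> intro h <;> linarith
  have hF1 : F < 0 := by
    rw [← hmF]; simpa using hlt
  have hneg : ∀ m : ℤ, 0 < Real.pi / 2 + m * Real.pi ↔ 0 ≤ m := by
    intro m
    constructor
    · intro h
      by_contra hm
      have : (m : ℝ) ≤ -1 := by exact_mod_cast (by omega : m ≤ -1)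
      nlinarith
    · intro h
      have : (0 : ℝ) ≤ m := by exact_mod_cast h
      nlinarith
  have hcard : {r ∈ Ico (0 : ℝ) a | w r = 0}.ncard = (↑(Finset.Icc (F + 1) (-1)) : Set ℤ).ncard := by
    have hex : ∀ r ∈ {r ∈ Ico (0 : ℝ) a | w r = 0}, ∃ m : ℤ, φ r = Real.pi / 2 + m * Real.pi := by
      rintro r ⟨hr, hr0⟩
      rw [hw r ⟨hr.1, hr.2.le⟩, Real.cos_eq_zero_iff] at hr0
      obtain ⟨k, hk⟩ := hr0
      exact ⟨k, by rw [hk]; ring⟩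
    choose! g hg using hex
    have hinj : ∀ m : ℤ, ∀ x y : ℝ, 0 ≤ x → x ≤ a → 0 ≤ y → y ≤ a →
        φ x = Real.pi / 2 + m * Real.pi → φ y = Real.pi / 2 + m * Real.pi → x = y := by
      intro m x y hx hx' hy hy' h1 h2
      rcases lt_trichotomy x y with h | h | h
      · have := haft m x y hx h hy' h1; linarith
      · exact h
      · have := haft m y x hy h hx' h2; linarith
    refine Set.ncard_congr (fun r _ => g r) ?_ ?_ ?_
    · intro r hr
      have hgr := hg r hr
      simp only [Finset.coe_Icc, mem_Icc]
      have h1 := (hmF (g r)).1 (haft _ r a hr.1.1 hr.1.2 le_rfl hgr)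
      have h2 : ¬ 0 ≤ g r := by
        rw [← hneg]
        intro h
        have := hfw (g r) 0 r le_rfl hr.1.1 hr.1.2.le (by rw [h0]; exact h)
        linarith
      omega
    · intro x y hx hy hxy
      have h1 := hg x hx
      have h2 := hg y hy
      rw [← hxy] at h2
      exact hinj _ x y hx.1.1 hx.1.2.le hy.1.1 hy.1.2.le h1 h2
    · intro m hm
      simp only [Finset.coe_Icc, mem_Icc] at hm
      have h1 := (hmF m).2 (by omega)
      have h2 : Real.pi / 2 + m * Real.pi ≤ φ 0 := by
        rw [h0]; by_contra h; push Not at h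
        have := (hneg m).1 h; omega
      obtain ⟨r, hr, hrc⟩ := intermediate_value_Icc' ha.le hφ ⟨h1.le, h2⟩
      have hra : r < a := lt_of_le_of_ne hr.2 (by rintro rfl; linarith)
      have hmem : r ∈ {r ∈ Ico (0 : ℝ) a | w r = 0} :=
        ⟨⟨hr.1, hra⟩, (hw r hr).2 (hrc ▸ hlev m)⟩
      refine ⟨r, hmem, ?_⟩
      have h3 := hg r hmem
      rw [hrc] at h3
      have h4 : (m : ℝ) = g r := by
        have : (m : ℝ) * Real.pi = g r * Real.pi := by linarith
        exact mul_right_cancel₀ hpi.ne' this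
      exact_mod_cast h4.symm
  rw [hcard, Set.ncard_coe_finset, Int.card_Icc]
  omega

lemma zc_cross {φ ρ w : ℝ → ℝ} {a : ℝ} (hφ : ContinuousOn φ (Icc 0 a))
    (hρ : ∀ r ∈ Icc 0 a, 0 < ρ r) (hw : ∀ r ∈ Icc 0 a, w r = ρ r * Real.cos (φ r))
    (hd : ∀ r ∈ Icc 0 a, HasDerivWithinAt w (ρ r * Real.sin (φ r)) (Icc 0 a) r) :
    ∀ s ∈ Icc 0 a, Real.cos (φ s) = 0 →
      ∀ᶠ r in 𝓝[Icc 0 a \ {s}] s, (φ r - φ s) * (r - s) < 0 := by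
  intro s hs hc
  have hws : w s = 0 := by rw [hw s hs, hc, mul_zero]
  have hsin : Real.sin (φ s) ^ 2 = 1 := by have := Real.sin_sq_add_cos_sq (φ s); rw [hc] at this; linarith
  have h1 := (hasDerivWithinAt_iff_tendsto_slope.1 (hd s hs)).mul_const (Real.sin (φ s))
  have hpos : 0 < ρ s * Real.sin (φ s) * Real.sin (φ s) := by
    have := hρ s hs
    calc 0 < ρ s := this
      _ = _ := by rw [mul_assoc, ← sq, hsin, mul_one]
  have h2 := h1.eventually (lt_mem_nhds hpos)
  have h3 : ∀ᶠ r in 𝓝[Icc 0 a \ {s}] s, |φ r - φ s| < Real.pi := by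
    have := (hφ s hs).mono_left (nhdsWithin_mono s (sdiff_subset : Icc 0 a \ {s} ⊆ Icc 0 a))
    have := this.eventually (Metric.ball_mem_nhds (φ s) Real.pi_pos)
    filter_upwards [this] with r hr
    simpa [Real.dist_eq] using hr
  filter_upwards [h2, h3, self_mem_nhdsWithin] with r h2 h3 hr
  rw [slope_def_field, hws, hw r hr.1] at h2
  have hrs : r - s ≠ 0 := sub_ne_zero.2 hr.2
  have hρr := hρ r hr.1
  have hcos : Real.cos (φ r) = - Real.sin (φ s) * Real.sin (φ r - φ s) := by
    have : φ r = φ s + (φ r - φ s) := by ring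
    conv_lhs => rw [this]
    rw [Real.cos_add, hc]; ring
  rw [hcos] at h2
  have h4 : (ρ r * (-Real.sin (φ s) * Real.sin (φ r - φ s)) - 0) / (r - s) * Real.sin (φ s)
      = - (ρ r * Real.sin (φ r - φ s) / (r - s)) := by
    field_simp
    linear_combination (-(ρ r * Real.sin (φ r - φ s))) * hsin
  rw [h4] at h2
  have h5 : ρ r * Real.sin (φ r - φ s) / (r - s) < 0 := by linarith
  rw [abs_lt] at h3
  rcases lt_or_gt_of_ne hrs with h | h
  · have h6 : 0 < ρ r * Real.sin (φ r - φ s) := by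
      by_contra hh; push Not at hh
      linarith [div_nonneg_of_nonpos hh h.le]
    have h7 : 0 < Real.sin (φ r - φ s) := pos_of_mul_pos_right h6 hρr.le
    have h8 : 0 < φ r - φ s := by
      by_contra hh; push Not at hh
      linarith [Real.sin_nonpos_of_nonpos_of_neg_pi_le hh h3.1.le]
    exact mul_neg_of_pos_of_neg h8 h
  · have h6 : ρ r * Real.sin (φ r - φ s) < 0 := by
      by_contra hh; push Not at hh
      linarith [div_nonneg hh h.le]
    have h7 : Real.sin (φ r - φ s) < 0 := by
      by_contra hh; push Not at hh
      linarith [mul_nonneg hρr.le hh]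
    have h8 : φ r - φ s < 0 := by
      by_contra hh; push Not at hh
      linarith [Real.sin_nonneg_of_nonneg_of_le_pi hh h3.2.le]
    exact mul_neg_of_neg_of_pos h8 h

/-- one-sided derivatives -/
lemma zc_deriv {w : ℝ → ℝ} {a : ℝ} (ha : 0 < a) (hw : ContDiffOn ℝ 2 w (Icc 0 a))
    (hc : Continuous (deriv w)) :
    ∀ r ∈ Icc 0 a, HasDerivWithinAt w (deriv w r) (Icc 0 a) r := by
  have hdiff : DifferentiableOn ℝ w (Ioo 0 a) :=
    (hw.differentiableOn (by norm_num)).mono Ioo_subset_Icc_self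
  intro r hr
  rcases eq_or_lt_of_le hr.1 with h | h
  · subst h
    refine (hasDerivWithinAt_Ici_of_tendsto_deriv (s := Ioo 0 a) hdiff
      ((hw.continuousOn 0 hr).mono Ioo_subset_Icc_self) (Ioo_mem_nhdsGT ha)
      (hc.continuousAt.mono_left nhdsWithin_le_nhds)).mono Icc_subset_Ici_self
  rcases eq_or_lt_of_le hr.2 with h' | h'
  · subst h'
    refine (hasDerivWithinAt_Iic_of_tendsto_deriv (s := Ioo 0 r) hdiff
      ((hw.continuousOn r hr).mono Ioo_subset_Icc_self) (Ioo_mem_nhdsLT ha)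
      (hc.continuousAt.mono_left nhdsWithin_le_nhds)).mono Icc_subset_Iic_self
  · exact ((hdiff r ⟨h, h'⟩).differentiableAt (Ioo_mem_nhds h h')).hasDerivAt.hasDerivWithinAt

lemma zc_deriv2 {w : ℝ → ℝ} {a : ℝ} (hw : ContDiffOn ℝ 2 w (Icc 0 a)) :
    ∀ r ∈ Ioo 0 a, HasDerivAt w (deriv w r) r ∧ HasDerivAt (deriv w) (deriv (deriv w) r) r := by
  intro r hr
  have hw' : ContDiffOn ℝ 2 w (Ioo 0 a) := hw.mono Ioo_subset_Icc_self
  have h1 : ContDiffOn ℝ 1 (deriv w) (Ioo 0 a) := hw'.deriv_of_isOpen isOpen_Ioo (by norm_num)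
  have hn := Ioo_mem_nhds hr.1 hr.2
  exact ⟨((hw'.differentiableOn (by norm_num)).differentiableAt hn).hasDerivAt,
    ((h1.differentiableOn (by norm_num)).differentiableAt hn).hasDerivAt⟩

/-- Gronwall -/
lemma zc_gron {w b g : ℝ → ℝ} {s a : ℝ} (hsa : s ≤ a) (hwc : Continuous w) (hdc : Continuous (deriv w))
    (h1 : ∀ r ∈ Ioo s a, HasDerivAt w (deriv w r) r)
    (h2 : ∀ r ∈ Ioo s a, HasDerivAt (deriv w) (- b r * deriv w r - g r * w r) r)
    (hb : ContinuousOn b (Icc s a)) (hg : ContinuousOn g (Icc s a))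
    (hs : w s = 0) (hs' : deriv w s = 0) : w a = 0 ∧ deriv w a = 0 := by
  obtain ⟨B, hB⟩ := isCompact_Icc.exists_bound_of_continuousOn hb
  obtain ⟨G, hG⟩ := isCompact_Icc.exists_bound_of_continuousOn hg
  set K : ℝ := 2 * B + (1 + G) with hK
  set E : ℝ → ℝ := fun r => (w r ^ 2 + deriv w r ^ 2) * Real.exp (-K * r) with hE
  have hanti : AntitoneOn E (Icc s a) := by
    have hder : ∀ r ∈ Ioo s a, HasDerivAt E
        ((2 * w r * deriv w r + 2 * deriv w r * (- b r * deriv w r - g r * w r)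
          - K * (w r ^ 2 + deriv w r ^ 2)) * Real.exp (-K * r)) r := by
      intro r hr
      have e1 := (h1 r hr).pow 2
      have e2 := (h2 r hr).pow 2
      have e3 : HasDerivAt (fun r => Real.exp (-K * r)) (Real.exp (-K * r) * (-K * 1)) r :=
        ((hasDerivAt_id r).const_mul (-K)).exp
      have := (e1.add e2).mul e3
      refine this.congr_deriv ?_
      simp only [Pi.add_apply, Pi.pow_apply]
      push_cast
      ring
    refine antitoneOn_of_deriv_nonpos (convex_Icc s a) ?_ ?_ ?_
    · exact Continuous.continuousOn (by fun_prop)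
    · rw [interior_Icc]
      exact fun r hr => (hder r hr).differentiableAt.differentiableWithinAt
    · rw [interior_Icc]
      intro r hr
      rw [(hder r hr).deriv]
      have hb' := abs_le.1 (hB r ⟨hr.1.le, hr.2.le⟩)
      have hg' := abs_le.1 (hG r ⟨hr.1.le, hr.2.le⟩)
      refine mul_nonpos_of_nonpos_of_nonneg ?_ (Real.exp_pos _).le
      have k1 : 0 ≤ (B + b r) * deriv w r ^ 2 := mul_nonneg (by linarith) (sq_nonneg _)
      have k2 : 0 ≤ (B + b r) := by linarith
      have k3 : 0 ≤ B * w r ^ 2 := mul_nonneg (by linarith) (sq_nonneg _)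
      have k4 : 0 ≤ (G + g r) * (w r + deriv w r) ^ 2 := mul_nonneg (by linarith) (sq_nonneg _)
      have k5 : 0 ≤ (G - g r) * (w r - deriv w r) ^ 2 := mul_nonneg (by linarith) (sq_nonneg _)
      have k6 : 0 ≤ (w r - deriv w r) ^ 2 := sq_nonneg _
      rw [hK]
      nlinarith
  have hEs := hanti ⟨le_rfl, hsa⟩ ⟨hsa, le_rfl⟩ hsa
  simp only [hE, hs, hs'] at hEs
  have h3 : w a ^ 2 + deriv w a ^ 2 ≤ 0 := by
    have : (w a ^ 2 + deriv w a ^ 2) * Real.exp (-K * a) ≤ 0 := by simpa using hEs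
    by_contra hh; push Not at hh
    linarith [mul_pos hh (Real.exp_pos (-K * a))]
  constructor
  · nlinarith [sq_nonneg (w a), sq_nonneg (deriv w a)]
  · nlinarith [sq_nonneg (w a), sq_nonneg (deriv w a)]

/-- energy -/
lemma zc_energy {w b : ℝ → ℝ} {a p lam : ℝ} (hp : 1 < p) (hlam : 0 < lam)
    (hwc : Continuous w) (hdc : Continuous (deriv w))
    (h1 : ∀ r ∈ Ioo 0 a, HasDerivAt w (deriv w r) r)
    (h2 : ∀ r ∈ Ioo 0 a, HasDerivAt (deriv w) (- b r * deriv w r -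
      lam * (|w r| ^ (p - 1) * w r - w r)) r)
    (hb : ∀ r ∈ Ioo 0 a, 0 ≤ b r)
    (hs : w 0 = 1) (hs' : deriv w 0 = 0) : ∀ r ∈ Icc 0 a, w r ≠ 0 := by
  set E : ℝ → ℝ := fun r => deriv w r ^ 2 / 2 + lam * (|w r| ^ (p + 1) / (p + 1) - w r ^ 2 / 2) with hE
  have hanti : AntitoneOn E (Icc 0 a) := by
    have hder : ∀ r ∈ Ioo 0 a, HasDerivAt E (- b r * deriv w r ^ 2) r := by
      intro r hr
      have e1 := ((h1 r hr).pow 2).div_const 2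
      have e2 := ((h2 r hr).pow 2).div_const 2
      have e3 := ((hasDerivAt_abs_rpow (w r) (p := p + 1) (by linarith)).comp r (h1 r hr)).div_const (p + 1)
      have := e2.add ((e3.sub e1).const_mul lam)
      refine this.congr_deriv ?_
      have : p + 1 - 2 = p - 1 := by ring
      rw [this]
      have : p + 1 ≠ 0 := by linarith
      field_simp
      push_cast
      ring
    refine antitoneOn_of_deriv_nonpos (convex_Icc 0 a) ?_ ?_ ?_
    · refine Continuous.continuousOn ?_
      have : Continuous fun r => |w r| ^ (p + 1) :=
        hwc.abs.rpow_const (fun _ => Or.inr (by linarith))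
      fun_prop
    · rw [interior_Icc]
      exact fun r hr => (hder r hr).differentiableAt.differentiableWithinAt
    · rw [interior_Icc]
      intro r hr
      rw [(hder r hr).deriv]
      nlinarith [mul_nonneg (hb r hr) (sq_nonneg (deriv w r))]
  intro r hr h0
  have hEs := hanti ⟨le_rfl, hr.1.trans hr.2⟩ hr hr.1
  simp only [hE, hs, hs', h0] at hEs
  rw [abs_zero, Real.zero_rpow (by linarith), abs_one, Real.one_rpow] at hEs
  rw [zero_div] at hEs
  have : 1 / (p + 1) < 1 / 2 := one_div_lt_one_div_of_lt (by norm_num) (by linarith)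
  nlinarith [sq_nonneg (deriv w r), mul_pos hlam (by linarith : 0 < 1 / 2 - 1 / (p + 1))]

/-- lifting -/
lemma zc_lift {z : ℝ × ℝ → ℂ} (hz : Continuous z) {a : ℝ} (ha : 0 < a)
    (hne : ∀ d > 0, ∀ r ∈ Icc 0 a, z (d, r) ≠ 0) (hz0 : ∀ d, z (d, 0) = (d : ℂ)) :
    ∃ L : ℝ × ℝ → ℂ, ContinuousOn L (Ioi 0 ×ˢ Icc 0 a) ∧
      (∀ d > 0, ∀ r ∈ Icc 0 a, Complex.exp (L (d, r)) = z (d, r)) ∧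
      (∀ d > 0, (L (d, 0)).im = 0) := by
  let H : C(unitInterval × Ioi (0 : ℝ), {z : ℂ // z ≠ 0}) :=
    ⟨fun q => ⟨z (q.2, q.1 * a), hne _ q.2.2 _
      ⟨mul_nonneg q.1.2.1 ha.le, mul_le_of_le_one_left ha.le q.1.2.2⟩⟩, by fun_prop⟩
  let f : C(Ioi (0 : ℝ), ℂ) := ⟨fun d => (Real.log d : ℂ), by
    refine Complex.continuous_ofReal.comp ?_
    exact continuous_subtype_val.log (fun d => (ne_of_gt d.2))⟩
  have H0 : ∀ d, H (0, d) = (⟨_, (f d).exp_ne_zero⟩ : {z : ℂ // z ≠ 0}) := by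
    intro d
    apply Subtype.ext
    change z (d, ((0 : unitInterval) : ℝ) * a) = Complex.exp (Real.log d : ℂ)
    rw [← Complex.ofReal_exp, Real.exp_log d.2]
    simp [hz0]
  let Lh := Complex.isCoveringMap_exp.liftHomotopy H f H0
  have hL1 := Complex.isCoveringMap_exp.liftHomotopy_lifts H f H0
  have hL2 := Complex.isCoveringMap_exp.liftHomotopy_zero H f H0
  let T : ℝ × ℝ → unitInterval × Ioi (0 : ℝ) := fun q =>
    (projIcc 0 1 zero_le_one (q.2 / a), if h : 0 < q.1 then ⟨q.1, h⟩ else ⟨1, mem_Ioi.2 one_pos⟩)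
  refine ⟨fun q => Lh (T q), ?_, ?_, ?_⟩
  · refine Lh.continuous.comp_continuousOn ?_
    refine ContinuousOn.prodMk ?_ ?_
    · exact (continuous_projIcc.comp (continuous_snd.div_const a)).continuousOn
    · rw [continuousOn_iff_continuous_domRestrict]
      refine Continuous.congr (f := fun q => (⟨q.1.1, q.2.1⟩ : Ioi (0 : ℝ))) (by fun_prop) ?_
      rintro ⟨q, hq⟩
      have hq1 : 0 < q.1 := hq.1
      exact (dif_pos hq1).symm
  · intro d hd r hr
    have hm : r / a ∈ Icc (0 : ℝ) 1 := ⟨div_nonneg hr.1 ha.le, (div_le_one ha).2 hr.2⟩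
    have hT : T (d, r) = (⟨r / a, hm⟩, ⟨d, hd⟩) := by
      simp only [T]
      rw [projIcc_of_mem zero_le_one hm, dif_pos hd]
    have := congrArg Subtype.val (congrFun hL1 (⟨r / a, hm⟩, ⟨d, hd⟩))
    simp only [Function.comp] at this
    change Complex.exp (Lh (T (d, r))) = _
    rw [hT]
    refine this.trans ?_
    change z (d, r / a * a) = _
    rw [div_mul_cancel₀ _ ha.ne']
  · intro d hd
    have hT : T (d, 0) = (0, ⟨d, hd⟩) := by
      simp only [T]
      rw [dif_pos hd]
      congr 1
      simp [projIcc]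
    change (Lh (T (d, 0))).im = 0
    rw [hT]
    have := hL2 ⟨d, hd⟩
    change (Complex.isCoveringMap_exp.liftHomotopy H f H0 (0, ⟨d, hd⟩)).im = 0
    rw [this]
    exact Complex.ofReal_im _

lemma zc_unique {D : ℝ → ℝ} (hD : ContinuousOn D (Ioi 0)) (h1 : D 1 = 0)
    (hc : ∀ d > 0, Real.cos (D d) = 1) : ∀ d > 0, D d = 0 := by
  intro d hd
  have hpi := Real.pi_pos
  have hpc : IsPreconnected (D '' Ioi 0) := isPreconnected_Ioi.image D hD
  have hoc := hpc.ordConnected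
  have m1 : (0 : ℝ) ∈ D '' Ioi 0 := ⟨1, by simp, h1⟩
  have md : D d ∈ D '' Ioi 0 := ⟨d, hd, rfl⟩
  have hnpi : ∀ x ∈ D '' Ioi 0, Real.cos x = 1 := by rintro _ ⟨y, hy, rfl⟩; exact hc y hy
  refine (Real.cos_eq_one_iff_of_lt_of_lt ?_ ?_).1 (hc d hd)
  · by_contra h; push Not at h
    have := hnpi _ (hoc.out md m1 (⟨by linarith, by linarith⟩ : -Real.pi ∈ Icc (D d) 0))
    rw [Real.cos_neg, Real.cos_pi] at this; linarith
  · by_contra h; push Not at h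
    have := hnpi _ (hoc.out m1 md (⟨by linarith, by linarith⟩ : Real.pi ∈ Icc 0 (D d)))
    rw [Real.cos_pi] at this; linarith

end ZC

/-- Proposition 4.3: for all `d > 0`, `θ(d) < π/2` and the number of zeroes of `w_d` in
`[0,a₀)` equals `-⌊(θ(d) - π/2)/π⌋ - 1`. -/
theorem zero_count_argument_formula
    (n ℓ m₁ m₂ : ℕ) (hn : 3 ≤ n) (hℓ : 1 ≤ ℓ) (hm₁ : 1 ≤ m₁) (hm₂ : 1 ≤ m₂)
    (p lam : ℝ) (hp : p = ((n : ℝ) + 2) / ((n : ℝ) - 2))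
    (hlam : lam = (n : ℝ) * ((n : ℝ) - 2) / (4 * (ℓ : ℝ) ^ 2))
    (h : ℝ → ℝ)
    (hh : ∀ r : ℝ, h r = (((m₁ : ℝ) + (m₂ : ℝ)) / 2) * Real.cos r - ((m₂ : ℝ) - (m₁ : ℝ)) / 2)
    (a₀ : ℝ) (ha₀ : a₀ ∈ Set.Ioo (0 : ℝ) Real.pi) (ha₀z : h a₀ = 0)
    (W : ℝ → ℝ → ℝ)
    (hWC2 : ∀ d : ℝ, ContDiffOn ℝ 2 (W d) (Set.Icc 0 a₀))
    (hWode : ∀ d : ℝ, ∀ r ∈ Set.Ioc (0 : ℝ) a₀,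
      deriv (deriv (W d)) r + (h r / Real.sin r) * deriv (W d) r
        + lam * (|W d r| ^ (p - 1) * W d r - W d r) = 0)
    (hW0 : ∀ d : ℝ, W d 0 = d) (hW'0 : ∀ d : ℝ, deriv (W d) 0 = 0)
    (hWcont : Continuous fun q : ℝ × ℝ => (W q.1 q.2, deriv (W q.1) q.2))
    (huniq : ∀ d d' : ℝ, W d a₀ = W d' a₀ → deriv (W d) a₀ = deriv (W d') a₀ → d = d')
    (I : ℝ → ℝ × ℝ) (hI : ∀ d : ℝ, I d = (W d a₀, deriv (W d) a₀))
    (hInz : ∀ d : ℝ, d ≠ 0 → I d ≠ (0, 0))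
    (θ : ℝ → ℝ) (hθc : ContinuousOn θ (Set.Ioi 0)) (hθ1 : θ 1 = 0)
    (hθ : ∀ d : ℝ, 0 < d →
      I d = (Real.sqrt ((I d).1 ^ 2 + (I d).2 ^ 2) * Real.cos (θ d),
             Real.sqrt ((I d).1 ^ 2 + (I d).2 ^ 2) * Real.sin (θ d)))
    (hfin : ∀ d : ℝ, d ≠ 0 → {r ∈ Set.Ico (0 : ℝ) a₀ | W d r = 0}.Finite) :
    ∀ d : ℝ, 0 < d → θ d < Real.pi / 2 ∧
      ({r ∈ Set.Ico (0 : ℝ) a₀ | W d r = 0}.ncard : ℤ)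
        = -⌊(θ d - Real.pi / 2) / Real.pi⌋ - 1 := by
  have ha := ha₀.1
  have hn' : (3 : ℝ) ≤ n := by exact_mod_cast hn
  have hℓ' : (1 : ℝ) ≤ ℓ := by exact_mod_cast hℓ
  have hp1 : 1 < p := by
    rw [hp, lt_div_iff₀ (by linarith)]; linarith
  have hl0 : 0 < lam := by
    rw [hlam]
    exact div_pos (mul_pos (by linarith) (by linarith)) (by positivity)
  have hsin : ∀ r ∈ Set.Ioc (0 : ℝ) a₀, 0 < Real.sin r := fun r hr =>
    Real.sin_pos_of_pos_of_lt_pi hr.1 (hr.2.trans_lt ha₀.2)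
  have hhc : Continuous h := by
    have : h = fun r => (((m₁ : ℝ) + (m₂ : ℝ)) / 2) * Real.cos r - ((m₂ : ℝ) - (m₁ : ℝ)) / 2 :=
      funext hh
    rw [this]; fun_prop
  have hh0 : ∀ r ∈ Set.Ioo (0 : ℝ) a₀, 0 ≤ h r := by
    intro r hr
    have h1 : Real.cos a₀ ≤ Real.cos r :=
      Real.cos_le_cos_of_nonneg_of_le_pi hr.1.le ha₀.2.le hr.2.le
    have h2 : h a₀ ≤ h r := by
      rw [hh, hh]
      have : (((m₁ : ℝ) + (m₂ : ℝ)) / 2) * Real.cos a₀ ≤ (((m₁ : ℝ) + (m₂ : ℝ)) / 2) * Real.cos r :=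
        mul_le_mul_of_nonneg_left h1 (by positivity)
      linarith
    linarith
  have hWc : Continuous fun q : ℝ × ℝ => W q.1 q.2 := continuous_fst.comp hWcont
  have hDc : Continuous fun q : ℝ × ℝ => deriv (W q.1) q.2 := continuous_snd.comp hWcont
  have hwc : ∀ d, Continuous (W d) := fun d => hWc.comp (Continuous.prodMk_right d)
  have hdc : ∀ d, Continuous (deriv (W d)) := fun d => hDc.comp (Continuous.prodMk_right d)
  have hd2 := fun d => zc_deriv2 (hWC2 d)
  have hode : ∀ d, ∀ r ∈ Set.Ioo (0 : ℝ) a₀, HasDerivAt (deriv (W d))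
      (- (h r / Real.sin r) * deriv (W d) r - lam * (|W d r| ^ (p - 1) * W d r - W d r)) r := by
    intro d r hr
    refine (hd2 d r hr).2.congr_deriv ?_
    have := hWode d r ⟨hr.1, hr.2.le⟩
    linarith
  have hnz : ∀ d > 0, ∀ r ∈ Set.Icc (0 : ℝ) a₀, ¬ (W d r = 0 ∧ deriv (W d) r = 0) := by
    rintro d hd r hr ⟨hr0, hr1⟩
    have hrp : 0 < r := by
      refine lt_of_le_of_ne hr.1 ?_
      rintro rfl
      rw [hW0] at hr0; linarith
    have hsub : ∀ x ∈ Set.Ioo r a₀, x ∈ Set.Ioo (0 : ℝ) a₀ := fun x hx => ⟨hrp.trans hx.1, hx.2⟩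
    have := zc_gron (w := W d) (b := fun r => h r / Real.sin r)
      (g := fun r => lam * (|W d r| ^ (p - 1) - 1)) hr.2 (hwc d) (hdc d)
      (fun x hx => (hd2 d x (hsub x hx)).1)
      (fun x hx => (hode d x (hsub x hx)).congr_deriv (by ring))
      (hhc.continuousOn.div Real.continuous_sin.continuousOn
        (fun x hx => (hsin x ⟨hrp.trans_le hx.1, hx.2⟩).ne'))
      (Continuous.continuousOn (continuous_const.mul
        (((hwc d).abs.rpow_const (fun _ => Or.inr (by linarith))).sub continuous_const)))
      hr0 hr1
    exact hInz d hd.ne' (by rw [hI, this.1, this.2])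
  obtain ⟨L, hLc, hLe, hL0⟩ := zc_lift
    (z := fun q => ((W q.1 q.2 : ℝ) : ℂ) + ((deriv (W q.1) q.2 : ℝ) : ℂ) * Complex.I)
    ((Complex.continuous_ofReal.comp hWc).add
      ((Complex.continuous_ofReal.comp hDc).mul continuous_const)) ha
    (by
      intro d hd r hr hz
      refine hnz d hd r hr ⟨?_, ?_⟩
      · simpa using congrArg Complex.re hz
      · simpa using congrArg Complex.im hz)
    (by intro d; simp [hW0, hW'0])
  have hw1 : ∀ d > 0, ∀ r ∈ Set.Icc (0 : ℝ) a₀,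
      W d r = Real.exp (L (d, r)).re * Real.cos (L (d, r)).im := by
    intro d hd r hr
    have := congrArg Complex.re (hLe d hd r hr)
    rw [Complex.exp_re] at this
    simpa using this.symm
  have hw2 : ∀ d > 0, ∀ r ∈ Set.Icc (0 : ℝ) a₀,
      deriv (W d) r = Real.exp (L (d, r)).re * Real.sin (L (d, r)).im := by
    intro d hd r hr
    have := congrArg Complex.im (hLe d hd r hr)
    rw [Complex.exp_im] at this
    simpa using this.symm
  have key : ∀ d > 0, (L (d, a₀)).im < Real.pi / 2 ∧
      ({r ∈ Set.Ico (0 : ℝ) a₀ | W d r = 0}.ncard : ℤ)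
        = -⌊((L (d, a₀)).im - Real.pi / 2) / Real.pi⌋ - 1 := by
    intro d hd
    have hφ : ContinuousOn (fun r => (L (d, r)).im) (Set.Icc 0 a₀) :=
      Complex.continuous_im.comp_continuousOn
        (hLc.comp (Continuous.prodMk_right d).continuousOn (fun r hr => ⟨hd, hr⟩))
    refine zc_count (φ := fun r => (L (d, r)).im) ha hφ (hL0 d hd) ?_ ?_
    · intro r hr
      rw [hw1 d hd r hr]
      simp [Real.exp_ne_zero]
    · refine zc_cross (ρ := fun r => Real.exp (L (d, r)).re) (w := W d) hφ
        (fun r _ => Real.exp_pos _) (hw1 d hd) ?_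
      intro r hr
      exact (zc_deriv ha (hWC2 d) (hdc d) r hr).congr_deriv (hw2 d hd r hr)
  have haI : a₀ ∈ Set.Icc (0 : ℝ) a₀ := ⟨ha.le, le_rfl⟩
  have hDcos : ∀ d > 0, Real.cos ((L (d, a₀)).im - θ d) = 1 := by
    intro d hd
    have e1 := hw1 d hd a₀ haI
    have e2 := hw2 d hd a₀ haI
    have e3 := hθ d hd
    rw [hI] at e3
    simp only [Prod.mk.injEq] at e3
    have hρ := Real.exp_pos (L (d, a₀)).re
    have hsq : Real.sqrt (W d a₀ ^ 2 + deriv (W d) a₀ ^ 2) = Real.exp (L (d, a₀)).re := by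
      rw [e1, e2, mul_pow, mul_pow, ← mul_add, Real.cos_sq_add_sin_sq, mul_one,
        Real.sqrt_sq hρ.le]
    rw [hsq] at e3
    have f1 : Real.cos (θ d) = Real.cos (L (d, a₀)).im :=
      mul_left_cancel₀ hρ.ne' (e3.1.symm.trans e1)
    have f2 : Real.sin (θ d) = Real.sin (L (d, a₀)).im :=
      mul_left_cancel₀ hρ.ne' (e3.2.symm.trans e2)
    rw [Real.cos_sub, f1, f2, ← sq, ← sq, Real.cos_sq_add_sin_sq]
  have hpi := Real.pi_pos
  have hD1 : (L (1, a₀)).im - θ 1 = 0 := by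
    have hne := zc_energy (w := W 1) (b := fun r => h r / Real.sin r) (a := a₀) hp1 hl0
      (hwc 1) (hdc 1) (fun r hr => (hd2 1 r hr).1) (hode 1)
      (fun r hr => div_nonneg (hh0 r hr) (hsin r ⟨hr.1, hr.2.le⟩).le) (hW0 1) (hW'0 1)
    have hemp : {r ∈ Set.Ico (0 : ℝ) a₀ | W 1 r = 0} = ∅ := by
      ext r
      simp only [Set.mem_setOf_eq, Set.mem_empty_iff_false, iff_false, not_and]
      exact fun hr => hne r ⟨hr.1, hr.2.le⟩
    obtain ⟨k1, k2⟩ := key 1 one_pos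
    rw [hemp, Set.ncard_empty] at k2
    have k3 : ⌊((L (1, a₀)).im - Real.pi / 2) / Real.pi⌋ = -1 := by push_cast at k2; omega
    have k4 := (Int.floor_eq_iff.1 k3).1
    rw [le_div_iff₀ hpi] at k4
    push_cast at k4
    refine (Real.cos_eq_one_iff_of_lt_of_lt ?_ ?_).1 (hDcos 1 one_pos) <;> rw [hθ1] <;> linarith
  have hDall := zc_unique (D := fun d => (L (d, a₀)).im - θ d)
    ((Complex.continuous_im.comp_continuousOn
        (hLc.comp (Continuous.prodMk_left a₀).continuousOn (fun d hd => ⟨hd, haI⟩))).sub hθc)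
    hD1 hDcos
  intro d hd
  have hk := key d hd
  have he : (L (d, a₀)).im = θ d := sub_eq_zero.1 (hDall d hd)
  rw [he] at hk
  exact hk
end

section
/- Assume the forward family (w_d) with I, θ and the backward family (w̃_c) with J, ϑ as in the context, and assume m₁ < n − 1 and m₂ < n − 1. Define R : [1,∞) → ℝ × (0,∞) by R(d) = (θ(d), |I(d)|) and S : [1,∞) → ℝ × (0,∞) by S(c) = (ϑ(c), |J(c)|). Then R and S are injective, and their images intersect only at the point (0,1); that is, R([1,∞)) ∩ S([1,∞)) = {(0,1)}. -/
theorem aux_lift (x y : ℝ × ℝ → ℝ) (hx : Continuous x) (hy : Continuous y)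
    (hnz : ∀ z, x z ≠ 0 ∨ y z ≠ 0) (hx0 : 0 < x 0) (hy0 : y 0 = 0) :
    ∃ Θ ρ : ℝ × ℝ → ℝ, Continuous Θ ∧ Θ 0 = 0 ∧
      ∀ z, 0 < ρ z ∧ x z = ρ z * Real.cos (Θ z) ∧ y z = ρ z * Real.sin (Θ z) := by
  let F : C(ℝ × ℝ, ℂ) := ⟨fun z => (x z : ℂ) + (y z : ℂ) * Complex.I, by fun_prop⟩
  obtain ⟨L, ⟨hL0, hL⟩, -⟩ := Complex.isCoveringMapOn_exp.existsUnique_continuousMap_lifts F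
    (a₀ := (0 : ℝ × ℝ)) (e₀ := ((Real.log (x 0) : ℝ) : ℂ))
    (by simp only [F, ContinuousMap.coe_mk]
        rw [← Complex.ofReal_exp, Real.exp_log hx0, hy0]; simp)
    (by
      intro z hz
      simp only [F, ContinuousMap.coe_mk, Set.mem_singleton_iff] at hz
      have h1 := congrArg Complex.re hz
      have h2 := congrArg Complex.im hz
      simp at h1 h2
      rcases hnz z with h | h
      · exact h h1
      · exact h h2)
  refine ⟨fun z => (L z).im, fun z => Real.exp (L z).re, by fun_prop, ?_, ?_⟩
  · simp [hL0]
  · intro z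
    have h := congrFun hL z
    simp only [F, ContinuousMap.coe_mk, Function.comp_apply] at h
    have h1 := congrArg Complex.re h
    have h2 := congrArg Complex.im h
    simp [Complex.exp_re, Complex.exp_im] at h1 h2
    exact ⟨Real.exp_pos _, h1.symm, h2.symm⟩

theorem aux_unique (f g : ℝ → ℝ) (hf : Continuous f) (hg : Continuous g)
    (hc : ∀ s, Real.cos (f s) = Real.cos (g s)) (hs : ∀ s, Real.sin (f s) = Real.sin (g s))
    (h0 : f 0 = g 0) : f = g := by
  refine Circle.isCoveringMap_exp.eq_of_comp_eq hf hg ?_ 0 h0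
  funext s
  apply Circle.ext
  simp only [Function.comp_apply, Circle.coe_exp]
  apply Complex.ext
  · simp [Complex.exp_re, hc]
  · simp [Complex.exp_im, hs]

theorem aux_polar (x y ρ φ : ℝ) (hρ : 0 < ρ) (hx : x = ρ * Real.cos φ) (hy : y = ρ * Real.sin φ) :
    Real.sqrt (x ^ 2 + y ^ 2) = ρ := by
  rw [Real.sqrt_eq_iff_mul_self_eq_of_pos hρ, hx, hy]
  have := Real.sin_sq_add_cos_sq φ
  linear_combination (-ρ ^ 2) * this

theorem aux_cross (a : ℝ) (v u φ ρ : ℝ → ℝ) (hv : Continuous v) (hu : Continuous u)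
    (hφ : Continuous φ) (hd : ∀ t ∈ Set.Ioo 0 a, HasDerivAt v (u t) t)
    (hpol : ∀ t ∈ Set.Icc 0 a, 0 < ρ t ∧ v t = ρ t * Real.cos (φ t) ∧ u t = ρ t * Real.sin (φ t))
    (h0 : φ 0 < Real.pi / 2) : ∀ t ∈ Set.Icc 0 a, φ t < Real.pi / 2 := by
  intro t₁ ht₁
  by_contra hcon
  push Not at hcon
  have hpi := Real.pi_pos
  have hcomp : IsCompact (Set.Icc 0 t₁ ∩ {t | Real.pi / 2 ≤ φ t}) :=
    isCompact_Icc.inter_right (isClosed_le continuous_const hφ)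
  obtain ⟨t₀, ⟨ht₀, hle⟩, hleast⟩ := hcomp.exists_isLeast ⟨t₁, ⟨ht₁.1, le_rfl⟩, hcon⟩
  simp only [Set.mem_ofPred_eq] at hle
  have hpos : 0 < t₀ := by
    rcases ht₀.1.eq_or_lt with h | h
    · rw [← h] at hle; linarith
    · exact h
  have hbef : ∀ t, 0 ≤ t → t < t₀ → φ t < Real.pi / 2 := by
    intro t h1 h2
    by_contra h3
    push Not at h3
    have := hleast ⟨⟨h1, by linarith [ht₀.2]⟩, h3⟩
    linarith
  have heq : φ t₀ = Real.pi / 2 := by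
    refine le_antisymm ?_ hle
    have h1 : Filter.Tendsto φ (nhdsWithin t₀ (Set.Iio t₀)) (nhds (φ t₀)) :=
      hφ.continuousAt.tendsto.mono_left nhdsWithin_le_nhds
    refine le_of_tendsto h1 ?_
    filter_upwards [Ioo_mem_nhdsLT hpos] with t ht
    exact (hbef t ht.1.le ht.2).le
  have hp0 := hpol t₀ ⟨ht₀.1, ht₀.2.trans ht₁.2⟩
  have hv0 : v t₀ = 0 := by rw [hp0.2.1, heq]; simp
  have hu0 : 0 < u t₀ := by rw [hp0.2.2, heq]; simpa using hp0.1
  have e1 : ∀ᶠ t in nhds t₀, 0 < u t := hu.continuousAt.eventually_const_lt hu0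
  have e2 : ∀ᶠ t in nhds t₀, -(Real.pi / 2) < φ t :=
    hφ.continuousAt.eventually_const_lt (by rw [heq]; linarith)
  obtain ⟨ε, hε, hball⟩ := Metric.eventually_nhds_iff.1 (e1.and e2)
  set s := max (t₀ - ε / 2) (t₀ / 2) with hs
  have hs1 : s < t₀ := max_lt (by linarith) (by linarith)
  have hs2 : t₀ - ε / 2 ≤ s := le_max_left _ _
  have hs3 : t₀ / 2 ≤ s := le_max_right _ _
  have hb : ∀ t ∈ Set.Icc s t₀, 0 < u t ∧ -(Real.pi / 2) < φ t := by
    intro t ht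
    apply hball
    rw [Real.dist_eq, abs_lt]
    constructor <;> linarith [ht.1, ht.2]
  have hmono : StrictMonoOn v (Set.Icc s t₀) := by
    apply strictMonoOn_of_deriv_pos (convex_Icc _ _) hv.continuousOn
    intro t ht
    rw [interior_Icc] at ht
    rw [(hd t ⟨by linarith [ht.1], by linarith [ht.2, ht₀.2, ht₁.2]⟩).deriv]
    exact (hb t ⟨ht.1.le, ht.2.le⟩).1
  have hlt := hmono ⟨le_rfl, hs1.le⟩ ⟨hs1.le, le_rfl⟩ hs1
  have hps := hpol s ⟨by linarith, by linarith [ht₀.2, ht₁.2]⟩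
  have hcos : 0 < Real.cos (φ s) :=
    Real.cos_pos_of_mem_Ioo ⟨(hb s ⟨le_rfl, hs1.le⟩).2, hbef s (by linarith) hs1⟩
  have := mul_pos hps.1 hcos
  rw [hv0, hps.2.1] at hlt
  linarith

theorem aux_cross' (a : ℝ) (v u φ ρ : ℝ → ℝ) (hv : Continuous v) (hu : Continuous u)
    (hφ : Continuous φ) (hd : ∀ t ∈ Set.Ioo 0 a, HasDerivAt v (u t) t)
    (hpol : ∀ t ∈ Set.Icc 0 a, 0 < ρ t ∧ v t = ρ t * Real.cos (φ t) ∧ u t = ρ t * Real.sin (φ t))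
    (h0 : -(Real.pi / 2) < φ a) : ∀ t ∈ Set.Icc 0 a, -(Real.pi / 2) < φ t := by
  intro t ht
  have := aux_cross a (fun t => v (a - t)) (fun t => -u (a - t)) (fun t => -φ (a - t))
    (fun t => ρ (a - t)) (by fun_prop) (by fun_prop) (by fun_prop)
    (by
      intro t ht
      have h1 := hd (a - t) ⟨by linarith [ht.2], by linarith [ht.1]⟩
      have h2 : HasDerivAt (fun t : ℝ => a - t) (-1) t := by
        simpa using (hasDerivAt_id t).const_sub a
      have h3 := h1.comp t h2
      exact h3.congr_deriv (by ring))
    (by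
      intro t ht
      have h1 := hpol (a - t) ⟨by linarith [ht.2], by linarith [ht.1]⟩
      refine ⟨h1.1, by simpa using h1.2.1, by simpa using h1.2.2⟩)
    (by simp only [sub_zero]; linarith) (a - t) ⟨by linarith [ht.2], by linarith [ht.1]⟩
  simp only [sub_sub_cancel] at this
  linarith

theorem aux_nonvanish (a lam q : ℝ) (hlam : 0 < lam) (hq : 0 < q) (k v u : ℝ → ℝ)
    (hk : ∀ t ∈ Set.Ioo 0 a, 0 ≤ k t)
    (hv : Continuous v) (hu : Continuous u)
    (hd : ∀ t ∈ Set.Ioo 0 a, HasDerivAt v (u t) t)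
    (hd2 : ∀ t ∈ Set.Ioo 0 a,
      HasDerivAt u (-(k t) * u t - lam * (|v t| ^ q * v t - v t)) t)
    (hnz : v a ≠ 0 ∨ u a ≠ 0) (r : ℝ) (hr : r ∈ Set.Icc 0 a) : v r ≠ 0 ∨ u r ≠ 0 := by
  by_contra hcon
  push Not at hcon
  obtain ⟨M, hM⟩ := isCompact_Icc.exists_bound_of_continuousOn (s := Set.Icc 0 a) hv.continuousOn
  have hM0 : 0 ≤ M := (norm_nonneg _).trans (hM r hr)
  set C := 1 + lam * (M ^ q + 1) with hC
  have hanti : AntitoneOn (fun t => (v t ^ 2 + u t ^ 2) * Real.exp (-C * t)) (Set.Icc r a) := by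
    have hder : ∀ t ∈ Set.Ioo r a, HasDerivAt (fun t => (v t ^ 2 + u t ^ 2) * Real.exp (-C * t))
        ((2 * v t * u t + 2 * u t * (-(k t) * u t - lam * (|v t| ^ q * v t - v t)))
          * Real.exp (-C * t) + (v t ^ 2 + u t ^ 2) * (Real.exp (-C * t) * (-C))) t := by
      intro t ht
      have ht' : t ∈ Set.Ioo 0 a := ⟨lt_of_le_of_lt hr.1 ht.1, ht.2⟩
      have h1 := ((hd t ht').pow 2).add ((hd2 t ht').pow 2)
      have h2 : HasDerivAt (fun t : ℝ => Real.exp (-C * t)) (Real.exp (-C * t) * (-C)) t := by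
        have h3 : HasDerivAt (fun t : ℝ => -C * t) (-C) t := by
          simpa using (hasDerivAt_id t).const_mul (-C)
        exact h3.exp
      refine (h1.mul h2).congr_deriv ?_
      simp
    apply antitoneOn_of_deriv_nonpos (convex_Icc _ _)
    · fun_prop
    · rw [interior_Icc]
      exact fun t ht => (hder t ht).differentiableAt.differentiableWithinAt
    · rw [interior_Icc]
      intro t ht
      rw [(hder t ht).deriv]
      have ht' : t ∈ Set.Ioo 0 a := ⟨lt_of_le_of_lt hr.1 ht.1, ht.2⟩
      have hvM : |v t| ^ q ≤ M ^ q :=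
        Real.rpow_le_rpow (abs_nonneg _) (hM t ⟨ht'.1.le, ht'.2.le⟩) hq.le
      have hP : 0 ≤ |v t| ^ q := Real.rpow_nonneg (abs_nonneg _) _
      have hku : 0 ≤ k t * u t ^ 2 := mul_nonneg (hk t ht') (sq_nonneg _)
      have hE := Real.exp_pos (-C * t)
      generalize |v t| ^ q = P at *
      generalize M ^ q = Q at *
      have key : 2 * v t * u t + 2 * u t * (-(k t) * u t - lam * (P * v t - v t))
          - C * (v t ^ 2 + u t ^ 2) ≤ 0 := by
        have h1 : 0 ≤ (v t - u t) ^ 2 := sq_nonneg _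
        have h2 : 0 ≤ lam * P * (v t + u t) ^ 2 := by positivity
        have h3 : 0 ≤ lam * (v t - u t) ^ 2 := by positivity
        have h4 : 0 ≤ lam * (Q - P) * (v t ^ 2 + u t ^ 2) := by
          have : 0 ≤ Q - P := by linarith
          positivity
        rw [hC]
        nlinarith
      nlinarith [mul_nonneg hE.le (neg_nonneg.2 key)]
  have h1 := hanti ⟨le_rfl, hr.2⟩ ⟨hr.2, le_rfl⟩ hr.2
  simp only [hcon.1, hcon.2] at h1
  have hE := Real.exp_pos (-C * a)
  have h2 : (v a ^ 2 + u a ^ 2) * Real.exp (-C * a) ≤ 0 := by simpa using h1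
  have h3 : v a ^ 2 + u a ^ 2 ≤ 0 := by
    by_contra h; push Not at h
    have := mul_pos h hE
    linarith
  rcases hnz with h | h
  · have := sq_nonneg (u a); have : 0 < v a ^ 2 := by positivity
    linarith
  · have := sq_nonneg (v a); have : 0 < u a ^ 2 := by positivity
    linarith

theorem aux_const (a lam q : ℝ) (ha : 0 < a) (hlam : 0 < lam) (hq : 0 < q) (k v u : ℝ → ℝ)
    (hk : ∀ t ∈ Set.Ioo 0 a, 0 ≤ k t)
    (hv : Continuous v) (hu : Continuous u)
    (hd : ∀ t ∈ Set.Ioo 0 a, HasDerivAt v (u t) t)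
    (hd2 : ∀ t ∈ Set.Ioo 0 a,
      HasDerivAt u (-(k t) * u t - lam * (|v t| ^ q * v t - v t)) t)
    (hv0 : v 0 = 1) (hu0 : u 0 = 0) : ∀ t ∈ Set.Icc 0 a, v t = 1 ∧ u t = 0 := by
  set s := (q + 2) / 2 with hs
  have hs1 : 1 < s := by rw [hs]; linarith
  set E : ℝ → ℝ := fun t => u t ^ 2 / 2 + lam * ((v t ^ 2) ^ s / (2 * s) - v t ^ 2 / 2) with hE
  have hder : ∀ t ∈ Set.Ioo 0 a, HasDerivAt E (-(k t) * u t ^ 2) t := by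
    intro t ht
    have h1 := ((hd2 t ht).pow 2).div_const 2
    have h2 := (hd t ht).pow 2
    have h3 := h2.rpow_const (p := s) (Or.inr hs1.le)
    have h4 := h1.add (((h3.div_const (2 * s)).sub (h2.div_const 2)).const_mul lam)
    refine h4.congr_deriv ?_
    have h5 : (v t ^ 2) ^ (s - 1) = |v t| ^ q := by
      rw [← sq_abs, ← Real.rpow_natCast, ← Real.rpow_mul (abs_nonneg _)]
      congr 1
      rw [hs]; push_cast; ring
    simp only [Pi.pow_apply, h5]
    have : s ≠ 0 := by linarith
    field_simp
    push_cast
    ring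
  have hEc : Continuous E := by
    have : Continuous fun t => (v t ^ 2) ^ s :=
      (hv.pow 2).rpow_const (fun _ => Or.inr (by linarith))
    fun_prop
  have hanti : AntitoneOn E (Set.Icc 0 a) := by
    apply antitoneOn_of_deriv_nonpos (convex_Icc _ _) hEc.continuousOn
    · rw [interior_Icc]
      exact fun t ht => (hder t ht).differentiableAt.differentiableWithinAt
    · rw [interior_Icc]
      intro t ht
      rw [(hder t ht).deriv]
      have := mul_nonneg (hk t ht) (sq_nonneg (u t))
      linarith
  have hu' : ∀ t ∈ Set.Icc 0 a, u t = 0 := by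
    intro t ht
    have h1 := hanti ⟨le_rfl, ha.le⟩ ht ht.1
    simp only [hE, hv0, hu0] at h1
    have h2 := one_add_mul_self_le_rpow_one_add (s := v t ^ 2 - 1) (by nlinarith [sq_nonneg (v t)])
      hs1.le
    rw [show 1 + (v t ^ 2 - 1) = v t ^ 2 by ring] at h2
    have h3 : (1 + s * (v t ^ 2 - 1)) / (2 * s) ≤ (v t ^ 2) ^ s / (2 * s) := by gcongr
    have h4 : (1 + s * (v t ^ 2 - 1)) / (2 * s) = 1 / (2 * s) + v t ^ 2 / 2 - 1 / 2 := by
      have : s ≠ 0 := by linarith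
      field_simp
      ring
    rw [h4] at h3
    simp only [one_pow, Real.one_rpow] at h1
    have h5 : lam * (1 / (2 * s) - 1 / 2) ≤ lam * ((v t ^ 2) ^ s / (2 * s) - v t ^ 2 / 2) := by
      apply mul_le_mul_of_nonneg_left _ hlam.le
      linarith
    have h6 : u t ^ 2 ≤ 0 := by linarith
    exact pow_eq_zero_iff (two_ne_zero) |>.1 (le_antisymm h6 (sq_nonneg _))
  intro t ht
  refine ⟨?_, hu' t ht⟩
  have hdv : ∀ t ∈ interior (Set.Icc 0 a), HasDerivAt v 0 t := by
    rw [interior_Icc]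
    intro t ht
    have := hd t ht
    rwa [hu' t ⟨ht.1.le, ht.2.le⟩] at this
  have hdiff : DifferentiableOn ℝ v (interior (Set.Icc 0 a)) :=
    fun t ht => (hdv t ht).differentiableAt.differentiableWithinAt
  have m1 := antitoneOn_of_deriv_nonpos (convex_Icc 0 a) hv.continuousOn hdiff
    (fun t ht => (hdv t ht).deriv.le)
  have m2 := monotoneOn_of_deriv_nonneg (convex_Icc 0 a) hv.continuousOn hdiff
    (fun t ht => (hdv t ht).deriv.ge)
  have z : (0 : ℝ) ∈ Set.Icc 0 a := ⟨le_rfl, ha.le⟩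
  rw [← hv0]
  exact le_antisymm (m1 z ht ht.1) (m2 z ht ht.1)

theorem aux_zero (f : ℝ → ℝ) (hf : Continuous f) (h0 : f 0 = 0)
    (h : ∀ s, ∃ ρ : ℝ, 0 < ρ ∧ 0 < ρ * Real.cos (f s) ∧ ρ * Real.sin (f s) = 0) : f = 0 := by
  have key : ∀ s, Real.cos (f s) = 1 ∧ Real.sin (f s) = 0 := by
    intro s
    obtain ⟨ρ, hρ, h1, h2⟩ := h s
    have h3 : Real.sin (f s) = 0 := by
      rcases mul_eq_zero.1 h2 with h | h
      · exact absurd h hρ.ne'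
      · exact h
    have h4 : 0 < Real.cos (f s) := pos_of_mul_pos_right h1 hρ.le
    have h5 := Real.sin_sq_add_cos_sq (f s)
    rw [h3] at h5
    exact ⟨by nlinarith, h3⟩
  apply aux_unique f 0 hf continuous_const
  · intro s; simpa using (key s).1
  · intro s; simpa using (key s).2
  · simpa using h0

theorem aux_core (a lam q : ℝ) (ha : 0 < a) (hlam : 0 < lam) (hq : 0 < q) (k : ℝ → ℝ)
    (V U : ℝ → ℝ → ℝ)
    (hk : ∀ t ∈ Set.Ioo 0 a, 0 ≤ k t)
    (hV : Continuous fun z : ℝ × ℝ => V z.1 z.2) (hU : Continuous fun z : ℝ × ℝ => U z.1 z.2)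
    (hd : ∀ d, ∀ t ∈ Set.Ioo 0 a, HasDerivAt (V d) (U d t) t)
    (hd2 : ∀ d, ∀ t ∈ Set.Ioo 0 a,
      HasDerivAt (U d) (-(k t) * U d t - lam * (|V d t| ^ q * V d t - V d t)) t)
    (hV0 : ∀ d, V d 0 = d) (hU0 : ∀ d, U d 0 = 0)
    (hnz : ∀ d, 0 < d → V d a ≠ 0 ∨ U d a ≠ 0)
    (θ : ℝ → ℝ) (hθc : ContinuousOn θ (Set.Ioi 0)) (hθ1 : θ 1 = 0)
    (hθ : ∀ d, 0 < d → V d a = Real.sqrt (V d a ^ 2 + U d a ^ 2) * Real.cos (θ d) ∧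
      U d a = Real.sqrt (V d a ^ 2 + U d a ^ 2) * Real.sin (θ d)) :
    (V 1 a = 1 ∧ U 1 a = 0) ∧ ∀ d, 0 < d → θ d < Real.pi / 2 ∧
      (-(Real.pi / 2) < θ d → ∀ t ∈ Set.Icc 0 a, 0 < V d t) := by
  have hVd : ∀ d, Continuous (V d) := fun d => hV.comp (Continuous.prodMk_right d)
  have hUd : ∀ d, Continuous (U d) := fun d => hU.comp (Continuous.prodMk_right d)
  have hone := aux_const a lam q ha hlam hq k (V 1) (U 1) hk (hVd 1) (hUd 1) (hd 1) (hd2 1)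
    (hV0 1) (hU0 1)
  refine ⟨hone a ⟨ha.le, le_rfl⟩, ?_⟩
  let pr : ℝ → ℝ := fun t => max 0 (min a t)
  have hprc : Continuous pr := by fun_prop
  have hprm : ∀ t, pr t ∈ Set.Icc 0 a := fun t => ⟨le_max_left _ _, max_le ha.le (min_le_left _ _)⟩
  have hpre : ∀ t ∈ Set.Icc 0 a, pr t = t := by
    intro t ht
    simp only [pr]
    rw [min_eq_right ht.2, max_eq_right ht.1]
  have hpr0 : pr 0 = 0 := hpre 0 ⟨le_rfl, ha.le⟩
  have hpra : pr a = a := hpre a ⟨ha.le, le_rfl⟩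
  obtain ⟨Θ, ρ, hΘc, hΘ0, hΘ⟩ := aux_lift (fun z => V (Real.exp z.1) (pr z.2))
    (fun z => U (Real.exp z.1) (pr z.2))
    (hV.comp (g := fun z : ℝ × ℝ => V z.1 z.2) (f := fun z : ℝ × ℝ => (Real.exp z.1, pr z.2))
      (by fun_prop))
    (hU.comp (g := fun z : ℝ × ℝ => U z.1 z.2) (f := fun z : ℝ × ℝ => (Real.exp z.1, pr z.2))
      (by fun_prop))
    (fun z => aux_nonvanish a lam q hlam hq k _ _ hk (hVd _) (hUd _) (hd _) (hd2 _)
      (hnz _ (Real.exp_pos _)) _ (hprm _))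
    (by simp [hpr0, hV0]) (by simp [hpr0, hU0])
  have z1 := aux_zero (fun s => Θ (s, 0)) (by fun_prop) hΘ0 (by
    intro s
    obtain ⟨h1, h2, h3⟩ := hΘ (s, 0)
    refine ⟨_, h1, ?_, ?_⟩
    · rw [← h2]; simp only [hpr0, hV0]; exact Real.exp_pos _
    · rw [← h3]; simp only [hpr0, hU0])
  have z2 := aux_zero (fun t => Θ (0, t)) (by fun_prop) hΘ0 (by
    intro t
    obtain ⟨h1, h2, h3⟩ := hΘ (0, t)
    have := hone (pr t) (hprm t)
    refine ⟨_, h1, ?_, ?_⟩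
    · rw [← h2]; simp [this.1]
    · rw [← h3]; simp [this.2])
  have hθe : Continuous fun s => θ (Real.exp s) :=
    hθc.comp_continuous Real.continuous_exp (fun s => Real.exp_pos s)
  have heq : (fun s => Θ (s, a)) = fun s => θ (Real.exp s) := by
    have key : ∀ s, Real.cos (Θ (s, a)) = Real.cos (θ (Real.exp s)) ∧
        Real.sin (Θ (s, a)) = Real.sin (θ (Real.exp s)) := by
      intro s
      obtain ⟨h1, h2, h3⟩ := hΘ (s, a)
      simp only [hpra] at h2 h3
      obtain ⟨h4, h5⟩ := hθ _ (Real.exp_pos s)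
      rw [aux_polar _ _ _ _ h1 h2 h3] at h4 h5
      exact ⟨mul_left_cancel₀ h1.ne' (h2.symm.trans h4), mul_left_cancel₀ h1.ne' (h3.symm.trans h5)⟩
    refine aux_unique _ _ (by fun_prop) hθe (fun s => (key s).1) (fun s => (key s).2) ?_
    simp only [Real.exp_zero, hθ1]
    exact congrFun z2 a
  intro d hdpos
  have hel : Real.exp (Real.log d) = d := Real.exp_log hdpos
  have hda : Θ (Real.log d, a) = θ d := by
    have := congrFun heq (Real.log d)
    simpa only [hel] using this
  have hpol : ∀ t ∈ Set.Icc 0 a, 0 < ρ (Real.log d, t) ∧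
      V d t = ρ (Real.log d, t) * Real.cos (Θ (Real.log d, t)) ∧
      U d t = ρ (Real.log d, t) * Real.sin (Θ (Real.log d, t)) := by
    intro t ht
    have := hΘ (Real.log d, t)
    simpa only [hel, hpre t ht] using this
  have c1 := aux_cross a (V d) (U d) (fun t => Θ (Real.log d, t)) (fun t => ρ (Real.log d, t))
    (hVd d) (hUd d) (by fun_prop) (hd d) hpol (by
      have := congrFun z1 (Real.log d)
      simp only [Pi.zero_apply] at this
      rw [this]; have := Real.pi_pos; linarith)
  refine ⟨by rw [← hda]; exact c1 a ⟨ha.le, le_rfl⟩, ?_⟩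
  intro hlow t ht
  have c2 := aux_cross' a (V d) (U d) (fun t => Θ (Real.log d, t)) (fun t => ρ (Real.log d, t))
    (hVd d) (hUd d) (by fun_prop) (hd d) hpol (by rw [hda]; exact hlow)
  obtain ⟨h1, h2, -⟩ := hpol t ht
  rw [h2]
  exact mul_pos h1 (Real.cos_pos_of_mem_Ioo ⟨c2 t ht, c1 t ht⟩)

theorem aux_C2 (f : ℝ → ℝ) (a b : ℝ) (hf : ContDiffOn ℝ 2 f (Set.Icc a b)) (t : ℝ)
    (ht : t ∈ Set.Ioo a b) : HasDerivAt f (deriv f t) t ∧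
      HasDerivAt (deriv f) (deriv (deriv f) t) t := by
  have h1 : ContDiffOn ℝ (1 + 1) f (Set.Ioo a b) := by
    rw [one_add_one_eq_two]; exact hf.mono Set.Ioo_subset_Icc_self
  rw [contDiffOn_succ_iff_deriv_of_isOpen isOpen_Ioo] at h1
  obtain ⟨h2, -, h3⟩ := h1
  have hn := isOpen_Ioo.mem_nhds ht
  exact ⟨(h2.differentiableAt hn).hasDerivAt,
    ((h3.differentiableOn one_ne_zero).differentiableAt hn).hasDerivAt⟩



/-- Lemma 4.5: the curves `R(d) = (θ(d), |I(d)|)` and `S(c) = (ϑ(c), |J(c)|)` in the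
argument–radius plane are injective and their images intersect only at `(0,1)`. -/
theorem shooting_curves_intersect_only_at_constant_solution
    (n ℓ m₁ m₂ : ℕ) (hn : 3 ≤ n) (hℓ : 1 ≤ ℓ) (hm₁ : 1 ≤ m₁) (hm₂ : 1 ≤ m₂)
    (hm₁n : m₁ < n - 1) (hm₂n : m₂ < n - 1)
    (p lam : ℝ) (hp : p = ((n : ℝ) + 2) / ((n : ℝ) - 2))
    (hlam : lam = (n : ℝ) * ((n : ℝ) - 2) / (4 * (ℓ : ℝ) ^ 2))
    (h : ℝ → ℝ)
    (hh : ∀ r : ℝ, h r = (((m₁ : ℝ) + (m₂ : ℝ)) / 2) * Real.cos r - ((m₂ : ℝ) - (m₁ : ℝ)) / 2)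
    (a₀ : ℝ) (ha₀ : a₀ ∈ Set.Ioo (0 : ℝ) Real.pi) (ha₀z : h a₀ = 0)
    -- forward family
    (W : ℝ → ℝ → ℝ)
    (hWC2 : ∀ d : ℝ, ContDiffOn ℝ 2 (W d) (Set.Icc 0 a₀))
    (hWode : ∀ d : ℝ, ∀ r ∈ Set.Ioc (0 : ℝ) a₀,
      deriv (deriv (W d)) r + (h r / Real.sin r) * deriv (W d) r
        + lam * (|W d r| ^ (p - 1) * W d r - W d r) = 0)
    (hW0 : ∀ d : ℝ, W d 0 = d) (hW'0 : ∀ d : ℝ, deriv (W d) 0 = 0)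
    (hWcont : Continuous fun q : ℝ × ℝ => (W q.1 q.2, deriv (W q.1) q.2))
    (hWuniq : ∀ d d' : ℝ, W d a₀ = W d' a₀ → deriv (W d) a₀ = deriv (W d') a₀ → d = d')
    (I : ℝ → ℝ × ℝ) (hI : ∀ d : ℝ, I d = (W d a₀, deriv (W d) a₀))
    (hInz : ∀ d : ℝ, d ≠ 0 → I d ≠ (0, 0))
    (θ : ℝ → ℝ) (hθc : ContinuousOn θ (Set.Ioi 0)) (hθ1 : θ 1 = 0)
    (hθ : ∀ d : ℝ, 0 < d →
      I d = (Real.sqrt ((I d).1 ^ 2 + (I d).2 ^ 2) * Real.cos (θ d),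
             Real.sqrt ((I d).1 ^ 2 + (I d).2 ^ 2) * Real.sin (θ d)))
    -- backward family
    (Wt : ℝ → ℝ → ℝ)
    (hWtC2 : ∀ c : ℝ, ContDiffOn ℝ 2 (Wt c) (Set.Icc a₀ Real.pi))
    (hWtode : ∀ c : ℝ, ∀ r ∈ Set.Ico a₀ Real.pi,
      deriv (deriv (Wt c)) r + (h r / Real.sin r) * deriv (Wt c) r
        + lam * (|Wt c r| ^ (p - 1) * Wt c r - Wt c r) = 0)
    (hWtπ : ∀ c : ℝ, Wt c Real.pi = c) (hWt'π : ∀ c : ℝ, deriv (Wt c) Real.pi = 0)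
    (hWtcont : Continuous fun q : ℝ × ℝ => (Wt q.1 q.2, deriv (Wt q.1) q.2))
    (hWtuniq : ∀ c c' : ℝ, Wt c a₀ = Wt c' a₀ → deriv (Wt c) a₀ = deriv (Wt c') a₀ → c = c')
    (J : ℝ → ℝ × ℝ) (hJ : ∀ c : ℝ, J c = (Wt c a₀, deriv (Wt c) a₀))
    (hJnz : ∀ c : ℝ, c ≠ 0 → J c ≠ (0, 0))
    (ϑ : ℝ → ℝ) (hϑc : ContinuousOn ϑ (Set.Ioi 0)) (hϑ1 : ϑ 1 = 0)
    (hϑ : ∀ c : ℝ, 0 < c →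
      J c = (Real.sqrt ((J c).1 ^ 2 + (J c).2 ^ 2) * Real.cos (ϑ c),
             Real.sqrt ((J c).1 ^ 2 + (J c).2 ^ 2) * Real.sin (ϑ c)))
    -- matching solutions glue to global solutions on [0,π]
    (hglue : ∀ d c : ℝ, 0 < d → 0 < c → I d = J c →
      ∃ w : ℝ → ℝ, ContDiffOn ℝ 2 w (Set.Icc 0 Real.pi) ∧
        (∀ r ∈ Set.Icc (0 : ℝ) a₀, w r = W d r) ∧
        (∀ r ∈ Set.Icc a₀ Real.pi, w r = Wt c r) ∧
        (∀ r ∈ Set.Ioo (0 : ℝ) Real.pi,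
          deriv (deriv w) r + (h r / Real.sin r) * deriv w r
            + lam * (|w r| ^ (p - 1) * w r - w r) = 0) ∧
        deriv w 0 = 0 ∧ deriv w Real.pi = 0)
    -- Obata/Aubin: positive solutions of the Yamabe equation on the round sphere are
    -- axially symmetric; since m₁, m₂ < n-1 the only positive solution of the reduced
    -- ODE with Neumann conditions is the constant 1
    (hObata : ∀ w : ℝ → ℝ, ContDiffOn ℝ 2 w (Set.Icc 0 Real.pi) →
      (∀ r ∈ Set.Ioo (0 : ℝ) Real.pi,
        deriv (deriv w) r + (h r / Real.sin r) * deriv w r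
          + lam * (|w r| ^ (p - 1) * w r - w r) = 0) →
      deriv w 0 = 0 → deriv w Real.pi = 0 →
      (∀ r ∈ Set.Icc (0 : ℝ) Real.pi, 0 < w r) →
      ∀ r ∈ Set.Icc (0 : ℝ) Real.pi, w r = 1) :
    Set.InjOn (fun d : ℝ => (θ d, Real.sqrt ((I d).1 ^ 2 + (I d).2 ^ 2))) (Set.Ici 1) ∧
    Set.InjOn (fun c : ℝ => (ϑ c, Real.sqrt ((J c).1 ^ 2 + (J c).2 ^ 2))) (Set.Ici 1) ∧
    ((fun d : ℝ => (θ d, Real.sqrt ((I d).1 ^ 2 + (I d).2 ^ 2))) '' Set.Ici 1) ∩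
        ((fun c : ℝ => (ϑ c, Real.sqrt ((J c).1 ^ 2 + (J c).2 ^ 2))) '' Set.Ici 1)
      = {((0 : ℝ), (1 : ℝ))} := by
  have hn' : (3 : ℝ) ≤ n := by exact_mod_cast hn
  have hℓ' : (1 : ℝ) ≤ ℓ := by exact_mod_cast hℓ
  have hlam0 : 0 < lam := by
    rw [hlam]
    have : (0 : ℝ) < (n : ℝ) - 2 := by linarith
    positivity
  have hq : 0 < p - 1 := by
    rw [hp, sub_pos, lt_div_iff₀ (by linarith)]
    linarith
  have hm : (0 : ℝ) < ((m₁ : ℝ) + (m₂ : ℝ)) / 2 := by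
    have : (1 : ℝ) ≤ m₁ := by exact_mod_cast hm₁
    positivity
  have hIp : ∀ d, 0 < d → (I d).1 = Real.sqrt ((I d).1 ^ 2 + (I d).2 ^ 2) * Real.cos (θ d) ∧
      (I d).2 = Real.sqrt ((I d).1 ^ 2 + (I d).2 ^ 2) * Real.sin (θ d) := fun d hd =>
    ⟨congrArg Prod.fst (hθ d hd), congrArg Prod.snd (hθ d hd)⟩
  have hJp : ∀ d, 0 < d → (J d).1 = Real.sqrt ((J d).1 ^ 2 + (J d).2 ^ 2) * Real.cos (ϑ d) ∧
      (J d).2 = Real.sqrt ((J d).1 ^ 2 + (J d).2 ^ 2) * Real.sin (ϑ d) := fun d hd =>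
    ⟨congrArg Prod.fst (hϑ d hd), congrArg Prod.snd (hϑ d hd)⟩
  have hWc1 : Continuous fun z : ℝ × ℝ => W z.1 z.2 := hWcont.fst
  have hWc2 : Continuous fun z : ℝ × ℝ => deriv (W z.1) z.2 := hWcont.snd
  have hTc1 : Continuous fun z : ℝ × ℝ => Wt z.1 z.2 := hWtcont.fst
  have hTc2 : Continuous fun z : ℝ × ℝ => deriv (Wt z.1) z.2 := hWtcont.snd
  have hIz : ∀ d, 0 < d → W d a₀ ≠ 0 ∨ deriv (W d) a₀ ≠ 0 := by
    intro d hd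
    by_contra hc
    push Not at hc
    exact hInz d hd.ne' (by rw [hI, hc.1, hc.2])
  have hJz : ∀ d, 0 < d → Wt d a₀ ≠ 0 ∨ deriv (Wt d) a₀ ≠ 0 := by
    intro d hd
    by_contra hc
    push Not at hc
    exact hJnz d hd.ne' (by rw [hJ, hc.1, hc.2])
  obtain ⟨f1, f2⟩ := aux_core a₀ lam (p - 1) ha₀.1 hlam0 hq (fun r => h r / Real.sin r) W
    (fun d r => deriv (W d) r)
    (by
      intro t ht
      apply div_nonneg
      · have hc := Real.cos_le_cos_of_nonneg_of_le_pi ht.1.le ha₀.2.le ht.2.le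
        rw [hh] at ha₀z ⊢
        have := mul_le_mul_of_nonneg_left hc hm.le
        linarith
      · exact (Real.sin_pos_of_pos_of_lt_pi ht.1 (ht.2.trans ha₀.2)).le)
    hWc1 hWc2 (fun d t ht => (aux_C2 _ _ _ (hWC2 d) t ht).1)
    (fun d t ht => (aux_C2 _ _ _ (hWC2 d) t ht).2.congr_deriv
      (by linarith [hWode d t ⟨ht.1, ht.2.le⟩]))
    hW0 hW'0 hIz θ hθc hθ1
    (by
      intro d hd
      have := hIp d hd
      rw [hI] at this
      exact this)
  obtain ⟨b1, b2⟩ := aux_core (Real.pi - a₀) lam (p - 1) (by linarith [ha₀.2]) hlam0 hq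
    (fun r => -h (Real.pi - r) / Real.sin (Real.pi - r))
    (fun c r => Wt c (Real.pi - r)) (fun c r => -deriv (Wt c) (Real.pi - r))
    (by
      intro t ht
      apply div_nonneg
      · have hc := Real.cos_le_cos_of_nonneg_of_le_pi (x := a₀) (y := Real.pi - t) ha₀.1.le
          (by linarith [ht.1]) (by linarith [ht.2])
        rw [hh] at ha₀z ⊢
        have := mul_le_mul_of_nonneg_left hc hm.le
        linarith
      · exact (Real.sin_pos_of_pos_of_lt_pi (by linarith [ht.2, ha₀.1]) (by linarith [ht.1])).le)
    (hTc1.comp (g := fun z : ℝ × ℝ => Wt z.1 z.2) (f := fun z : ℝ × ℝ => (z.1, Real.pi - z.2))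
      (by fun_prop))
    (hTc2.comp (g := fun z : ℝ × ℝ => deriv (Wt z.1) z.2)
      (f := fun z : ℝ × ℝ => (z.1, Real.pi - z.2)) (by fun_prop)).neg
    (by
      intro c t ht
      have h1 := (aux_C2 _ _ _ (hWtC2 c) (Real.pi - t)
        ⟨by linarith [ht.2], by linarith [ht.1]⟩).1
      exact (h1.comp t (by simpa using (hasDerivAt_id t).const_sub Real.pi :
        HasDerivAt (fun t : ℝ => Real.pi - t) (-1) t)).congr_deriv (by ring))
    (by
      intro c t ht
      have h1 := (aux_C2 _ _ _ (hWtC2 c) (Real.pi - t)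
        ⟨by linarith [ht.2], by linarith [ht.1]⟩).2
      have h2 := hWtode c (Real.pi - t) ⟨by linarith [ht.2], by linarith [ht.1]⟩
      refine ((h1.comp t (by simpa using (hasDerivAt_id t).const_sub Real.pi :
        HasDerivAt (fun t : ℝ => Real.pi - t) (-1) t)).neg).congr_deriv ?_
      linear_combination h2)
    (by simpa using hWtπ) (by simpa using hWt'π)
    (by simpa using hJz) (fun c => -ϑ c) hϑc.neg (by simp [hϑ1])
    (by
      intro d hd
      have := hJp d hd
      rw [hJ] at this
      simp only [sub_sub_cancel, Real.cos_neg, Real.sin_neg, neg_sq]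
      exact ⟨this.1, by linarith [this.2]⟩)
  simp only [sub_sub_cancel] at b1
  have I1 : I 1 = (1, 0) := by rw [hI, f1.1, f1.2]
  have J1 : J 1 = (1, 0) := by
    rw [hJ, b1.1, neg_eq_zero.1 b1.2]
  refine ⟨?_, ?_, ?_⟩
  · intro d hd d' hd' he
    simp only [Prod.mk.injEq] at he
    have hd : (1 : ℝ) ≤ d := hd
    have hd' : (1 : ℝ) ≤ d' := hd'
    have e : I d = I d' := by
      rw [hθ d (by linarith), hθ d' (by linarith), he.1, he.2]
    rw [hI, hI, Prod.mk.injEq] at e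
    exact hWuniq d d' e.1 e.2
  · intro d hd d' hd' he
    simp only [Prod.mk.injEq] at he
    have hd : (1 : ℝ) ≤ d := hd
    have hd' : (1 : ℝ) ≤ d' := hd'
    have e : J d = J d' := by
      rw [hϑ d (by linarith), hϑ d' (by linarith), he.1, he.2]
    rw [hJ, hJ, Prod.mk.injEq] at e
    exact hWtuniq d d' e.1 e.2
  · apply Set.Subset.antisymm
    · rintro x ⟨⟨d, hd, rfl⟩, ⟨c, hc, he⟩⟩
      simp only [Prod.mk.injEq] at he
      have hd : (1 : ℝ) ≤ d := hd
      have hc : (1 : ℝ) ≤ c := hc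
      have e : I d = J c := by
        rw [hθ d (by linarith), hϑ c (by linarith), he.1, he.2]
      obtain ⟨w, w1, w2, w3, w4, w5, w6⟩ := hglue d c (by linarith) (by linarith) e
      obtain ⟨g1, g2⟩ := f2 d (by linarith)
      obtain ⟨k1, k2⟩ := b2 c (by linarith)
      have p1 := g2 (by linarith [he.1])
      have p2 := k2 (by linarith [he.1])
      have hw := hObata w w1 w4 w5 w6 (by
        intro r hr
        rcases le_total r a₀ with hra | hra
        · rw [w2 r ⟨hr.1, hra⟩]; exact p1 r ⟨hr.1, hra⟩
        · rw [w3 r ⟨hra, hr.2⟩]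
          have := p2 (Real.pi - r) ⟨by linarith [hr.2], by linarith⟩
          simpa only [sub_sub_cancel] using this)
      have hd1 : d = 1 := by
        rw [← hW0 d, ← w2 0 ⟨le_rfl, ha₀.1.le⟩]
        exact hw 0 ⟨le_rfl, Real.pi_pos.le⟩
      subst hd1
      simp [I1, hθ1]
    · rintro x rfl
      exact ⟨⟨1, Set.mem_Ici.2 le_rfl, by simp [I1, hθ1]⟩, ⟨1, Set.mem_Ici.2 le_rfl, by simp [J1, hϑ1]⟩⟩
end
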